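/- For any recursively enumerable extension T of PA(K4), T has the modal disjunction property (MDP) if and only if T has the modal existence property (MEP). -/

import Mathlib

namespace ModalArith

/-- Terms of the language of arithmetic L_A = {0, S, +, ×, ≤, =}. -/
inductive Term : Type
  | var : ℕ → Term
  | zero : Term
  | succ : Term → Term
  | add : Term → Term → Term
  | mul : Term → Term → Term
  deriving DecidableEq

namespace Term

/-- Free variables of a term. -/
def fv : Term → Finset ℕ
  | var x => {x}
  | zero => ∅
  | succ t => fv t
  | add t u => fv t ∪ fv u
  | mul t u => fv t ∪ fv u

/-- Simultaneous substitution of terms for variables. -/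
def substAll : Term → (ℕ → Term) → Term
  | var x, v => v x
  | zero, _ => zero
  | succ t, v => succ (substAll t v)
  | add t u, v => add (substAll t v) (substAll u v)
  | mul t u, v => mul (substAll t v) (substAll u v)

/-- Substitution of the term `s` for the variable `x`. -/
def subst (x : ℕ) (s : Term) (t : Term) : Term :=
  substAll t (Function.update Term.var x s)

/-- The numeral `n̄`. -/
def numeral : ℕ → Term
  | 0 => zero
  | n + 1 => succ (numeral n)

/-- Value of a term in the standard model under a valuation. -/
def val : Term → (ℕ → ℕ) → ℕ
  | var x, v => v x
  | zero, _ => 0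
  | succ t, v => val t v + 1
  | add t u, v => val t v + val u v
  | mul t u, v => val t v * val u v

/-- A Gödel numbering of terms. -/
def code : Term → ℕ
  | var x => Nat.pair 0 x
  | zero => Nat.pair 1 0
  | succ t => Nat.pair 2 (code t)
  | add t u => Nat.pair 3 (Nat.pair (code t) (code u))
  | mul t u => Nat.pair 4 (Nat.pair (code t) (code u))

end Term

/-- Formulas of the language L_□ of modal arithmetic. -/
inductive Formula : Type
  | falsum : Formula
  | eq : Term → Term → Formula
  | le : Term → Term → Formula
  | and : Formula → Formula → Formula
  | or : Formula → Formula → Formula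
  | imp : Formula → Formula → Formula
  | neg : Formula → Formula
  | all : ℕ → Formula → Formula
  | ex : ℕ → Formula → Formula
  | box : Formula → Formula
  deriving DecidableEq

namespace Formula

/-- Free variables of a formula. -/
def fv : Formula → Finset ℕ
  | falsum => ∅
  | eq t u => t.fv ∪ u.fv
  | le t u => t.fv ∪ u.fv
  | and φ ψ => fv φ ∪ fv ψ
  | or φ ψ => fv φ ∪ fv ψ
  | imp φ ψ => fv φ ∪ fv ψ
  | neg φ => fv φ
  | all x φ => (fv φ).erase x
  | ex x φ => (fv φ).erase x
  | box φ => fv φ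

/-- Simultaneous substitution of terms for the free variables of a formula. -/
def substAll : Formula → (ℕ → Term) → Formula
  | falsum, _ => falsum
  | eq t u, v => eq (t.substAll v) (u.substAll v)
  | le t u, v => le (t.substAll v) (u.substAll v)
  | and φ ψ, v => and (substAll φ v) (substAll ψ v)
  | or φ ψ, v => or (substAll φ v) (substAll ψ v)
  | imp φ ψ, v => imp (substAll φ v) (substAll ψ v)
  | neg φ, v => neg (substAll φ v)
  | all x φ, v => all x (substAll φ (Function.update v x (Term.var x)))
  | ex x φ, v => ex x (substAll φ (Function.update v x (Term.var x)))
  | box φ, v => box (substAll φ v)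

/-- Substitution of the term `s` for the free occurrences of the variable `x`. -/
def subst (x : ℕ) (s : Term) (φ : Formula) : Formula :=
  substAll φ (Function.update Term.var x s)

/-- The term `s` is substitutable (free) for the variable `x` in the formula. -/
def freeFor (s : Term) (x : ℕ) : Formula → Prop
  | falsum => True
  | eq _ _ => True
  | le _ _ => True
  | and φ ψ => freeFor s x φ ∧ freeFor s x ψ
  | or φ ψ => freeFor s x φ ∧ freeFor s x ψ
  | imp φ ψ => freeFor s x φ ∧ freeFor s x ψ
  | neg φ => freeFor s x φ
  | all y φ => x = y ∨ x ∉ fv φ ∨ (y ∉ s.fv ∧ freeFor s x φ)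
  | ex y φ => x = y ∨ x ∉ fv φ ∨ (y ∉ s.fv ∧ freeFor s x φ)
  | box φ => freeFor s x φ

/-- The formula is an L_A-formula (contains no □). -/
def noBox : Formula → Prop
  | falsum => True
  | eq _ _ => True
  | le _ _ => True
  | and φ ψ => noBox φ ∧ noBox ψ
  | or φ ψ => noBox φ ∧ noBox ψ
  | imp φ ψ => noBox φ ∧ noBox ψ
  | neg φ => noBox φ
  | all _ φ => noBox φ
  | ex _ φ => noBox φ
  | box _ => False

/-- Truth in the standard model ℕ under a valuation (meaningful for L_A-formulas;
boxed formulas are given the dummy value `False`). -/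
def val : Formula → (ℕ → ℕ) → Prop
  | falsum, _ => False
  | eq t u, v => t.val v = u.val v
  | le t u, v => t.val v ≤ u.val v
  | and φ ψ, v => val φ v ∧ val ψ v
  | or φ ψ, v => val φ v ∨ val ψ v
  | imp φ ψ, v => val φ v → val ψ v
  | neg φ, v => ¬ val φ v
  | all x φ, v => ∀ n : ℕ, val φ (Function.update v x n)
  | ex x φ, v => ∃ n : ℕ, val φ (Function.update v x n)
  | box _, _ => False

/-- Biconditional, as an abbreviation. -/
def iff (φ ψ : Formula) : Formula := (φ.imp ψ).and (ψ.imp φ)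

/-- `t < u` abbreviates `S t ≤ u`. -/
def lt (t u : Term) : Formula := le (Term.succ t) u

/-- Bounded universal quantification `∀ x < t, φ`. -/
def ball (x : ℕ) (t : Term) (φ : Formula) : Formula :=
  all x ((lt (Term.var x) t).imp φ)

/-- Bounded existential quantification `∃ x < t, φ`. -/
def bex (x : ℕ) (t : Term) (φ : Formula) : Formula :=
  ex x ((lt (Term.var x) t).and φ)

/-- A Gödel numbering of formulas. -/
def code : Formula → ℕ
  | falsum => Nat.pair 0 0
  | eq t u => Nat.pair 1 (Nat.pair t.code u.code)
  | le t u => Nat.pair 2 (Nat.pair t.code u.code)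
  | and φ ψ => Nat.pair 3 (Nat.pair (code φ) (code ψ))
  | or φ ψ => Nat.pair 4 (Nat.pair (code φ) (code ψ))
  | imp φ ψ => Nat.pair 5 (Nat.pair (code φ) (code ψ))
  | neg φ => Nat.pair 6 (code φ)
  | all x φ => Nat.pair 7 (Nat.pair x (code φ))
  | ex x φ => Nat.pair 8 (Nat.pair x (code φ))
  | box φ => Nat.pair 9 (code φ)

end Formula

/-- A sentence is a formula with no free variables. -/
def Sentence (φ : Formula) : Prop := φ.fv = ∅

/-- Truth in the standard model ℕ (for sentences; any fixed valuation will do). -/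
def StdTrue (φ : Formula) : Prop := φ.val fun _ => 0

/-- The logical axioms of classical first-order logic with equality for L_□,
with the identity axioms only for atomic formulas. -/
inductive LogicalAxiom : Formula → Prop
  | imp1 (φ ψ : Formula) : LogicalAxiom (φ.imp (ψ.imp φ))
  | imp2 (φ ψ χ : Formula) :
      LogicalAxiom ((φ.imp (ψ.imp χ)).imp ((φ.imp ψ).imp (φ.imp χ)))
  | dne (φ : Formula) : LogicalAxiom (φ.neg.neg.imp φ)
  | negI (φ ψ : Formula) : LogicalAxiom ((φ.imp ψ).imp ((φ.imp ψ.neg).imp φ.neg))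
  | negE (φ ψ : Formula) : LogicalAxiom (φ.neg.imp (φ.imp ψ))
  | falsumE (φ : Formula) : LogicalAxiom (Formula.falsum.imp φ)
  | negIntro (φ : Formula) : LogicalAxiom ((φ.imp Formula.falsum).imp φ.neg)
  | negElimFalsum (φ : Formula) : LogicalAxiom (φ.neg.imp (φ.imp Formula.falsum))
  | andI (φ ψ : Formula) : LogicalAxiom (φ.imp (ψ.imp (φ.and ψ)))
  | andE1 (φ ψ : Formula) : LogicalAxiom ((φ.and ψ).imp φ)
  | andE2 (φ ψ : Formula) : LogicalAxiom ((φ.and ψ).imp ψ)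
  | orI1 (φ ψ : Formula) : LogicalAxiom (φ.imp (φ.or ψ))
  | orI2 (φ ψ : Formula) : LogicalAxiom (ψ.imp (φ.or ψ))
  | orE (φ ψ χ : Formula) :
      LogicalAxiom ((φ.imp χ).imp ((ψ.imp χ).imp ((φ.or ψ).imp χ)))
  | allE (x : ℕ) (t : Term) (φ : Formula) :
      φ.freeFor t x → LogicalAxiom ((Formula.all x φ).imp (φ.subst x t))
  | allImp (x : ℕ) (φ ψ : Formula) :
      x ∉ φ.fv → LogicalAxiom ((Formula.all x (φ.imp ψ)).imp (φ.imp (Formula.all x ψ)))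
  | exI (x : ℕ) (t : Term) (φ : Formula) :
      φ.freeFor t x → LogicalAxiom ((φ.subst x t).imp (Formula.ex x φ))
  | exE (x : ℕ) (φ ψ : Formula) :
      x ∉ ψ.fv → LogicalAxiom ((Formula.all x (φ.imp ψ)).imp ((Formula.ex x φ).imp ψ))
  | eqRefl (t : Term) : LogicalAxiom (Formula.eq t t)
  | eqSymm (t u : Term) : LogicalAxiom ((Formula.eq t u).imp (Formula.eq u t))
  | eqTrans (t u w : Term) :
      LogicalAxiom ((Formula.eq t u).imp ((Formula.eq u w).imp (Formula.eq t w)))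
  | eqSucc (t u : Term) :
      LogicalAxiom ((Formula.eq t u).imp (Formula.eq t.succ u.succ))
  | eqAdd (t₁ t₂ u₁ u₂ : Term) :
      LogicalAxiom ((Formula.eq t₁ t₂).imp ((Formula.eq u₁ u₂).imp
        (Formula.eq (t₁.add u₁) (t₂.add u₂))))
  | eqMul (t₁ t₂ u₁ u₂ : Term) :
      LogicalAxiom ((Formula.eq t₁ t₂).imp ((Formula.eq u₁ u₂).imp
        (Formula.eq (t₁.mul u₁) (t₂.mul u₂))))
  | eqLe (t₁ t₂ u₁ u₂ : Term) :
      LogicalAxiom ((Formula.eq t₁ t₂).imp ((Formula.eq u₁ u₂).imp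
        ((Formula.le t₁ u₁).imp (Formula.le t₂ u₂))))

/-- Provability in an L_□-theory: logical axioms, the axioms of the theory, and the
rules modus ponens, generalization, and necessitation. -/
inductive Provable (T : Set Formula) : Formula → Prop
  | ax {φ : Formula} : φ ∈ T → Provable T φ
  | logic {φ : Formula} : LogicalAxiom φ → Provable T φ
  | mp {φ ψ : Formula} : Provable T (φ.imp ψ) → Provable T φ → Provable T ψ
  | gen {φ : Formula} (x : ℕ) : Provable T φ → Provable T (Formula.all x φ)
  | nec {φ : Formula} : Provable T φ → Provable T (Formula.box φ)

/-- First-order provability (no necessitation rule); used for the non-modal theory PA. -/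
inductive FOProvable (T : Set Formula) : Formula → Prop
  | ax {φ : Formula} : φ ∈ T → FOProvable T φ
  | logic {φ : Formula} : LogicalAxiom φ → FOProvable T φ
  | mp {φ ψ : Formula} : FOProvable T (φ.imp ψ) → FOProvable T φ → FOProvable T ψ
  | gen {φ : Formula} (x : ℕ) : FOProvable T φ → FOProvable T (Formula.all x φ)

/-- Basic (Robinson-style) axioms of arithmetic. -/
def succNeZero : Formula := (Formula.eq (Term.succ (Term.var 0)) Term.zero).neg
def succInj : Formula :=
  (Formula.eq (Term.succ (Term.var 0)) (Term.succ (Term.var 1))).imp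
    (Formula.eq (Term.var 0) (Term.var 1))
def addZero : Formula := Formula.eq (Term.add (Term.var 0) Term.zero) (Term.var 0)
def addSucc : Formula :=
  Formula.eq (Term.add (Term.var 0) (Term.succ (Term.var 1)))
    (Term.succ (Term.add (Term.var 0) (Term.var 1)))
def mulZero : Formula := Formula.eq (Term.mul (Term.var 0) Term.zero) Term.zero
def mulSucc : Formula :=
  Formula.eq (Term.mul (Term.var 0) (Term.succ (Term.var 1)))
    (Term.add (Term.mul (Term.var 0) (Term.var 1)) (Term.var 0))
def leDef : Formula :=
  (Formula.le (Term.var 0) (Term.var 1)).iff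
    (Formula.ex 2 (Formula.eq (Term.add (Term.var 0) (Term.var 2)) (Term.var 1)))

def baseAxioms : Set Formula :=
  {succNeZero, succInj, addZero, addSucc, mulZero, mulSucc, leDef}

/-- The induction axiom for the formula `φ` and the variable `x`. -/
def inductionAx (x : ℕ) (φ : Formula) : Formula :=
  ((φ.subst x Term.zero).and
    (Formula.all x (φ.imp (φ.subst x (Term.succ (Term.var x)))))).imp
      (Formula.all x φ)

/-- Peano arithmetic PA: basic axioms plus induction for L_A-formulas. -/
def PA : Set Formula :=
  baseAxioms ∪ {χ | ∃ (x : ℕ) (φ : Formula), φ.noBox ∧ χ = inductionAx x φ}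

/-- PA_□ : basic axioms plus induction for all L_□-formulas. -/
def PABox : Set Formula :=
  baseAxioms ∪ {χ | ∃ (x : ℕ) (φ : Formula), χ = inductionAx x φ}

/-- The distribution axiom K. -/
def axK (φ ψ : Formula) : Formula :=
  (Formula.box (φ.imp ψ)).imp ((Formula.box φ).imp (Formula.box ψ))

/-- PA(K). -/
def PAK : Set Formula := PABox ∪ {χ | ∃ φ ψ : Formula, χ = axK φ ψ}

/-- The axiom 4. -/
def ax4 (φ : Formula) : Formula := (Formula.box φ).imp (Formula.box (Formula.box φ))

/-- PA(K4). -/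
def PAK4 : Set Formula := PAK ∪ {χ | ∃ φ : Formula, χ = ax4 φ}

/-- The axiom of Triv. -/
def axTriv (φ : Formula) : Formula := (Formula.box φ).iff φ

/-- PA(Triv). -/
def PATriv : Set Formula := PAK ∪ {χ | ∃ φ : Formula, χ = axTriv φ}

/-- PA(Ver). -/
def PAVer : Set Formula := PAK ∪ {Formula.box Formula.falsum}

/-- `T` extends `U`: every axiom of `U` is provable in `T`. -/
def Extends (T U : Set Formula) : Prop := ∀ φ ∈ U, Provable T φ

/-- Consistency. -/
def Consistent (T : Set Formula) : Prop := ¬ Provable T Formula.falsum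

/-- The class Δ₀ of bounded L_A-formulas. -/
inductive IsDelta0 : Formula → Prop
  | falsum : IsDelta0 Formula.falsum
  | eq (t u : Term) : IsDelta0 (Formula.eq t u)
  | le (t u : Term) : IsDelta0 (Formula.le t u)
  | and {φ ψ : Formula} : IsDelta0 φ → IsDelta0 ψ → IsDelta0 (φ.and ψ)
  | or {φ ψ : Formula} : IsDelta0 φ → IsDelta0 ψ → IsDelta0 (φ.or ψ)
  | imp {φ ψ : Formula} : IsDelta0 φ → IsDelta0 ψ → IsDelta0 (φ.imp ψ)
  | neg {φ : Formula} : IsDelta0 φ → IsDelta0 φ.neg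
  | ball {x : ℕ} {t : Term} {φ : Formula} :
      x ∉ t.fv → IsDelta0 φ → IsDelta0 (Formula.ball x t φ)
  | bex {x : ℕ} {t : Term} {φ : Formula} :
      x ∉ t.fv → IsDelta0 φ → IsDelta0 (Formula.bex x t φ)

/-- The class Σ₁ of L_A-formulas. -/
inductive IsSigma1 : Formula → Prop
  | delta0 {φ : Formula} : IsDelta0 φ → IsSigma1 φ
  | and {φ ψ : Formula} : IsSigma1 φ → IsSigma1 ψ → IsSigma1 (φ.and ψ)
  | or {φ ψ : Formula} : IsSigma1 φ → IsSigma1 ψ → IsSigma1 (φ.or ψ)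
  | ex {x : ℕ} {φ : Formula} : IsSigma1 φ → IsSigma1 (Formula.ex x φ)
  | ball {x : ℕ} {t : Term} {φ : Formula} :
      x ∉ t.fv → IsSigma1 φ → IsSigma1 (Formula.ball x t φ)

/-- The class B of boxed formulas. -/
def IsB (φ : Formula) : Prop := ∃ ψ : Formula, φ = Formula.box ψ

/-- The class ΔB. -/
inductive IsDeltaB : Formula → Prop
  | delta0 {φ : Formula} : IsDelta0 φ → IsDeltaB φ
  | b (ψ : Formula) : IsDeltaB (Formula.box ψ)
  | and {φ ψ : Formula} : IsDeltaB φ → IsDeltaB ψ → IsDeltaB (φ.and ψ)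
  | or {φ ψ : Formula} : IsDeltaB φ → IsDeltaB ψ → IsDeltaB (φ.or ψ)
  | ball {x : ℕ} {t : Term} {φ : Formula} :
      x ∉ t.fv → IsDeltaB φ → IsDeltaB (Formula.ball x t φ)
  | bex {x : ℕ} {t : Term} {φ : Formula} :
      x ∉ t.fv → IsDeltaB φ → IsDeltaB (Formula.bex x t φ)

/-- The class ΣB. -/
inductive IsSigmaB : Formula → Prop
  | sigma1 {φ : Formula} : IsSigma1 φ → IsSigmaB φ
  | b (ψ : Formula) : IsSigmaB (Formula.box ψ)
  | and {φ ψ : Formula} : IsSigmaB φ → IsSigmaB ψ → IsSigmaB (φ.and ψ)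
  | or {φ ψ : Formula} : IsSigmaB φ → IsSigmaB ψ → IsSigmaB (φ.or ψ)
  | ex {x : ℕ} {φ : Formula} : IsSigmaB φ → IsSigmaB (Formula.ex x φ)
  | ball {x : ℕ} {t : Term} {φ : Formula} :
      x ∉ t.fv → IsSigmaB φ → IsSigmaB (Formula.ball x t φ)

/-- Iterated disjunction (the empty disjunction is ⊥). -/
def disj : List Formula → Formula
  | [] => Formula.falsum
  | [φ] => φ
  | φ :: ψ :: l => φ.or (disj (ψ :: l))

/-- Iterated conjunction (the empty conjunction is ⊤). -/
def conj : List Formula → Formula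
  | [] => Formula.falsum.neg
  | [φ] => φ
  | φ :: ψ :: l => φ.and (conj (ψ :: l))

/-- Γ-disjunction property. -/
def HasDP (T : Set Formula) (Γ : Formula → Prop) : Prop :=
  ∀ φ ψ : Formula, Γ φ → Γ ψ → Sentence φ → Sentence ψ →
    Provable T (φ.or ψ) → Provable T φ ∨ Provable T ψ

/-- (Γ, Θ)-disjunction property. -/
def HasDP2 (T : Set Formula) (Γ Θ : Formula → Prop) : Prop :=
  ∀ φ ψ : Formula, Γ φ → Θ ψ → Sentence φ → Sentence ψ →
    Provable T (φ.or ψ) → Provable T φ ∨ Provable T ψ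

/-- Γ-existence property. -/
def HasEP (T : Set Formula) (Γ : Formula → Prop) : Prop :=
  ∀ (x : ℕ) (φ : Formula), Γ φ → φ.fv ⊆ {x} →
    Provable T (Formula.ex x φ) → ∃ n : ℕ, Provable T (φ.subst x (Term.numeral n))

/-- Modal disjunction property. -/
def HasMDP (T : Set Formula) : Prop :=
  ∀ φ ψ : Formula, Sentence φ → Sentence ψ →
    Provable T ((Formula.box φ).or (Formula.box ψ)) → Provable T φ ∨ Provable T ψ

/-- Modal existence property. -/
def HasMEP (T : Set Formula) : Prop :=
  ∀ (x : ℕ) (φ : Formula), φ.fv ⊆ {x} →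
    Provable T (Formula.ex x (Formula.box φ)) →
      ∃ n : ℕ, Provable T (φ.subst x (Term.numeral n))

/-- n-fold B-disjunction property. -/
def HasBnDP (T : Set Formula) (n : ℕ) : Prop :=
  ∀ φ : Fin n → Formula, (∀ i, Sentence (φ i)) →
    Provable T (disj (List.ofFn fun i => Formula.box (φ i))) →
    ∃ i, Provable T (Formula.box (φ i))

/-- Σ₁-soundness. -/
def Sigma1Sound (T : Set Formula) : Prop :=
  ∀ φ : Formula, IsSigma1 φ → Sentence φ → Provable T φ → StdTrue φ

/-- L_A-soundness. -/
def LASound (T : Set Formula) : Prop :=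
  ∀ φ : Formula, φ.noBox → Sentence φ → Provable T φ → StdTrue φ

/-- `T` is recursively enumerable (via the Gödel numbering of formulas). -/
def RE (T : Set Formula) : Prop :=
  Nat.Partrec fun n => Part.assert (∃ φ ∈ T, Formula.code φ = n) fun _ => Part.some 0

/-- A fixed natural Σ₁ provability predicate `Pr_T(x)` for the theory `T`:
a Σ₁ L_A-formula with only the free variable `0` which numerates provability in `T`
in the standard model and satisfies the standard derivability conditions
(provably in PA). -/
structure ProvPred (T : Set Formula) where
  pr : Formula
  noBox : pr.noBox
  sigma1 : IsSigma1 pr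
  fvSub : pr.fv ⊆ {0}
  numerates : ∀ φ : Formula,
    StdTrue (pr.subst 0 (Term.numeral φ.code)) ↔ Provable T φ
  d1 : ∀ φ : Formula, Provable T φ → FOProvable PA (pr.subst 0 (Term.numeral φ.code))
  d2 : ∀ φ ψ : Formula,
    FOProvable PA ((pr.subst 0 (Term.numeral (φ.imp ψ).code)).imp
      ((pr.subst 0 (Term.numeral φ.code)).imp (pr.subst 0 (Term.numeral ψ.code))))
  necClosed : ∀ φ : Formula,
    FOProvable PA ((pr.subst 0 (Term.numeral φ.code)).imp
      (pr.subst 0 (Term.numeral (Formula.box φ).code)))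

/-- `Pr_T(⌜φ⌝)`. -/
def ProvPred.app {T : Set Formula} (P : ProvPred T) (φ : Formula) : Formula :=
  P.pr.subst 0 (Term.numeral φ.code)

/-- Γ-disjunctive correctness (Γ-DC). -/
def DC (T : Set Formula) (P : ProvPred T) (Γ : Formula → Prop) : Prop :=
  ∀ φ : Formula, Γ φ → Sentence φ → Provable T (φ.or (P.app φ)) → Provable T φ

/-- The substitution replacing each variable by the numeral of its value. -/
def numeralSubst (v : ℕ → ℕ) : ℕ → Term := fun x => Term.numeral (v x)

/-- Standard-model satisfaction of the ρ_T-translation: `ρ_T` is the identity on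
L_A-formulas, commutes with connectives and quantifiers, and sends `□φ(x⃗)` to
`Pr_T(⌜□φ(ẋ⃗)⌝)`, whose truth in ℕ (for a natural provability predicate) amounts to
provability in `T` of `□φ(n̄⃗)`. -/
def RhoSat (T : Set Formula) : Formula → (ℕ → ℕ) → Prop
  | .falsum, _ => False
  | .eq t u, v => t.val v = u.val v
  | .le t u, v => t.val v ≤ u.val v
  | .and φ ψ, v => RhoSat T φ v ∧ RhoSat T ψ v
  | .or φ ψ, v => RhoSat T φ v ∨ RhoSat T ψ v
  | .imp φ ψ, v => RhoSat T φ v → RhoSat T ψ v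
  | .neg φ, v => ¬ RhoSat T φ v
  | .all x φ, v => ∀ n : ℕ, RhoSat T φ (Function.update v x n)
  | .ex x φ, v => ∃ n : ℕ, RhoSat T φ (Function.update v x n)
  | .box φ, v => Provable T (Formula.box (φ.substAll (numeralSubst v)))

/-- Standard-model satisfaction of the π_T-translation: `π_T` is the identity on
L_A-formulas, commutes with connectives and quantifiers, and sends `□φ(x⃗)` to
`Pr_T(⌜φ(ẋ⃗)⌝)`, whose truth in ℕ (for a natural provability predicate) amounts to
provability in `T` of `φ(n̄⃗)`. -/
def PiSat (T : Set Formula) : Formula → (ℕ → ℕ) → Prop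
  | .falsum, _ => False
  | .eq t u, v => t.val v = u.val v
  | .le t u, v => t.val v ≤ u.val v
  | .and φ ψ, v => PiSat T φ v ∧ PiSat T ψ v
  | .or φ ψ, v => PiSat T φ v ∨ PiSat T ψ v
  | .imp φ ψ, v => PiSat T φ v → PiSat T ψ v
  | .neg φ, v => ¬ PiSat T φ v
  | .all x φ, v => ∀ n : ℕ, PiSat T φ (Function.update v x n)
  | .ex x φ, v => ∃ n : ℕ, PiSat T φ (Function.update v x n)
  | .box φ, v => Provable T (φ.substAll (numeralSubst v))

/-- Weak ΣB-soundness: every provable ΣB sentence is true in ℕ under ρ_T. -/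
def WeaklySigmaBSound (T : Set Formula) : Prop :=
  ∀ φ : Formula, IsSigmaB φ → Sentence φ → Provable T φ → RhoSat T φ fun _ => 0

/-- ΣB-soundness: every provable ΣB sentence is true in ℕ under π_T. -/
def SigmaBSound (T : Set Formula) : Prop :=
  ∀ φ : Formula, IsSigmaB φ → Sentence φ → Provable T φ → PiSat T φ fun _ => 0

end ModalArith

namespace ModalArith

set_option linter.unusedSimpArgs false
set_option linter.unusedVariables false

/-! ### Bounded formulas and definability in the standard model -/

/-- A minimal class of bounded formulas. -/
inductive D0 : Formula → Prop
  | eq (t u : Term) : D0 (Formula.eq t u)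
  | neg {φ : Formula} : D0 φ → D0 φ.neg
  | and {φ ψ : Formula} : D0 φ → D0 ψ → D0 (φ.and ψ)
  | ball {x : ℕ} {t : Term} {φ : Formula} : x ∉ t.fv → D0 φ → D0 (Formula.ball x t φ)

/-- Predicates on valuations defined by a bounded formula. -/
def DD (P : (ℕ → ℕ) → Prop) : Prop := ∃ φ, D0 φ ∧ ∀ v, φ.val v ↔ P v

theorem Term.val_congr (t : Term) (v w : ℕ → ℕ) (h : ∀ x ∈ t.fv, v x = w x) :
    t.val v = t.val w := by
  induction t with
  | var x => exact h x (by simp [Term.fv])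
  | zero => rfl
  | succ t ih => simp only [Term.val]; rw [ih h]
  | add t u iht ihu =>
    simp only [Term.val]
    rw [iht fun x hx => h x (by simp [Term.fv, hx]), ihu fun x hx => h x (by simp [Term.fv, hx])]
  | mul t u iht ihu =>
    simp only [Term.val]
    rw [iht fun x hx => h x (by simp [Term.fv, hx]), ihu fun x hx => h x (by simp [Term.fv, hx])]

theorem Term.val_update (t : Term) (v : ℕ → ℕ) (x n : ℕ) (h : x ∉ t.fv) :
    t.val (Function.update v x n) = t.val v := by
  apply Term.val_congr
  intro y hy
  have : y ≠ x := by rintro rfl; exact h hy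
  simp [this]

theorem val_ball (x : ℕ) (t : Term) (φ : Formula) (h : x ∉ t.fv) (v : ℕ → ℕ) :
    (Formula.ball x t φ).val v ↔ ∀ n < t.val v, φ.val (Function.update v x n) := by
  simp only [Formula.ball, Formula.lt, Formula.val, Term.val, Function.update_self,
    Term.val_update _ _ _ _ h]
  rfl

namespace DD

theorem congr {P Q : (ℕ → ℕ) → Prop} (h : DD P) (e : ∀ v, P v ↔ Q v) : DD Q := by
  obtain ⟨φ, h1, h2⟩ := h
  exact ⟨φ, h1, fun v => (h2 v).trans (e v)⟩

theorem eq (t u : Term) : DD (fun v => t.val v = u.val v) :=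
  ⟨_, D0.eq t u, fun _ => Iff.rfl⟩

theorem neg {P : (ℕ → ℕ) → Prop} (h : DD P) : DD (fun v => ¬ P v) := by
  obtain ⟨φ, h1, h2⟩ := h
  exact ⟨_, h1.neg, fun v => not_congr (h2 v)⟩

theorem and {P Q : (ℕ → ℕ) → Prop} (h : DD P) (k : DD Q) : DD (fun v => P v ∧ Q v) := by
  obtain ⟨φ, h1, h2⟩ := h
  obtain ⟨ψ, k1, k2⟩ := k
  exact ⟨_, h1.and k1, fun v => and_congr (h2 v) (k2 v)⟩

theorem or {P Q : (ℕ → ℕ) → Prop} (h : DD P) (k : DD Q) : DD (fun v => P v ∨ Q v) :=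
  ((h.neg.and k.neg).neg).congr fun v => by tauto

theorem ball (x : ℕ) (t : Term) (hx : x ∉ t.fv) {P : (ℕ → ℕ) → Prop} (h : DD P) :
    DD (fun v => ∀ n < t.val v, P (Function.update v x n)) := by
  obtain ⟨φ, h1, h2⟩ := h
  refine ⟨_, D0.ball hx h1, fun v => ?_⟩
  rw [val_ball _ _ _ hx]
  simp only [h2]

theorem bex (x : ℕ) (t : Term) (hx : x ∉ t.fv) {P : (ℕ → ℕ) → Prop} (h : DD P) :
    DD (fun v => ∃ n < t.val v, P (Function.update v x n)) :=
  ((h.neg.ball x t hx).neg).congr fun v => by push Not; rfl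

theorem lt (i j : ℕ) : DD (fun v => v i < v j) := by
  have hx : (i + j + 1) ∉ (Term.var j).fv := by simp [Term.fv]; omega
  refine ((DD.eq (Term.var (i + j + 1)) (Term.var i)).bex (i+j+1) (Term.var j) hx).congr ?_
  intro v
  have h1 : i ≠ i + j + 1 := by omega
  simp [Term.val, h1]

end DD

/-- Binary bounded relations. -/
def D2 (Q : ℕ → ℕ → Prop) : Prop := ∀ i j, i ≠ j → DD (fun v => Q (v i) (v j))

/-- Sigma-one sets of natural numbers. -/
def SD (P : ℕ → Prop) : Prop :=
  ∃ Q : ℕ → ℕ → Prop, D2 Q ∧ (∀ z z' c, z ≤ z' → Q z c → Q z' c) ∧ ∀ c, P c ↔ ∃ z, Q z c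

/-- First projection. -/
def lft (n : ℕ) : ℕ := n.unpair.1
/-- Second projection. -/
def rgt (n : ℕ) : ℕ := n.unpair.2

@[simp] theorem lft_pair (a b : ℕ) : lft (Nat.pair a b) = a := by simp [lft]
@[simp] theorem rgt_pair (a b : ℕ) : rgt (Nat.pair a b) = b := by simp [rgt]
@[simp] theorem pair_lft_rgt (a : ℕ) : Nat.pair (lft a) (rgt a) = a := by simp [lft, rgt]

theorem eq_pair_iff (c a b : ℕ) : c = Nat.pair a b ↔ lft c = a ∧ rgt c = b := by
  constructor
  · rintro rfl; simp
  · rintro ⟨rfl, rfl⟩; simp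

theorem DD.pair (i j k : ℕ) : DD (fun v => v k = Nat.pair (v i) (v j)) := by
  have A := (DD.lt i j).and
    (DD.eq (.var k) (.add (.mul (.var j) (.var j)) (.var i)))
  have B := (DD.lt i j).neg.and
    (DD.eq (.var k) (.add (.add (.mul (.var i) (.var i)) (.var i)) (.var j)))
  refine (A.or B).congr fun v => ?_
  simp only [Term.val, Nat.pair]
  split_ifs with h <;> simp [h]

namespace SD

theorem congr {P Q : ℕ → Prop} (h : SD P) (e : ∀ v, P v ↔ Q v) : SD Q := by
  have : P = Q := funext fun v => propext (e v)
  exact this ▸ h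

theorem ofDD {P : ℕ → Prop} (h : ∀ j, DD (fun v => P (v j))) : SD P :=
  ⟨fun _ c => P c, fun _ j _ => h j, fun _ _ _ _ h => h, fun c => by simp⟩

theorem and {P Q : ℕ → Prop} (h : SD P) (k : SD Q) : SD (fun v => P v ∧ Q v) := by
  obtain ⟨P', h1, h2, h3⟩ := h
  obtain ⟨Q', k1, k2, k3⟩ := k
  refine ⟨fun z c => P' z c ∧ Q' z c, fun i j hij => (h1 i j hij).and (k1 i j hij),
    fun z z' c hz hh => ⟨h2 _ _ _ hz hh.1, k2 _ _ _ hz hh.2⟩, fun c => ?_⟩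
  change P c ∧ Q c ↔ _
  rw [h3, k3]
  constructor
  · rintro ⟨⟨z, hz⟩, ⟨w, hw⟩⟩
    exact ⟨max z w, h2 _ _ _ (le_max_left _ _) hz, k2 _ _ _ (le_max_right _ _) hw⟩
  · rintro ⟨z, hz⟩
    exact ⟨⟨z, hz.1⟩, ⟨z, hz.2⟩⟩

theorem or {P Q : ℕ → Prop} (h : SD P) (k : SD Q) : SD (fun v => P v ∨ Q v) := by
  obtain ⟨P', h1, h2, h3⟩ := h
  obtain ⟨Q', k1, k2, k3⟩ := k
  refine ⟨fun z c => P' z c ∨ Q' z c, fun i j hij => (h1 i j hij).or (k1 i j hij),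
    fun z z' c hz hh => hh.imp (h2 _ _ _ hz) (k2 _ _ _ hz), fun c => ?_⟩
  change P c ∨ Q c ↔ _
  rw [h3, k3, exists_or]

theorem ex {P : ℕ → ℕ → Prop} (h : SD (fun p => P (lft p) (rgt p))) :
    SD (fun c => ∃ n, P c n) := by
  obtain ⟨Q, h1, h2, h3⟩ := h
  refine ⟨fun z c => ∃ n < z, ∃ p < z, p = Nat.pair c n ∧ Q z p, ?_, ?_, ?_⟩
  · intro i j hij
    have h4 : i + j + 1 ≠ i := by omega
    have h5 : i + j + 1 ≠ j := by omega
    have h6 : i + j + 2 ≠ i := by omega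
    have h7 : i + j + 2 ≠ j := by omega
    have A := (((DD.pair j (i+j+1) (i+j+2)).and (h1 i (i+j+2) h6.symm)).bex (i+j+2) (.var i)
      (by simpa [Term.fv] using h6)).bex (i+j+1) (.var i) (by simpa [Term.fv] using h4)
    refine A.congr fun v => ?_
    simp [Term.val, h4.symm, h5.symm, h6.symm, h7.symm]
  · rintro z z' c hz ⟨n, hn, p, hp, e, hq⟩
    exact ⟨n, by omega, p, by omega, e, h2 _ _ _ hz hq⟩
  · intro c
    constructor
    · rintro ⟨n, hn⟩
      have := (h3 (Nat.pair c n)).1 (by simpa using hn)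
      obtain ⟨z, hz⟩ := this
      refine ⟨max z (max (n+1) (Nat.pair c n + 1)), n, by omega, Nat.pair c n, by omega, rfl, ?_⟩
      exact h2 _ _ _ (le_max_left _ _) hz
    · rintro ⟨z, n, _, p, _, rfl, hq⟩
      exact ⟨n, by simpa using (h3 (Nat.pair c n)).2 ⟨z, hq⟩⟩

theorem ball0 {P : ℕ → ℕ → Prop} (h : SD (fun p => P (lft p) (rgt p))) :
    SD (fun c => ∀ i < rgt c, P (lft c) i) := by
  obtain ⟨Q, h1, h2, h3⟩ := h
  refine ⟨fun z c => ∃ a < z, ∃ b < z, c = Nat.pair a b ∧ ∀ i < b, ∃ p < z,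
    p = Nat.pair a i ∧ Q z p, ?_, ?_, ?_⟩
  · intro i j hij
    obtain ⟨k, hk⟩ : ∃ k, k = i + j + 1 := ⟨_, rfl⟩
    have e1 : i ≠ k := by omega
    have e2 : j ≠ k := by omega
    have e3 : i ≠ k + 1 := by omega
    have e4 : j ≠ k + 1 := by omega
    have e5 : i ≠ k + 2 := by omega
    have e6 : j ≠ k + 2 := by omega
    have e7 : i ≠ k + 3 := by omega
    have e8 : j ≠ k + 3 := by omega
    have A1 := ((DD.pair k (k+2) (k+3)).and (h1 i (k+3) e7)).bex (k+3) (.var i)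
      (by simpa [Term.fv] using e7.symm)
    have A2 := A1.ball (k+2) (.var (k+1)) (by simp [Term.fv])
    have A3 := (((DD.pair k (k+1) j).and A2).bex (k+1) (.var i)
      (by simpa [Term.fv] using e3.symm)).bex k (.var i) (by simpa [Term.fv] using e1.symm)
    refine A3.congr fun v => ?_
    simp [Term.val, e1, e2, e3, e4, e5, e6, e7, e8]
  · rintro z z' c hz ⟨a, ha, b, hb, e, H⟩
    refine ⟨a, by omega, b, by omega, e, fun i hi => ?_⟩
    obtain ⟨p, hp, hp', hq⟩ := H i hi
    exact ⟨p, by omega, hp', h2 _ _ _ hz hq⟩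
  · intro c
    constructor
    · intro H
      have : ∀ b, (∀ i < b, P (lft c) i) → ∃ z, ∀ i < b, ∃ p < z,
          p = Nat.pair (lft c) i ∧ Q z p := by
        intro b
        induction b with
        | zero => intro _; exact ⟨0, by simp⟩
        | succ b ih =>
          intro H
          obtain ⟨z, hz⟩ := ih fun i hi => H i (by omega)
          obtain ⟨w, hw⟩ := (h3 (Nat.pair (lft c) b)).1 (by simpa using H b (by omega))
          refine ⟨max z (max w (Nat.pair (lft c) b + 1)), fun i hi => ?_⟩
          rcases Nat.lt_succ_iff_lt_or_eq.1 hi with hi | rfl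
          · obtain ⟨p, hp, hp', hq⟩ := hz i hi
            exact ⟨p, by omega, hp', h2 _ _ _ (by omega) hq⟩
          · exact ⟨_, by omega, rfl, h2 _ _ _ (by omega) hw⟩
      obtain ⟨z, hz⟩ := this _ H
      refine ⟨max z (max (lft c + 1) (rgt c + 1)), lft c, by omega, rgt c, by omega, by simp,
        fun i hi => ?_⟩
      obtain ⟨p, hp, hp', hq⟩ := hz i hi
      exact ⟨p, by omega, hp', h2 _ _ _ (by omega) hq⟩
    · rintro ⟨z, a, _, b, _, rfl, H⟩ i hi
      obtain ⟨p, hp, rfl, hq⟩ := H i (by simpa using hi)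
      simpa using (h3 _).2 ⟨z, hq⟩

end SD

/-- Functions with sigma-one graph. -/
@[fun_prop]
def EF (f : ℕ → ℕ) : Prop := SD (fun p => rgt p = f (lft p))

theorem SD.comp {P : ℕ → Prop} (h : SD P) {f : ℕ → ℕ} (hf : EF f) : SD (fun c => P (f c)) := by
  -- `P` weakened to the second component
  have hr : SD (fun p => P (rgt p)) := by
    obtain ⟨Q, h1, h2, h3⟩ := h
    refine ⟨fun z c => ∃ a < z, ∃ b < z, c = Nat.pair a b ∧ Q z b, ?_, ?_, ?_⟩
    · intro i j hij
      obtain ⟨k, hk⟩ : ∃ k, k = i + j + 1 := ⟨_, rfl⟩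
      have e1 : i ≠ k := by omega
      have e2 : j ≠ k := by omega
      have e3 : i ≠ k + 1 := by omega
      have e4 : j ≠ k + 1 := by omega
      refine ((((DD.pair k (k+1) j).and (h1 i (k+1) e3)).bex (k+1) (.var i)
        (by simpa [Term.fv] using e3.symm)).bex k (.var i)
        (by simpa [Term.fv] using e1.symm)).congr fun v => ?_
      simp [Term.val, e1, e2, e3, e4]
    · rintro z z' c hz ⟨a, ha, b, hb, e, H⟩
      exact ⟨a, by omega, b, by omega, e, h2 _ _ _ hz H⟩
    · intro c
      change P (rgt c) ↔ _
      rw [h3]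
      constructor
      · rintro ⟨z, hz⟩
        exact ⟨max z (max (lft c + 1) (rgt c + 1)), lft c, by omega, rgt c, by omega, by simp,
          h2 _ _ _ (by omega) hz⟩
      · rintro ⟨z, a, _, b, _, rfl, H⟩
        exact ⟨z, by simpa using H⟩
  have := SD.ex (P := fun c n => n = f c ∧ P n) (SD.and hf hr)
  exact this.congr fun c => by simp

theorem SD.of3 {R : ℕ → ℕ → ℕ → Prop}
    (h : ∀ i j k, i ≠ j → i ≠ k → j ≠ k → DD (fun v => R (v i) (v j) (v k))) :
    SD (fun p => R (lft (lft p)) (rgt (lft p)) (rgt p)) := by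
  refine ⟨fun z c => ∃ a < z, ∃ b < z, ∃ d < z, ∃ e < z, c = Nat.pair d e ∧ d = Nat.pair a b
    ∧ R a b e, ?_, ?_, ?_⟩
  · intro i j hij
    obtain ⟨k, hk⟩ : ∃ k, k = i + j + 1 := ⟨_, rfl⟩
    have e1 : i ≠ k := by omega
    have e2 : j ≠ k := by omega
    have e3 : i ≠ k + 1 := by omega
    have e4 : j ≠ k + 1 := by omega
    have e5 : i ≠ k + 2 := by omega
    have e6 : j ≠ k + 2 := by omega
    have e7 : i ≠ k + 3 := by omega
    have e8 : j ≠ k + 3 := by omega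
    refine (((((((DD.pair (k+2) (k+3) j).and ((DD.pair k (k+1) (k+2)).and
      (h k (k+1) (k+3) (by omega) (by omega) (by omega)))).bex (k+3) (.var i)
        (by simpa [Term.fv] using e7.symm)).bex (k+2) (.var i)
        (by simpa [Term.fv] using e5.symm))).bex (k+1) (.var i)
        (by simpa [Term.fv] using e3.symm)).bex k (.var i)
        (by simpa [Term.fv] using e1.symm)).congr fun v => ?_
    simp [Term.val, e1, e2, e3, e4, e5, e6, e7, e8]
  · rintro z z' c hz ⟨a, ha, b, hb, d, hd, e, he, H⟩
    exact ⟨a, by omega, b, by omega, d, by omega, e, by omega, H⟩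
  · intro c
    constructor
    · intro H
      exact ⟨lft (lft c) + rgt (lft c) + lft c + rgt c + 1, lft (lft c), by omega,
        rgt (lft c), by omega, lft c, by omega, rgt c, by omega, by simp, by simp, H⟩
    · rintro ⟨z, a, _, b, _, d, _, e, _, rfl, rfl, H⟩
      simpa using H

theorem SD.of2 {R : ℕ → ℕ → Prop} (h : ∀ i j, i ≠ j → DD (fun v => R (v i) (v j))) :
    SD (fun p => R (lft p) (rgt p)) := by
  refine ⟨fun z c => ∃ a < z, ∃ b < z, c = Nat.pair a b ∧ R a b, ?_, ?_, ?_⟩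
  · intro i j hij
    obtain ⟨k, hk⟩ : ∃ k, k = i + j + 1 := ⟨_, rfl⟩
    have e1 : i ≠ k := by omega
    have e2 : j ≠ k := by omega
    have e3 : i ≠ k + 1 := by omega
    have e4 : j ≠ k + 1 := by omega
    refine ((((DD.pair k (k+1) j).and (h k (k+1) (by omega))).bex (k+1) (.var i)
        (by simpa [Term.fv] using e3.symm)).bex k (.var i)
        (by simpa [Term.fv] using e1.symm)).congr fun v => ?_
    simp [Term.val, e1, e2, e3, e4]
  · rintro z z' c hz ⟨a, ha, b, hb, H⟩
    exact ⟨a, by omega, b, by omega, H⟩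
  · intro c
    constructor
    · intro H
      exact ⟨lft c + rgt c + 1, lft c, by omega, rgt c, by omega, by simp, H⟩
    · rintro ⟨z, a, _, b, _, rfl, H⟩
      simpa using H

namespace EF

@[fun_prop]
theorem id : EF (fun c => c) :=
  SD.of2 (R := fun a b => b = a) fun i j _ => DD.eq (.var j) (.var i)

@[fun_prop]
theorem const (n : ℕ) : EF (fun _ => n) := by
  refine SD.of2 (R := fun a b => b = n) fun i j _ => ?_
  refine (DD.eq (.var j) (Term.numeral n)).congr fun v => ?_
  have : ∀ n, (Term.numeral n).val v = n := by
    intro n; induction n with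
    | zero => rfl
    | succ n ih => simp [Term.numeral, Term.val, ih]
  simp [Term.val, this]

@[fun_prop]
theorem comp {f g : ℕ → ℕ} (hf : EF f) (hg : EF g) : EF (fun c => f (g c)) := by
  -- graph: exists m with m = g c and y = f m
  obtain ⟨Qg, g1, g2, g3⟩ := hg
  obtain ⟨Qf, f1, f2, f3⟩ := hf
  refine ⟨fun z p => ∃ a < z, ∃ b < z, ∃ m < z, ∃ p1 < z, ∃ p2 < z,
    p = Nat.pair a b ∧ p1 = Nat.pair a m ∧ p2 = Nat.pair m b ∧ Qg z p1 ∧ Qf z p2, ?_, ?_, ?_⟩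
  · intro i j hij
    obtain ⟨k, hk⟩ : ∃ k, k = i + j + 1 := ⟨_, rfl⟩
    have e1 : i ≠ k := by omega
    have e2 : j ≠ k := by omega
    have e3 : i ≠ k + 1 := by omega
    have e4 : j ≠ k + 1 := by omega
    have e5 : i ≠ k + 2 := by omega
    have e6 : j ≠ k + 2 := by omega
    have e7 : i ≠ k + 3 := by omega
    have e8 : j ≠ k + 3 := by omega
    have e9 : i ≠ k + 4 := by omega
    have e10 : j ≠ k + 4 := by omega
    refine ((((((((DD.pair k (k+1) j).and ((DD.pair k (k+2) (k+3)).and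
      ((DD.pair (k+2) (k+1) (k+4)).and ((g1 i (k+3) e7).and (f1 i (k+4) e9))))).bex (k+4) (.var i)
        (by simpa [Term.fv] using e9.symm)).bex (k+3) (.var i)
        (by simpa [Term.fv] using e7.symm)).bex (k+2) (.var i)
        (by simpa [Term.fv] using e5.symm))).bex (k+1) (.var i)
        (by simpa [Term.fv] using e3.symm)).bex k (.var i)
        (by simpa [Term.fv] using e1.symm)).congr fun v => ?_
    simp [Term.val, e1, e2, e3, e4, e5, e6, e7, e8, e9, e10]
  · rintro z z' c hz ⟨a, ha, b, hb, m, hm, p, hp, q, hq, h1, h2, h3, h4, h5⟩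
    exact ⟨a, by omega, b, by omega, m, by omega, p, by omega, q, by omega, h1, h2, h3,
      g2 _ _ _ hz h4, f2 _ _ _ hz h5⟩
  · intro c
    constructor
    · intro H
      obtain ⟨z, hz⟩ := (g3 (Nat.pair (lft c) (g (lft c)))).1 (by simp)
      obtain ⟨w, hw⟩ := (f3 (Nat.pair (g (lft c)) (rgt c))).1 (by simpa using H)
      exact ⟨z + w + lft c + rgt c + g (lft c) + Nat.pair (lft c) (g (lft c)) +
        Nat.pair (g (lft c)) (rgt c) + 1, lft c, by omega, rgt c, by omega, g (lft c), by omega,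
        _, by omega, _, by omega, by simp, rfl, rfl, g2 _ _ _ (by omega) hz,
        f2 _ _ _ (by omega) hw⟩
    · rintro ⟨z, a, _, b, _, m, _, p1, _, p2, _, rfl, rfl, rfl, h1, h2⟩
      have e1 := (g3 _).2 ⟨z, h1⟩
      have e2 := (f3 _).2 ⟨z, h2⟩
      simp at e1 e2 ⊢
      rw [e2, e1]

@[fun_prop]
theorem lft' : EF lft := by
  refine SD.of2 (R := fun a b => b = lft a) fun i j hij => ?_
  obtain ⟨k, hk⟩ : ∃ k, k = i + j + 1 := ⟨_, rfl⟩
  have e1 : i ≠ k := by omega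
  have e2 : j ≠ k := by omega
  refine ((DD.pair j k i).bex k (.succ (.var i))
    (by simpa [Term.fv] using e1.symm)).congr fun v => ?_
  simp only [Term.val, Function.update_self, Function.update_of_ne e1, Function.update_of_ne e2]
  constructor
  · rintro ⟨n, _, h⟩; rw [h]; simp
  · intro h; exact ⟨rgt (v i), Nat.lt_succ_of_le (Nat.unpair_right_le _), by rw [h]; simp⟩

@[fun_prop]
theorem rgt' : EF rgt := by
  refine SD.of2 (R := fun a b => b = rgt a) fun i j hij => ?_
  obtain ⟨k, hk⟩ : ∃ k, k = i + j + 1 := ⟨_, rfl⟩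
  have e1 : i ≠ k := by omega
  have e2 : j ≠ k := by omega
  refine ((DD.pair k j i).bex k (.succ (.var i))
    (by simpa [Term.fv] using e1.symm)).congr fun v => ?_
  simp only [Term.val, Function.update_self, Function.update_of_ne e1, Function.update_of_ne e2]
  constructor
  · rintro ⟨n, _, h⟩; rw [h]; simp
  · intro h; exact ⟨lft (v i), Nat.lt_succ_of_le (Nat.unpair_left_le _), by rw [h]; simp⟩

@[fun_prop]
theorem l {f : ℕ → ℕ} (hf : EF f) : EF (fun c => lft (f c)) := lft'.comp hf
@[fun_prop]
theorem r {f : ℕ → ℕ} (hf : EF f) : EF (fun c => rgt (f c)) := rgt'.comp hf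

end EF

theorem SD.eq {f g : ℕ → ℕ} (hf : EF f) (hg : EF g) : SD (fun c => f c = g c) := by
  have h1 : SD (fun p => rgt p = f (lft p)) := hf
  have h2 : SD (fun p => rgt p = g (lft p)) := hg
  exact (SD.ex (P := fun c n => n = f c ∧ n = g c) (h1.and h2)).congr fun c => by simp

theorem SD.app2 {R : ℕ → ℕ → Prop} (hR : SD (fun p => R (lft p) (rgt p))) {f g : ℕ → ℕ}
    (hf : EF f) (hg : EF g) : SD (fun c => R (f c) (g c)) := by
  have A : SD (fun c => ∃ p, (lft p = f c ∧ rgt p = g c) ∧ R (lft p) (rgt p)) := by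
    refine SD.ex (SD.and (SD.and ?_ ?_) ?_)
    · exact SD.eq EF.rgt'.l (hf.comp EF.lft')
    · exact SD.eq EF.rgt'.r (hg.comp EF.lft')
    · exact SD.comp hR EF.rgt'
  refine A.congr fun c => ⟨?_, fun h => ⟨Nat.pair (f c) (g c), by simpa using h⟩⟩
  rintro ⟨p, ⟨h1, h2⟩, h3⟩
  rwa [h1, h2] at h3

namespace EF

@[fun_prop]
theorem pair {f g : ℕ → ℕ} (hf : EF f) (hg : EF g) : EF (fun c => Nat.pair (f c) (g c)) := by
  have : SD (fun p => lft (rgt p) = f (lft p) ∧ rgt (rgt p) = g (lft p)) :=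
    SD.and (SD.eq EF.rgt'.l (hf.comp EF.lft')) (SD.eq EF.rgt'.r (hg.comp EF.lft'))
  exact this.congr fun c => (eq_pair_iff _ _ _).symm

theorem bin {F : ℕ → ℕ → ℕ}
    (h : ∀ i j k, i ≠ j → i ≠ k → j ≠ k → DD (fun v => v k = F (v i) (v j))) {f g : ℕ → ℕ}
    (hf : EF f) (hg : EF g) : EF (fun c => F (f c) (g c)) := by
  have A : EF (fun p => F (lft p) (rgt p)) := SD.of3 (R := fun a b c => c = F a b) h
  have := A.comp (hf.pair hg)
  simpa using this

@[fun_prop]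
theorem add {f g : ℕ → ℕ} (hf : EF f) (hg : EF g) : EF (fun c => f c + g c) :=
  bin (F := fun a b => a + b) (fun i j k _ _ _ => DD.eq (.var k) (.add (.var i) (.var j))) hf hg

@[fun_prop]
theorem mul {f g : ℕ → ℕ} (hf : EF f) (hg : EF g) : EF (fun c => f c * g c) :=
  bin (F := fun a b => a * b) (fun i j k _ _ _ => DD.eq (.var k) (.mul (.var i) (.var j))) hf hg

end EF

theorem SD.lt {f g : ℕ → ℕ} (hf : EF f) (hg : EF g) : SD (fun c => f c < g c) :=
  SD.app2 (R := fun a b => a < b) (SD.of2 fun i j _ => DD.lt i j) hf hg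

theorem SD.ne {f g : ℕ → ℕ} (hf : EF f) (hg : EF g) : SD (fun c => f c ≠ g c) :=
  SD.app2 (R := fun a b => a ≠ b) (SD.of2 fun i j _ => (DD.eq (.var i) (.var j)).neg) hf hg

theorem SD.ball {P : ℕ → ℕ → Prop} (h : SD (fun p => P (lft p) (rgt p))) {f : ℕ → ℕ} (hf : EF f) :
    SD (fun c => ∀ i < f c, P c i) := by
  have := (SD.ball0 h).comp (EF.id.pair hf)
  simpa using this

@[fun_prop]
theorem EF.beta {f g : ℕ → ℕ} (hf : EF f) (hg : EF g) : EF (fun c => Nat.beta (f c) (g c)) := by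
  have A : EF (fun p => Nat.beta (lft p) (rgt p)) := by
    have : SD (fun p => ∃ q, (lft (lft (lft p)) =
        q * ((rgt (lft p) + 1) * rgt (lft (lft p)) + 1) + rgt p) ∧
        rgt p < (rgt (lft p) + 1) * rgt (lft (lft p)) + 1) := by
      exact SD.ex (SD.and (SD.eq (by fun_prop) (by fun_prop)) (SD.lt (by fun_prop) (by fun_prop)))
    refine this.congr fun p => ?_
    obtain ⟨m, hm⟩ : ∃ m, m = (rgt (lft p) + 1) * rgt (lft (lft p)) + 1 := ⟨_, rfl⟩
    have e : Nat.beta (lft (lft p)) (rgt (lft p)) = lft (lft (lft p)) % m := by rw [hm]; rfl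
    change _ ↔ rgt p = Nat.beta (lft (lft p)) (rgt (lft p))
    rw [e, ← hm]
    constructor
    · rintro ⟨q, h1, h2⟩
      rw [h1, Nat.mul_add_mod_self_right, Nat.mod_eq_of_lt h2]
    · intro h
      have hpos : 0 < m := by omega
      refine ⟨lft (lft (lft p)) / m, ?_, ?_⟩
      · rw [h, mul_comm]; exact (Nat.div_add_mod _ _).symm
      · rw [h]; exact Nat.mod_lt _ hpos
  have := A.comp (hf.pair hg)
  simpa using this

attribute [irreducible] EF SD

end ModalArith

namespace ModalArith
set_option linter.unusedSimpArgs false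
set_option linter.unusedVariables false

theorem SD.app3 {R : ℕ → ℕ → ℕ → Prop} (hR : SD (fun p => R (lft p) (lft (rgt p)) (rgt (rgt p))))
    {f g h : ℕ → ℕ} (hf : EF f) (hg : EF g) (hh : EF h) : SD (fun c => R (f c) (g c) (h c)) := by
  have := hR.comp (hf.pair (hg.pair hh))
  simpa using this

theorem exists_beta (s : ℕ → ℕ) (n : ℕ) : ∃ c, ∀ i < n, Nat.beta c i = s i := by
  refine ⟨Nat.unbeta ((List.range n).map s), fun i hi => ?_⟩
  have := Nat.beta_unbeta_coe ((List.range n).map s) ⟨i, by simpa using hi⟩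
  simpa using this

/-! ### Inductive definitions are sigma-one -/

/-- Least set closed under axioms `A` and two-premise rules `R`. -/
inductive Lfp (A : ℕ → Prop) (R : ℕ → ℕ → ℕ → Prop) : ℕ → Prop
  | base {x : ℕ} : A x → Lfp A R x
  | step {x y z : ℕ} : R x y z → Lfp A R y → Lfp A R z → Lfp A R x

/-- A derivation sequence. -/
def IsDer (A : ℕ → Prop) (R : ℕ → ℕ → ℕ → Prop) (s : ℕ → ℕ) (n : ℕ) : Prop :=
  ∀ i < n, A (s i) ∨ ∃ j, ∃ k, (j < i ∧ k < i) ∧ R (s i) (s j) (s k)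

theorem IsDer.lfp {A : ℕ → Prop} {R : ℕ → ℕ → ℕ → Prop} {s : ℕ → ℕ} {n : ℕ} (h : IsDer A R s n) :
    ∀ i < n, Lfp A R (s i) := by
  intro i
  induction i using Nat.strong_induction_on with
  | _ i ih =>
    intro hi
    rcases h i hi with h | ⟨j, k, ⟨hj, hk⟩, h⟩
    · exact .base h
    · exact .step h (ih j hj (by omega)) (ih k hk (by omega))

theorem IsDer.append {A : ℕ → Prop} {R : ℕ → ℕ → ℕ → Prop} {s t : ℕ → ℕ} {n m : ℕ}
    (h : IsDer A R s n) (k : IsDer A R t m) :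
    IsDer A R (fun i => if i < n then s i else t (i - n)) (n + m) := by
  intro i hi
  by_cases hn : i < n
  · rcases h i hn with h | ⟨a, b, ⟨ha, hb⟩, h⟩
    · left; simpa [hn] using h
    · right; refine ⟨a, b, ⟨ha, hb⟩, ?_⟩
      have h1 : a < n := by omega
      have h2 : b < n := by omega
      simpa [hn, h1, h2] using h
  · rcases k (i - n) (by omega) with h | ⟨a, b, ⟨ha, hb⟩, h⟩
    · left; simpa [hn] using h
    · right; refine ⟨n + a, n + b, ⟨by omega, by omega⟩, ?_⟩
      simpa [hn] using h

theorem Lfp.der {A : ℕ → Prop} {R : ℕ → ℕ → ℕ → Prop} {x : ℕ} (h : Lfp A R x) :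
    ∃ s n, IsDer A R s (n + 1) ∧ s n = x := by
  induction h with
  | @base x h => exact ⟨fun _ => x, 0, fun i _ => Or.inl h, rfl⟩
  | @step x y z hR _ _ ihy ihz =>
    obtain ⟨s, n, hs, rfl⟩ := ihy
    obtain ⟨t, m, ht, rfl⟩ := ihz
    obtain ⟨u, hu⟩ : ∃ u, u = fun i => if i < n + 1 then s i else t (i - (n + 1)) := ⟨_, rfl⟩
    have H := hs.append ht
    rw [← hu] at H
    have h1 : u n = s n := by simp [hu]
    have h2 : u (n + 1 + m) = t m := by
      simp [hu]; intro h; omega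
    refine ⟨fun i => if i < n + 1 + (m + 1) then u i else x, n + 1 + (m + 1), ?_, by simp⟩
    intro i hi
    by_cases hn : i < n + 1 + (m + 1)
    · rcases H i hn with h | ⟨a, b, ⟨ha, hb⟩, h⟩
      · left; simpa [hn] using h
      · right; refine ⟨a, b, ⟨ha, hb⟩, ?_⟩
        have h1 : a < n + 1 + (m + 1) := by omega
        have h2 : b < n + 1 + (m + 1) := by omega
        simpa only [hn, h1, h2, if_true] using h
    · right
      refine ⟨n, n + 1 + m, ⟨by omega, by omega⟩, ?_⟩
      have h3 : n < n + 1 + (m + 1) := by omega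
      have h4 : n + 1 + m < n + 1 + (m + 1) := by omega
      simp only [hn, h3, h4, if_true, if_false, h1, h2]
      exact hR

theorem SD.lfp {A : ℕ → Prop} {R : ℕ → ℕ → ℕ → Prop} (hA : SD A)
    (hR : SD (fun p => R (lft p) (lft (rgt p)) (rgt (rgt p)))) : SD (Lfp A R) := by
  have key : SD (fun x => ∃ c, ∃ n, Nat.beta c n = x ∧ ∀ i < n + 1, A (Nat.beta c i) ∨
      ∃ j, ∃ k, (j < i ∧ k < i) ∧ R (Nat.beta c i) (Nat.beta c j) (Nat.beta c k)) := by
    refine SD.ex (SD.ex (SD.and (SD.eq (by fun_prop) (by fun_prop))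
      (SD.ball (SD.or (SD.comp hA (by fun_prop)) (SD.ex (SD.ex (SD.and (SD.and
        (SD.lt (by fun_prop) (by fun_prop)) (SD.lt (by fun_prop) (by fun_prop)))
        (SD.app3 hR (by fun_prop) (by fun_prop) (by fun_prop)))))) (by fun_prop))))
  refine key.congr fun x => ⟨?_, fun h => ?_⟩
  · rintro ⟨c, n, rfl, h⟩
    exact IsDer.lfp (s := Nat.beta c) h n (by omega)
  · obtain ⟨s, n, hs, rfl⟩ := h.der
    obtain ⟨c, hc⟩ := exists_beta s (n + 1)
    refine ⟨c, n, hc n (by omega), fun i hi => ?_⟩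
    rcases hs i hi with h | ⟨j, k, ⟨hj, hk⟩, h⟩
    · left; rwa [hc i hi]
    · right; refine ⟨j, k, ⟨hj, hk⟩, ?_⟩
      rwa [hc i hi, hc j (by omega), hc k (by omega)]

/-! ### Partial recursive functions have sigma-one graphs -/

theorem SD.partrec {f : ℕ →. ℕ} (hf : Nat.Partrec f) : SD (fun p => rgt p ∈ f (lft p)) := by
  induction hf with
  | zero =>
    refine (SD.eq (f := rgt) (g := fun _ => 0) (by fun_prop) (by fun_prop)).congr fun p => ?_
    simp [pure, PFun.pure]
  | succ =>
    refine (SD.eq (f := rgt) (g := fun p => lft p + 1) (by fun_prop) (by fun_prop)).congr fun p => ?_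
    simp [Nat.succ_eq_add_one]
  | left =>
    refine (SD.eq (f := rgt) (g := fun p => lft (lft p)) (by fun_prop) (by fun_prop)).congr fun p => ?_
    simp [lft]
  | right =>
    refine (SD.eq (f := rgt) (g := fun p => rgt (lft p)) (by fun_prop) (by fun_prop)).congr fun p => ?_
    simp [rgt, lft]
  | @pair f g hf hg ihf ihg =>
    have : SD (fun p => lft (rgt p) ∈ f (lft p) ∧ rgt (rgt p) ∈ g (lft p)) :=
      SD.and (SD.app2 (R := fun a b => b ∈ f a) ihf (by fun_prop) (by fun_prop))
        (SD.app2 (R := fun a b => b ∈ g a) ihg (by fun_prop) (by fun_prop))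
    refine this.congr fun p => ?_
    simp only [Seq.seq, Part.bind_eq_bind, Part.mem_bind_iff, Part.map_eq_map, Part.mem_map_iff]
    constructor
    · rintro ⟨h1, h2⟩
      exact ⟨_, ⟨_, h1, rfl⟩, _, h2, by simp⟩
    · rintro ⟨_, ⟨a, h1, rfl⟩, b, h2, h⟩
      rw [← h]; simp [h1, h2]
  | @comp f g hf hg ihf ihg =>
    have : SD (fun p => ∃ m, m ∈ g (lft p) ∧ rgt p ∈ f m) :=
      SD.ex (SD.and (SD.app2 (R := fun a b => b ∈ g a) ihg (by fun_prop) (by fun_prop))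
        (SD.app2 (R := fun a b => b ∈ f a) ihf (by fun_prop) (by fun_prop)))
    refine this.congr fun p => ?_
    exact (Part.mem_bind_iff (f := g (lft p)) (g := f)).symm
  | @prec f g hf hg ihf ihg =>
    have : SD (fun p => ∃ c, Nat.beta c 0 ∈ f (lft (lft p)) ∧ rgt p = Nat.beta c (rgt (lft p)) ∧
        ∀ i < rgt (lft p), Nat.beta c (i + 1) ∈
          g (Nat.pair (lft (lft p)) (Nat.pair i (Nat.beta c i)))) :=
      SD.ex (SD.and (SD.app2 (R := fun a b => b ∈ f a) ihf (by fun_prop) (by fun_prop))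
        (SD.and (SD.eq (by fun_prop) (by fun_prop)) (SD.ball
          (SD.app2 (R := fun a b => b ∈ g a) ihg (by fun_prop) (by fun_prop)) (by fun_prop))))
    refine this.congr fun p => ?_
    have key : ∀ a n y, y ∈ (Nat.rec (f a) (fun y IH => IH.bind fun i =>
          g (Nat.pair a (Nat.pair y i))) n : Part ℕ) ↔
        ∃ s : ℕ → ℕ, s 0 ∈ f a ∧ y = s n ∧
          ∀ i < n, s (i + 1) ∈ g (Nat.pair a (Nat.pair i (s i))) := by
      intro a n
      induction n with
      | zero =>
        intro y
        constructor
        · intro h; exact ⟨fun _ => y, h, rfl, by simp⟩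
        · rintro ⟨s, h, rfl, _⟩; exact h
      | succ n ih =>
        intro y
        simp only [Part.mem_bind_iff, ih]
        constructor
        · rintro ⟨_, ⟨s, h0, rfl, hs⟩, hy⟩
          refine ⟨fun i => if i < n + 1 then s i else y, by simpa using h0, by simp, ?_⟩
          intro i hi
          rcases Nat.lt_succ_iff_lt_or_eq.1 hi with h | rfl
          · have h2 : i < n + 1 := by omega
            simpa [h, h2] using hs i h
          · simpa using hy
        · rintro ⟨s, h0, rfl, hs⟩
          exact ⟨s n, ⟨s, h0, rfl, fun i hi => hs i (by omega)⟩, hs n (by omega)⟩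
    have e := key (lft (lft p)) (rgt (lft p)) (rgt p)
    refine Iff.trans ?_ e.symm
    constructor
    · rintro ⟨c, h⟩; exact ⟨Nat.beta c, h⟩
    · rintro ⟨s, h0, h1, h2⟩
      obtain ⟨c, hc⟩ := exists_beta s (rgt (lft p) + 1)
      refine ⟨c, ?_, ?_, fun i hi => ?_⟩
      · rwa [hc 0 (by omega)]
      · rwa [hc _ (by omega)]
      · rw [hc _ (by omega), hc _ (by omega)]; exact h2 i hi
  | @rfind f hf ihf =>
    have : SD (fun p => 0 ∈ f (Nat.pair (lft p) (rgt p)) ∧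
        ∀ i < rgt p, ∃ w, w + 1 ∈ f (Nat.pair (lft p) i)) :=
      SD.and (SD.app2 (R := fun a b => b ∈ f a) ihf (by fun_prop) (by fun_prop))
        (SD.ball (SD.ex (SD.app2 (R := fun a b => b ∈ f a) ihf (by fun_prop) (by fun_prop)))
          (by fun_prop))
    refine this.congr fun p => ?_
    refine Iff.trans ?_ Nat.mem_rfind.symm
    simp only [Part.map_eq_map, Part.mem_map_iff]
    refine and_congr ?_ (forall_congr' fun i => forall_congr' fun hi => ?_)
    · constructor
      · intro h; exact ⟨0, h, by simp⟩
      · rintro ⟨a, h, e⟩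
        have : a = 0 := by simpa using e
        rwa [this] at h
    · constructor
      · rintro ⟨w, h⟩; exact ⟨_, h, by simp⟩
      · rintro ⟨a, h, e⟩
        have : a ≠ 0 := by simpa using e
        exact ⟨a - 1, by rwa [Nat.sub_add_cancel (Nat.pos_of_ne_zero this)]⟩

theorem SD.ofRE {T : Set Formula} (h : RE T) : SD (fun c => ∃ φ ∈ T, Formula.code φ = c) := by
  have := (SD.partrec h).comp (f := fun c => Nat.pair c 0) (by fun_prop)
  refine this.congr fun c => ?_
  simp [Part.assert, Part.mem_eq]

end ModalArith

namespace ModalArith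
set_option linter.unusedSimpArgs false
set_option linter.unusedVariables false

/-! ### Basic syntactic lemmas -/

theorem Term.substAll_congr {t : Term} {v w : ℕ → Term} (h : ∀ x ∈ t.fv, v x = w x) :
    t.substAll v = t.substAll w := by
  induction t with
  | var x => exact h x (by simp [Term.fv])
  | zero => rfl
  | succ t ih => simp only [Term.substAll]; rw [ih h]
  | add t u iht ihu =>
    simp only [Term.substAll]
    rw [iht fun x hx => h x (by simp [Term.fv, hx]), ihu fun x hx => h x (by simp [Term.fv, hx])]
  | mul t u iht ihu =>
    simp only [Term.substAll]
    rw [iht fun x hx => h x (by simp [Term.fv, hx]), ihu fun x hx => h x (by simp [Term.fv, hx])]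

@[simp] theorem Term.substAll_var (t : Term) : t.substAll Term.var = t := by
  induction t <;> simp_all [Term.substAll]

theorem Term.subst_not_fv {t s : Term} {x : ℕ} (h : x ∉ t.fv) : Term.subst x s t = t := by
  unfold Term.subst
  refine (Term.substAll_congr (w := Term.var) ?_).trans (Term.substAll_var t)
  intro y hy
  rw [Function.update_of_ne]
  rintro rfl; exact h hy

theorem Formula.substAll_congr {φ : Formula} {v w : ℕ → Term} (h : ∀ x ∈ φ.fv, v x = w x) :
    φ.substAll v = φ.substAll w := by
  induction φ generalizing v w with
  | falsum => rfl
  | eq t u =>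
    simp only [Formula.substAll]
    rw [Term.substAll_congr fun x hx => h x (by simp [Formula.fv, hx]),
      Term.substAll_congr (t := u) fun x hx => h x (by simp [Formula.fv, hx])]
  | le t u =>
    simp only [Formula.substAll]
    rw [Term.substAll_congr fun x hx => h x (by simp [Formula.fv, hx]),
      Term.substAll_congr (t := u) fun x hx => h x (by simp [Formula.fv, hx])]
  | and φ ψ ihφ ihψ | or φ ψ ihφ ihψ | imp φ ψ ihφ ihψ =>
    simp only [Formula.substAll]
    rw [ihφ fun x hx => h x (by simp [Formula.fv, hx]),
      ihψ fun x hx => h x (by simp [Formula.fv, hx])]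
  | neg φ ih | box φ ih =>
    simp only [Formula.substAll]
    rw [ih fun x hx => h x (by simpa [Formula.fv] using hx)]
  | all y φ ih | ex y φ ih =>
    simp only [Formula.substAll]
    rw [ih fun x hx => ?_]
    by_cases hxy : x = y
    · subst hxy; simp
    · rw [Function.update_of_ne hxy, Function.update_of_ne hxy]
      exact h x (by simp [Formula.fv, hx, hxy])

@[simp] theorem Formula.substAll_var (φ : Formula) : φ.substAll Term.var = φ := by
  induction φ <;> simp_all [Formula.substAll]

theorem Formula.subst_not_fv {φ : Formula} {s : Term} {x : ℕ} (h : x ∉ φ.fv) :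
    φ.subst x s = φ := by
  unfold Formula.subst
  refine (Formula.substAll_congr (w := Term.var) ?_).trans (Formula.substAll_var φ)
  intro y hy
  rw [Function.update_of_ne]
  rintro rfl; exact h hy

theorem Formula.freeFor_not_fv {φ : Formula} {s : Term} {x : ℕ} (h : x ∉ φ.fv) :
    φ.freeFor s x := by
  induction φ <;> simp_all [Formula.freeFor, Formula.fv] <;> grind

theorem Formula.subst_all_same (x : ℕ) (s : Term) (φ : Formula) :
    (Formula.all x φ).subst x s = Formula.all x φ :=
  Formula.subst_not_fv (by simp [Formula.fv])

theorem Formula.subst_ex_same (x : ℕ) (s : Term) (φ : Formula) :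
    (Formula.ex x φ).subst x s = Formula.ex x φ :=
  Formula.subst_not_fv (by simp [Formula.fv])

theorem Formula.subst_all_ne {x y : ℕ} (h : y ≠ x) (s : Term) (φ : Formula) :
    (Formula.all y φ).subst x s = Formula.all y (φ.subst x s) := by
  simp only [Formula.subst, Formula.substAll]
  congr 2
  rw [Function.update_eq_self_iff, Function.update_of_ne h]

theorem Formula.subst_ex_ne {x y : ℕ} (h : y ≠ x) (s : Term) (φ : Formula) :
    (Formula.ex y φ).subst x s = Formula.ex y (φ.subst x s) := by
  simp only [Formula.subst, Formula.substAll]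
  congr 2
  rw [Function.update_eq_self_iff, Function.update_of_ne h]

theorem Term.code_inj {t u : Term} : t.code = u.code ↔ t = u := by
  refine ⟨fun h => ?_, fun h => h ▸ rfl⟩
  induction t generalizing u <;> cases u <;> simp_all [Term.code, Nat.pair_eq_pair] <;> grind

theorem Formula.code_inj {φ ψ : Formula} : φ.code = ψ.code ↔ φ = ψ := by
  refine ⟨fun h => ?_, fun h => h ▸ rfl⟩
  induction φ generalizing ψ <;> cases ψ <;>
    simp_all [Formula.code, Nat.pair_eq_pair, Term.code_inj] <;> grind

theorem Term.numeral_fv (n : ℕ) : (Term.numeral n).fv = ∅ := by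
  induction n with
  | zero => rfl
  | succ n ih => simpa [Term.numeral, Term.fv] using ih

theorem Formula.freeFor_closed {s : Term} (h : s.fv = ∅) (x : ℕ) (φ : Formula) :
    φ.freeFor s x := by
  induction φ <;> simp_all [Formula.freeFor]

/-! ### Sigma-one description of the syntax -/

def NTp (x c : ℕ) : Prop := ∃ t : Term, t.code = c ∧ x ∉ t.fv
def NFp (x c : ℕ) : Prop := ∃ φ : Formula, φ.code = c ∧ x ∉ φ.fv

theorem SD.nt : SD (fun p => NTp (lft p) (rgt p)) := by
  have h : SD (Lfp
      (fun p => ∃ x y, (p = Nat.pair x (Nat.pair 0 y) ∧ x ≠ y) ∨ p = Nat.pair x (Nat.pair 1 0))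
      (fun p q r => ∃ x a b, q = Nat.pair x a ∧ r = Nat.pair x b ∧
        (p = Nat.pair x (Nat.pair 2 a) ∨ p = Nat.pair x (Nat.pair 3 (Nat.pair a b)) ∨
          p = Nat.pair x (Nat.pair 4 (Nat.pair a b))))) := by
    apply SD.lfp
    all_goals repeat' first | apply SD.ex | apply SD.and | apply SD.or | apply SD.eq | apply SD.ne
    all_goals fun_prop
  refine h.congr fun p => ⟨fun h => ?_, ?_⟩
  · induction h with
    | base h =>
      obtain ⟨x, y, ⟨rfl, h⟩ | rfl⟩ := h
      · exact ⟨.var y, by simp [Term.code], by simpa [Term.fv] using h⟩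
      · exact ⟨.zero, by simp [Term.code], by simp [Term.fv]⟩
    | step h _ _ ih1 ih2 =>
      obtain ⟨x, a, b, rfl, rfl, h⟩ := h
      simp only [lft_pair, rgt_pair] at ih1 ih2
      obtain ⟨t, rfl, ht⟩ := ih1
      obtain ⟨u, rfl, hu⟩ := ih2
      rcases h with rfl | rfl | rfl
      · exact ⟨t.succ, by simp [Term.code], by simpa [Term.fv] using ht⟩
      · exact ⟨t.add u, by simp [Term.code], by simpa [Term.fv] using ⟨ht, hu⟩⟩
      · exact ⟨t.mul u, by simp [Term.code], by simpa [Term.fv] using ⟨ht, hu⟩⟩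
  · rintro ⟨t, ht, hx⟩
    obtain ⟨x, c, rfl⟩ : ∃ x c, p = Nat.pair x c := ⟨lft p, rgt p, by simp⟩
    simp only [lft_pair, rgt_pair] at ht hx
    subst ht
    induction t with
    | var y => exact .base ⟨x, y, .inl ⟨rfl, by simpa [Term.fv] using hx⟩⟩
    | zero => exact .base ⟨x, 0, .inr rfl⟩
    | succ t ih =>
      have := ih hx
      exact .step ⟨x, _, _, rfl, rfl, .inl rfl⟩ this this
    | add t u iht ihu =>
      simp only [Term.fv, Finset.mem_union, not_or] at hx
      exact .step ⟨x, _, _, rfl, rfl, .inr (.inl rfl)⟩ (iht hx.1) (ihu hx.2)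
    | mul t u iht ihu =>
      simp only [Term.fv, Finset.mem_union, not_or] at hx
      exact .step ⟨x, _, _, rfl, rfl, .inr (.inr rfl)⟩ (iht hx.1) (ihu hx.2)

theorem SD.isT : SD (fun c => ∃ t : Term, t.code = c) := by
  have : SD (fun c => ∃ x, NTp x c) := SD.ex (SD.app2 SD.nt (by fun_prop) (by fun_prop))
  refine this.congr fun c => ⟨fun ⟨x, t, h, _⟩ => ⟨t, h⟩, fun ⟨t, h⟩ => ?_⟩
  obtain ⟨x, hx⟩ := Infinite.exists_notMem_finset t.fv
  exact ⟨x, t, h, hx⟩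

theorem SD.nf : SD (fun p => NFp (lft p) (rgt p)) := by
  have h : SD (Lfp
      (fun p => ∃ x a b, p = Nat.pair x (Nat.pair 0 0) ∨ ((NTp x a ∧ NTp x b) ∧
        (p = Nat.pair x (Nat.pair 1 (Nat.pair a b)) ∨ p = Nat.pair x (Nat.pair 2 (Nat.pair a b)))))
      (fun p q r => ∃ x a b, q = Nat.pair x a ∧ r = Nat.pair x b ∧
        (p = Nat.pair x (Nat.pair 3 (Nat.pair a b)) ∨ p = Nat.pair x (Nat.pair 4 (Nat.pair a b)) ∨
          p = Nat.pair x (Nat.pair 5 (Nat.pair a b)) ∨ p = Nat.pair x (Nat.pair 6 a) ∨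
          p = Nat.pair x (Nat.pair 9 a) ∨
          (∃ y, p = Nat.pair x (Nat.pair 7 (Nat.pair y a)) ∨
            p = Nat.pair x (Nat.pair 8 (Nat.pair y a)) ∨
            p = Nat.pair y (Nat.pair 7 (Nat.pair y a)) ∨
            p = Nat.pair y (Nat.pair 8 (Nat.pair y a)))))) := by
    apply SD.lfp
    all_goals repeat' first | apply SD.ex | apply SD.and | apply SD.or | apply SD.eq | apply SD.ne | apply SD.app2 SD.nt
    all_goals fun_prop
  refine h.congr fun p => ⟨fun h => ?_, ?_⟩
  · induction h with
    | base h =>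
      obtain ⟨x, a, b, rfl | ⟨⟨⟨t, rfl, h1⟩, ⟨u, rfl, h2⟩⟩, rfl | rfl⟩⟩ := h
      · exact ⟨.falsum, by simp [Formula.code], by simp [Formula.fv]⟩
      · exact ⟨.eq t u, by simp [Formula.code], by simpa [Formula.fv] using ⟨h1, h2⟩⟩
      · exact ⟨.le t u, by simp [Formula.code], by simpa [Formula.fv] using ⟨h1, h2⟩⟩
    | step h _ _ ih1 ih2 =>
      obtain ⟨x, a, b, rfl, rfl, h⟩ := h
      simp only [lft_pair, rgt_pair] at ih1 ih2
      obtain ⟨t, rfl, ht⟩ := ih1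
      obtain ⟨u, rfl, hu⟩ := ih2
      rcases h with rfl | rfl | rfl | rfl | rfl | ⟨y, rfl | rfl | rfl | rfl⟩
      · exact ⟨t.and u, by simp [Formula.code], by simpa [Formula.fv] using ⟨ht, hu⟩⟩
      · exact ⟨t.or u, by simp [Formula.code], by simpa [Formula.fv] using ⟨ht, hu⟩⟩
      · exact ⟨t.imp u, by simp [Formula.code], by simpa [Formula.fv] using ⟨ht, hu⟩⟩
      · exact ⟨t.neg, by simp [Formula.code], by simpa [Formula.fv] using ht⟩
      · exact ⟨t.box, by simp [Formula.code], by simpa [Formula.fv] using ht⟩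
      · exact ⟨.all y t, by simp [Formula.code], by simp [Formula.fv, ht]⟩
      · exact ⟨.ex y t, by simp [Formula.code], by simp [Formula.fv, ht]⟩
      · exact ⟨.all y t, by simp [Formula.code], by simp [Formula.fv]⟩
      · exact ⟨.ex y t, by simp [Formula.code], by simp [Formula.fv]⟩
  · rintro ⟨t, ht, hx⟩
    obtain ⟨x, c, rfl⟩ : ∃ x c, p = Nat.pair x c := ⟨lft p, rgt p, by simp⟩
    simp only [lft_pair, rgt_pair] at ht hx
    subst ht
    induction t generalizing x with
    | falsum => exact .base ⟨x, 0, 0, .inl rfl⟩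
    | eq t u =>
      simp only [Formula.fv, Finset.mem_union, not_or] at hx
      exact .base ⟨x, _, _, .inr ⟨⟨⟨t, rfl, hx.1⟩, ⟨u, rfl, hx.2⟩⟩, .inl rfl⟩⟩
    | le t u =>
      simp only [Formula.fv, Finset.mem_union, not_or] at hx
      exact .base ⟨x, _, _, .inr ⟨⟨⟨t, rfl, hx.1⟩, ⟨u, rfl, hx.2⟩⟩, .inr rfl⟩⟩
    | and t u iht ihu =>
      simp only [Formula.fv, Finset.mem_union, not_or] at hx
      exact .step ⟨x, _, _, rfl, rfl, .inl rfl⟩ (iht _ hx.1) (ihu _ hx.2)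
    | or t u iht ihu =>
      simp only [Formula.fv, Finset.mem_union, not_or] at hx
      exact .step ⟨x, _, _, rfl, rfl, .inr (.inl rfl)⟩ (iht _ hx.1) (ihu _ hx.2)
    | imp t u iht ihu =>
      simp only [Formula.fv, Finset.mem_union, not_or] at hx
      exact .step ⟨x, _, _, rfl, rfl, .inr (.inr (.inl rfl))⟩ (iht _ hx.1) (ihu _ hx.2)
    | neg t ih =>
      have := ih _ hx
      exact .step ⟨x, _, _, rfl, rfl, .inr (.inr (.inr (.inl rfl)))⟩ this this
    | box t ih =>
      have := ih _ hx
      exact .step ⟨x, _, _, rfl, rfl, .inr (.inr (.inr (.inr (.inl rfl))))⟩ this this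
    | all y t ih =>
      by_cases hxy : x = y
      · subst hxy
        obtain ⟨z, hz⟩ := Infinite.exists_notMem_finset t.fv
        have := ih z hz
        exact .step ⟨z, _, _, rfl, rfl, .inr (.inr (.inr (.inr (.inr
          ⟨x, .inr (.inr (.inl rfl))⟩))))⟩ this this
      · have := ih x (by simpa [Formula.fv, hxy] using hx)
        exact .step ⟨x, _, _, rfl, rfl, .inr (.inr (.inr (.inr (.inr
          ⟨y, .inl rfl⟩))))⟩ this this
    | ex y t ih =>
      by_cases hxy : x = y
      · subst hxy
        obtain ⟨z, hz⟩ := Infinite.exists_notMem_finset t.fv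
        have := ih z hz
        exact .step ⟨z, _, _, rfl, rfl, .inr (.inr (.inr (.inr (.inr
          ⟨x, .inr (.inr (.inr rfl))⟩))))⟩ this this
      · have := ih x (by simpa [Formula.fv, hxy] using hx)
        exact .step ⟨x, _, _, rfl, rfl, .inr (.inr (.inr (.inr (.inr
          ⟨y, .inr (.inl rfl)⟩))))⟩ this this

theorem SD.isF : SD (fun c => ∃ t : Formula, t.code = c) := by
  have : SD (fun c => ∃ x, NFp x c) := SD.ex (SD.app2 SD.nf (by fun_prop) (by fun_prop))
  refine this.congr fun c => ⟨fun ⟨x, t, h, _⟩ => ⟨t, h⟩, fun ⟨t, h⟩ => ?_⟩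
  obtain ⟨x, hx⟩ := Infinite.exists_notMem_finset t.fv
  exact ⟨x, t, h, hx⟩

end ModalArith

namespace ModalArith
set_option linter.unusedSimpArgs false
set_option linter.unusedVariables false

/-- Substitution on codes of terms. -/
def STp (k c d : ℕ) : Prop := ∃ (x : ℕ) (u t : Term), k = Nat.pair x u.code ∧ c = t.code ∧
  d = (Term.subst x u t).code
/-- Substitution on codes of formulas. -/
def SFp (k c d : ℕ) : Prop := ∃ (x : ℕ) (u : Term) (φ : Formula), k = Nat.pair x u.code ∧
  c = φ.code ∧ d = (φ.subst x u).code ∧ φ.freeFor u x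

theorem SD.st : SD (fun p => STp (lft p) (lft (rgt p)) (rgt (rgt p))) := by
  have h : SD (Lfp
      (fun p => ∃ x s, (∃ t : Term, t.code = s) ∧
        (p = Nat.pair (Nat.pair x s) (Nat.pair (Nat.pair 0 x) s) ∨
        (∃ y, y ≠ x ∧ p = Nat.pair (Nat.pair x s) (Nat.pair (Nat.pair 0 y) (Nat.pair 0 y))) ∨
        p = Nat.pair (Nat.pair x s) (Nat.pair (Nat.pair 1 0) (Nat.pair 1 0))))
      (fun p q r => ∃ k a b a1 b1, q = Nat.pair k (Nat.pair a a1) ∧ r = Nat.pair k (Nat.pair b b1) ∧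
        (p = Nat.pair k (Nat.pair (Nat.pair 2 a) (Nat.pair 2 a1)) ∨
          p = Nat.pair k (Nat.pair (Nat.pair 3 (Nat.pair a b)) (Nat.pair 3 (Nat.pair a1 b1))) ∨
          p = Nat.pair k (Nat.pair (Nat.pair 4 (Nat.pair a b)) (Nat.pair 4 (Nat.pair a1 b1)))))) := by
    apply SD.lfp
    all_goals repeat' first | apply SD.comp SD.isT | apply SD.ex | apply SD.and | apply SD.or | apply SD.eq | apply SD.ne
    all_goals fun_prop
  refine h.congr fun p => ⟨fun h => ?_, ?_⟩
  · induction h with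
    | base h =>
      obtain ⟨x, s, ⟨u, rfl⟩, rfl | ⟨y, hy, rfl⟩ | rfl⟩ := h
      · exact ⟨x, u, .var x, by simp, by simp [Term.code], by simp [Term.subst, Term.substAll]⟩
      · exact ⟨x, u, .var y, by simp, by simp [Term.code],
          by simp [Term.subst, Term.substAll, hy, Term.code]⟩
      · exact ⟨x, u, .zero, by simp, by simp [Term.code], by simp [Term.subst, Term.substAll, Term.code]⟩
    | step h _ _ ih1 ih2 =>
      obtain ⟨k, a, b, a1, b1, rfl, rfl, h⟩ := h
      simp only [lft_pair, rgt_pair] at ih1 ih2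
      obtain ⟨x, u, t, rfl, rfl, rfl⟩ := ih1
      obtain ⟨x1, u1, t1, h1, rfl, rfl⟩ := ih2
      obtain ⟨rfl, h1b⟩ := Nat.pair_eq_pair.1 h1
      obtain rfl := Term.code_inj.1 h1b
      rcases h with rfl | rfl | rfl
      · exact ⟨x, u, t.succ, by simp, by simp [Term.code], by simp [Term.subst, Term.substAll, Term.code]⟩
      · exact ⟨x, u, t.add t1, by simp, by simp [Term.code], by simp [Term.subst, Term.substAll, Term.code]⟩
      · exact ⟨x, u, t.mul t1, by simp, by simp [Term.code], by simp [Term.subst, Term.substAll, Term.code]⟩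
  · rintro ⟨x, u, t, h1, h2, h3⟩
    obtain ⟨k, c, d, rfl⟩ : ∃ k c d, p = Nat.pair k (Nat.pair c d) := ⟨lft p, lft (rgt p), rgt (rgt p), by simp⟩
    simp only [lft_pair, rgt_pair] at h1 h2 h3
    subst h1 h2 h3
    induction t with
    | var y =>
      by_cases hy : y = x
      · subst hy
        exact .base ⟨y, _, ⟨u, rfl⟩, .inl (by simp [Term.subst, Term.substAll, Term.code])⟩
      · exact .base ⟨x, _, ⟨u, rfl⟩, .inr (.inl ⟨y, hy,
          by simp [Term.subst, Term.substAll, Term.code, hy]⟩)⟩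
    | zero => exact .base ⟨x, _, ⟨u, rfl⟩, .inr (.inr rfl)⟩
    | succ t ih => exact .step ⟨_, _, _, _, _, rfl, rfl, .inl rfl⟩ ih ih
    | add t t1 ih ih1 => exact .step ⟨_, _, _, _, _, rfl, rfl, .inr (.inl rfl)⟩ ih ih1
    | mul t t1 ih ih1 => exact .step ⟨_, _, _, _, _, rfl, rfl, .inr (.inr rfl)⟩ ih ih1

theorem SD.sf : SD (fun p => SFp (lft p) (lft (rgt p)) (rgt (rgt p))) := by
  have h : SD (Lfp
      (fun p =>
        (∃ x s, (∃ t : Term, t.code = s) ∧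
          (p = Nat.pair (Nat.pair x s) (Nat.pair (Nat.pair 0 0) (Nat.pair 0 0)) ∨
          ∃ y a, (∃ t : Formula, t.code = a) ∧ (y = x ∨ NFp x a) ∧
            (p = Nat.pair (Nat.pair x s) (Nat.pair (Nat.pair 7 (Nat.pair y a)) (Nat.pair 7 (Nat.pair y a))) ∨
            p = Nat.pair (Nat.pair x s) (Nat.pair (Nat.pair 8 (Nat.pair y a)) (Nat.pair 8 (Nat.pair y a)))))) ∨
        ∃ k a b a1 b1, STp k a a1 ∧ STp k b b1 ∧
          (p = Nat.pair k (Nat.pair (Nat.pair 1 (Nat.pair a b)) (Nat.pair 1 (Nat.pair a1 b1))) ∨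
          p = Nat.pair k (Nat.pair (Nat.pair 2 (Nat.pair a b)) (Nat.pair 2 (Nat.pair a1 b1)))))
      (fun p q r => ∃ k a b a1 b1, q = Nat.pair k (Nat.pair a a1) ∧ r = Nat.pair k (Nat.pair b b1) ∧
        (p = Nat.pair k (Nat.pair (Nat.pair 3 (Nat.pair a b)) (Nat.pair 3 (Nat.pair a1 b1))) ∨
          p = Nat.pair k (Nat.pair (Nat.pair 4 (Nat.pair a b)) (Nat.pair 4 (Nat.pair a1 b1))) ∨
          p = Nat.pair k (Nat.pair (Nat.pair 5 (Nat.pair a b)) (Nat.pair 5 (Nat.pair a1 b1))) ∨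
          p = Nat.pair k (Nat.pair (Nat.pair 6 a) (Nat.pair 6 a1)) ∨
          p = Nat.pair k (Nat.pair (Nat.pair 9 a) (Nat.pair 9 a1)) ∨
          ∃ x s y, k = Nat.pair x s ∧ y ≠ x ∧ NTp y s ∧
            (p = Nat.pair k (Nat.pair (Nat.pair 7 (Nat.pair y a)) (Nat.pair 7 (Nat.pair y a1))) ∨
            p = Nat.pair k (Nat.pair (Nat.pair 8 (Nat.pair y a)) (Nat.pair 8 (Nat.pair y a1))))))) := by
    apply SD.lfp
    all_goals repeat' first | apply SD.app3 SD.st | apply SD.app2 SD.nf | apply SD.app2 SD.nt | apply SD.comp SD.isF | apply SD.comp SD.isT | apply SD.ex | apply SD.and | apply SD.or | apply SD.eq | apply SD.ne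
    all_goals fun_prop
  refine h.congr fun p => ⟨fun h => ?_, ?_⟩
  · induction h with
    | base h =>
      rcases h with ⟨x, s, ⟨u, rfl⟩, rfl | ⟨y, _, ⟨φ, rfl⟩, hy, h⟩⟩ | ⟨k, a, b, a1, b1, h1, h2, h⟩
      · exact ⟨x, u, .falsum, by simp, by simp [Formula.code], by simp [Formula.subst, Formula.substAll, Formula.code], trivial⟩
      · have hf : x = y ∨ x ∉ φ.fv := by
          rcases hy with rfl | ⟨ψ, h1, h2⟩
          · exact .inl rfl
          · obtain rfl := Formula.code_inj.1 h1
            exact .inr h2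
        rcases h with rfl | rfl
        · refine ⟨x, u, .all y φ, by simp, by simp [Formula.code], ?_, by simp only [Formula.freeFor]; tauto⟩
          rw [Formula.subst_not_fv (by simp only [Formula.fv, Finset.mem_erase]; tauto)]; simp [Formula.code]
        · refine ⟨x, u, .ex y φ, by simp, by simp [Formula.code], ?_, by simp only [Formula.freeFor]; tauto⟩
          rw [Formula.subst_not_fv (by simp only [Formula.fv, Finset.mem_erase]; tauto)]; simp [Formula.code]
      · obtain ⟨x, u, t, rfl, rfl, rfl⟩ := h1
        obtain ⟨x1, u1, t1, h1, rfl, rfl⟩ := h2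
        obtain ⟨rfl, h1b⟩ := Nat.pair_eq_pair.1 h1
        obtain rfl := Term.code_inj.1 h1b
        rcases h with rfl | rfl
        · exact ⟨x, u, .eq t t1, by simp, by simp [Formula.code],
            by simp [Formula.subst, Term.subst, Formula.substAll, Formula.code], trivial⟩
        · exact ⟨x, u, .le t t1, by simp, by simp [Formula.code],
            by simp [Formula.subst, Term.subst, Formula.substAll, Formula.code], trivial⟩
    | step h _ _ ih1 ih2 =>
      obtain ⟨k, a, b, a1, b1, rfl, rfl, h⟩ := h
      simp only [lft_pair, rgt_pair] at ih1 ih2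
      obtain ⟨x, u, t, rfl, rfl, rfl, hf⟩ := ih1
      obtain ⟨x1, u1, t1, h1, rfl, rfl, hf1⟩ := ih2
      obtain ⟨rfl, h1b⟩ := Nat.pair_eq_pair.1 h1
      obtain rfl := Term.code_inj.1 h1b
      rcases h with rfl | rfl | rfl | rfl | rfl | ⟨x1, s, y, h, hy, ⟨u1, rfl, hu⟩, hh⟩
      · exact ⟨x, u, t.and t1, by simp, by simp [Formula.code], by simp [Formula.subst, Formula.substAll, Formula.code], hf, hf1⟩
      · exact ⟨x, u, t.or t1, by simp, by simp [Formula.code], by simp [Formula.subst, Formula.substAll, Formula.code], hf, hf1⟩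
      · exact ⟨x, u, t.imp t1, by simp, by simp [Formula.code], by simp [Formula.subst, Formula.substAll, Formula.code], hf, hf1⟩
      · exact ⟨x, u, t.neg, by simp, by simp [Formula.code], by simp [Formula.subst, Formula.substAll, Formula.code], hf⟩
      · exact ⟨x, u, t.box, by simp, by simp [Formula.code], by simp [Formula.subst, Formula.substAll, Formula.code], hf⟩
      · obtain ⟨rfl, hb⟩ := Nat.pair_eq_pair.1 h
        obtain rfl := Term.code_inj.1 hb
        rcases hh with rfl | rfl
        · exact ⟨x, u, .all y t, by simp, by simp [Formula.code],
            by rw [Formula.subst_all_ne hy]; simp [Formula.code], .inr (.inr ⟨hu, hf⟩)⟩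
        · exact ⟨x, u, .ex y t, by simp, by simp [Formula.code],
            by rw [Formula.subst_ex_ne hy]; simp [Formula.code], .inr (.inr ⟨hu, hf⟩)⟩
  · rintro ⟨x, u, t, h1, h2, h3, hf⟩
    obtain ⟨k, c, d, rfl⟩ : ∃ k c d, p = Nat.pair k (Nat.pair c d) := ⟨lft p, lft (rgt p), rgt (rgt p), by simp⟩
    simp only [lft_pair, rgt_pair] at h1 h2 h3
    subst h1 h2 h3
    induction t with
    | falsum => exact .base (.inl ⟨x, _, ⟨u, rfl⟩, .inl rfl⟩)
    | eq t t1 => exact .base (.inr ⟨_, _, _, _, _, ⟨x, u, t, rfl, rfl, rfl⟩, ⟨x, u, t1, rfl, rfl, rfl⟩, .inl rfl⟩)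
    | le t t1 => exact .base (.inr ⟨_, _, _, _, _, ⟨x, u, t, rfl, rfl, rfl⟩, ⟨x, u, t1, rfl, rfl, rfl⟩, .inr rfl⟩)
    | and t t1 ih ih1 => exact .step ⟨_, _, _, _, _, rfl, rfl, .inl rfl⟩ (ih hf.1) (ih1 hf.2)
    | or t t1 ih ih1 => exact .step ⟨_, _, _, _, _, rfl, rfl, .inr (.inl rfl)⟩ (ih hf.1) (ih1 hf.2)
    | imp t t1 ih ih1 => exact .step ⟨_, _, _, _, _, rfl, rfl, .inr (.inr (.inl rfl))⟩ (ih hf.1) (ih1 hf.2)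
    | neg t ih => exact .step ⟨_, _, _, _, _, rfl, rfl, .inr (.inr (.inr (.inl rfl)))⟩ (ih hf) (ih hf)
    | box t ih => exact .step ⟨_, _, _, _, _, rfl, rfl, .inr (.inr (.inr (.inr (.inl rfl))))⟩ (ih hf) (ih hf)
    | all y t ih =>
      by_cases hv : y = x ∨ x ∉ t.fv
      · rw [Formula.subst_not_fv (by simp only [Formula.fv, Finset.mem_erase]; tauto)]
        exact .base (.inl ⟨x, _, ⟨u, rfl⟩, .inr ⟨y, _, ⟨t, rfl⟩, hv.imp id fun h => ⟨t, rfl, h⟩, .inl rfl⟩⟩)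
      · rw [not_or] at hv
        have hf2 : y ∉ u.fv ∧ t.freeFor u x := by
          simp only [Formula.freeFor] at hf; tauto
        rw [Formula.subst_all_ne hv.1]
        exact .step ⟨_, _, _, _, _, rfl, rfl, .inr (.inr (.inr (.inr (.inr
          ⟨x, _, y, rfl, hv.1, ⟨u, rfl, hf2.1⟩, .inl rfl⟩))))⟩ (ih hf2.2) (ih hf2.2)
    | ex y t ih =>
      by_cases hv : y = x ∨ x ∉ t.fv
      · rw [Formula.subst_not_fv (by simp only [Formula.fv, Finset.mem_erase]; tauto)]
        exact .base (.inl ⟨x, _, ⟨u, rfl⟩, .inr ⟨y, _, ⟨t, rfl⟩, hv.imp id fun h => ⟨t, rfl, h⟩, .inr rfl⟩⟩)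
      · rw [not_or] at hv
        have hf2 : y ∉ u.fv ∧ t.freeFor u x := by
          simp only [Formula.freeFor] at hf; tauto
        rw [Formula.subst_ex_ne hv.1]
        exact .step ⟨_, _, _, _, _, rfl, rfl, .inr (.inr (.inr (.inr (.inr
          ⟨x, _, y, rfl, hv.1, ⟨u, rfl, hf2.1⟩, .inr rfl⟩))))⟩ (ih hf2.2) (ih hf2.2)

theorem SD.num : SD (fun p => rgt p = (Term.numeral (lft p)).code) := by
  have h : SD (Lfp (fun p => p = Nat.pair 0 (Nat.pair 1 0))
      (fun p q r => p = Nat.pair (lft q + 1) (Nat.pair 2 (rgt q)))) := by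
    apply SD.lfp
    all_goals repeat' first | apply SD.ex | apply SD.and | apply SD.or | apply SD.eq | apply SD.ne
    all_goals fun_prop
  refine h.congr fun p => ⟨fun h => ?_, fun h => ?_⟩
  · induction h with
    | base h => subst h; simp [Term.numeral, Term.code]
    | step h _ _ ih1 ih2 => subst h; simp [Term.numeral, Term.code, ih1]
  · obtain ⟨m, s, rfl⟩ : ∃ x c, p = Nat.pair x c := ⟨lft p, rgt p, by simp⟩
    simp only [lft_pair, rgt_pair] at h
    subst h
    induction m with
    | zero => exact .base rfl
    | succ m ih => exact .step (by simp [Term.numeral, Term.code]) ih ih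

theorem SD.form1 (f : ℕ → ℕ) (hf : EF (fun p => f p)) :
    SD (fun e => ∃ t0 : Formula, e = f t0.code) := by
  have : SD (fun e => ∃ p, (fun e p => (∃ t : Formula, t.code = p) ∧ e = f p) e p) := by
    refine SD.ex ?_
    refine SD.and (SD.comp SD.isF (by fun_prop)) ?_
    exact SD.eq (by fun_prop) (hf.comp (by fun_prop))
  refine this.congr fun e => ⟨?_, ?_⟩
  · rintro ⟨p, ⟨t0, ht0⟩, rfl⟩
    exact ⟨t0, by rw [ht0]⟩
  · rintro ⟨t0, rfl⟩
    exact ⟨t0.code, ⟨t0, by simp⟩, by simp⟩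

theorem SD.form2 (f : ℕ → ℕ → ℕ) (hf : EF (fun p => f (lft p) (rgt p))) :
    SD (fun e => ∃ t0 t1 : Formula, e = f t0.code t1.code) := by
  have : SD (fun e => ∃ p, (fun e p => (∃ t : Formula, t.code = (lft p)) ∧ (∃ t : Formula, t.code = (rgt p)) ∧ e = f (lft p) (rgt p)) e p) := by
    refine SD.ex ?_
    refine SD.and (SD.comp SD.isF (by fun_prop)) ?_
    refine SD.and (SD.comp SD.isF (by fun_prop)) ?_
    exact SD.eq (by fun_prop) (hf.comp (by fun_prop))
  refine this.congr fun e => ⟨?_, ?_⟩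
  · rintro ⟨p, ⟨t0, ht0⟩, ⟨t1, ht1⟩, rfl⟩
    exact ⟨t0, t1, by rw [ht0, ht1]⟩
  · rintro ⟨t0, t1, rfl⟩
    exact ⟨Nat.pair t0.code t1.code, ⟨t0, by simp⟩, ⟨t1, by simp⟩, by simp⟩

theorem SD.form3 (f : ℕ → ℕ → ℕ → ℕ) (hf : EF (fun p => f (lft p) (lft (rgt p)) (rgt (rgt p)))) :
    SD (fun e => ∃ t0 t1 t2 : Formula, e = f t0.code t1.code t2.code) := by
  have : SD (fun e => ∃ p, (fun e p => (∃ t : Formula, t.code = (lft p)) ∧ (∃ t : Formula, t.code = (lft (rgt p))) ∧ (∃ t : Formula, t.code = (rgt (rgt p))) ∧ e = f (lft p) (lft (rgt p)) (rgt (rgt p))) e p) := by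
    refine SD.ex ?_
    refine SD.and (SD.comp SD.isF (by fun_prop)) ?_
    refine SD.and (SD.comp SD.isF (by fun_prop)) ?_
    refine SD.and (SD.comp SD.isF (by fun_prop)) ?_
    exact SD.eq (by fun_prop) (hf.comp (by fun_prop))
  refine this.congr fun e => ⟨?_, ?_⟩
  · rintro ⟨p, ⟨t0, ht0⟩, ⟨t1, ht1⟩, ⟨t2, ht2⟩, rfl⟩
    exact ⟨t0, t1, t2, by rw [ht0, ht1, ht2]⟩
  · rintro ⟨t0, t1, t2, rfl⟩
    exact ⟨Nat.pair t0.code (Nat.pair t1.code t2.code), ⟨t0, by simp⟩, ⟨t1, by simp⟩, ⟨t2, by simp⟩, by simp⟩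

theorem SD.term1 (f : ℕ → ℕ) (hf : EF (fun p => f p)) :
    SD (fun e => ∃ t0 : Term, e = f t0.code) := by
  have : SD (fun e => ∃ p, (fun e p => (∃ t : Term, t.code = p) ∧ e = f p) e p) := by
    refine SD.ex ?_
    refine SD.and (SD.comp SD.isT (by fun_prop)) ?_
    exact SD.eq (by fun_prop) (hf.comp (by fun_prop))
  refine this.congr fun e => ⟨?_, ?_⟩
  · rintro ⟨p, ⟨t0, ht0⟩, rfl⟩
    exact ⟨t0, by rw [ht0]⟩
  · rintro ⟨t0, rfl⟩
    exact ⟨t0.code, ⟨t0, by simp⟩, by simp⟩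

theorem SD.term2 (f : ℕ → ℕ → ℕ) (hf : EF (fun p => f (lft p) (rgt p))) :
    SD (fun e => ∃ t0 t1 : Term, e = f t0.code t1.code) := by
  have : SD (fun e => ∃ p, (fun e p => (∃ t : Term, t.code = (lft p)) ∧ (∃ t : Term, t.code = (rgt p)) ∧ e = f (lft p) (rgt p)) e p) := by
    refine SD.ex ?_
    refine SD.and (SD.comp SD.isT (by fun_prop)) ?_
    refine SD.and (SD.comp SD.isT (by fun_prop)) ?_
    exact SD.eq (by fun_prop) (hf.comp (by fun_prop))
  refine this.congr fun e => ⟨?_, ?_⟩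
  · rintro ⟨p, ⟨t0, ht0⟩, ⟨t1, ht1⟩, rfl⟩
    exact ⟨t0, t1, by rw [ht0, ht1]⟩
  · rintro ⟨t0, t1, rfl⟩
    exact ⟨Nat.pair t0.code t1.code, ⟨t0, by simp⟩, ⟨t1, by simp⟩, by simp⟩

theorem SD.term3 (f : ℕ → ℕ → ℕ → ℕ) (hf : EF (fun p => f (lft p) (lft (rgt p)) (rgt (rgt p)))) :
    SD (fun e => ∃ t0 t1 t2 : Term, e = f t0.code t1.code t2.code) := by
  have : SD (fun e => ∃ p, (fun e p => (∃ t : Term, t.code = (lft p)) ∧ (∃ t : Term, t.code = (lft (rgt p))) ∧ (∃ t : Term, t.code = (rgt (rgt p))) ∧ e = f (lft p) (lft (rgt p)) (rgt (rgt p))) e p) := by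
    refine SD.ex ?_
    refine SD.and (SD.comp SD.isT (by fun_prop)) ?_
    refine SD.and (SD.comp SD.isT (by fun_prop)) ?_
    refine SD.and (SD.comp SD.isT (by fun_prop)) ?_
    exact SD.eq (by fun_prop) (hf.comp (by fun_prop))
  refine this.congr fun e => ⟨?_, ?_⟩
  · rintro ⟨p, ⟨t0, ht0⟩, ⟨t1, ht1⟩, ⟨t2, ht2⟩, rfl⟩
    exact ⟨t0, t1, t2, by rw [ht0, ht1, ht2]⟩
  · rintro ⟨t0, t1, t2, rfl⟩
    exact ⟨Nat.pair t0.code (Nat.pair t1.code t2.code), ⟨t0, by simp⟩, ⟨t1, by simp⟩, ⟨t2, by simp⟩, by simp⟩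

theorem SD.term4 (f : ℕ → ℕ → ℕ → ℕ → ℕ) (hf : EF (fun p => f (lft p) (lft (rgt p)) (lft (rgt (rgt p))) (rgt (rgt (rgt p))))) :
    SD (fun e => ∃ t0 t1 t2 t3 : Term, e = f t0.code t1.code t2.code t3.code) := by
  have : SD (fun e => ∃ p, (fun e p => (∃ t : Term, t.code = (lft p)) ∧ (∃ t : Term, t.code = (lft (rgt p))) ∧ (∃ t : Term, t.code = (lft (rgt (rgt p)))) ∧ (∃ t : Term, t.code = (rgt (rgt (rgt p)))) ∧ e = f (lft p) (lft (rgt p)) (lft (rgt (rgt p))) (rgt (rgt (rgt p)))) e p) := by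
    refine SD.ex ?_
    refine SD.and (SD.comp SD.isT (by fun_prop)) ?_
    refine SD.and (SD.comp SD.isT (by fun_prop)) ?_
    refine SD.and (SD.comp SD.isT (by fun_prop)) ?_
    refine SD.and (SD.comp SD.isT (by fun_prop)) ?_
    exact SD.eq (by fun_prop) (hf.comp (by fun_prop))
  refine this.congr fun e => ⟨?_, ?_⟩
  · rintro ⟨p, ⟨t0, ht0⟩, ⟨t1, ht1⟩, ⟨t2, ht2⟩, ⟨t3, ht3⟩, rfl⟩
    exact ⟨t0, t1, t2, t3, by rw [ht0, ht1, ht2, ht3]⟩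
  · rintro ⟨t0, t1, t2, t3, rfl⟩
    exact ⟨Nat.pair t0.code (Nat.pair t1.code (Nat.pair t2.code t3.code)), ⟨t0, by simp⟩, ⟨t1, by simp⟩, ⟨t2, by simp⟩, ⟨t3, by simp⟩, by simp⟩

theorem SD.allE : SD (fun e => ∃ (x : ℕ) (t : Term) (φ : Formula), φ.freeFor t x ∧
    e = ((Formula.all x φ).imp (φ.subst x t)).code) := by
  have : SD (fun e => ∃ x s a b, SFp (Nat.pair x s) a b ∧
      e = Nat.pair 5 (Nat.pair (Nat.pair 7 (Nat.pair x a)) b)) := by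
    repeat' first | apply SD.app3 SD.sf | apply SD.ex | apply SD.and | apply SD.or | apply SD.eq
    all_goals fun_prop
  refine this.congr fun e => ⟨?_, ?_⟩
  · rintro ⟨x, s, a, b, ⟨y, u, φ, h, rfl, rfl, hf⟩, rfl⟩
    obtain ⟨rfl, rfl⟩ := Nat.pair_eq_pair.1 h
    exact ⟨x, u, φ, hf, rfl⟩
  · rintro ⟨x, u, φ, hf, rfl⟩
    exact ⟨x, _, _, _, ⟨x, u, φ, rfl, rfl, rfl, hf⟩, rfl⟩

theorem SD.exI : SD (fun e => ∃ (x : ℕ) (t : Term) (φ : Formula), φ.freeFor t x ∧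
    e = ((φ.subst x t).imp (Formula.ex x φ)).code) := by
  have : SD (fun e => ∃ x s a b, SFp (Nat.pair x s) a b ∧
      e = Nat.pair 5 (Nat.pair b (Nat.pair 8 (Nat.pair x a)))) := by
    repeat' first | apply SD.app3 SD.sf | apply SD.ex | apply SD.and | apply SD.or | apply SD.eq
    all_goals fun_prop
  refine this.congr fun e => ⟨?_, ?_⟩
  · rintro ⟨x, s, a, b, ⟨y, u, φ, h, rfl, rfl, hf⟩, rfl⟩
    obtain ⟨rfl, rfl⟩ := Nat.pair_eq_pair.1 h
    exact ⟨x, u, φ, hf, rfl⟩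
  · rintro ⟨x, u, φ, hf, rfl⟩
    exact ⟨x, _, _, _, ⟨x, u, φ, rfl, rfl, rfl, hf⟩, rfl⟩

theorem SD.allImp : SD (fun e => ∃ (x : ℕ) (φ ψ : Formula), x ∉ φ.fv ∧
    e = ((Formula.all x (φ.imp ψ)).imp (φ.imp (Formula.all x ψ))).code) := by
  have : SD (fun e => ∃ x a b, NFp x a ∧ (∃ ψ : Formula, ψ.code = b) ∧
      e = Nat.pair 5 (Nat.pair (Nat.pair 7 (Nat.pair x (Nat.pair 5 (Nat.pair a b))))
        (Nat.pair 5 (Nat.pair a (Nat.pair 7 (Nat.pair x b)))))) := by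
    repeat' first | apply SD.app2 SD.nf | apply SD.comp SD.isF | apply SD.ex | apply SD.and | apply SD.or | apply SD.eq
    all_goals fun_prop
  refine this.congr fun e => ⟨?_, ?_⟩
  · rintro ⟨x, a, b, ⟨φ, rfl, h⟩, ⟨ψ, rfl⟩, rfl⟩
    exact ⟨x, φ, ψ, h, rfl⟩
  · rintro ⟨x, φ, ψ, h, rfl⟩
    exact ⟨x, _, _, ⟨φ, rfl, h⟩, ⟨ψ, rfl⟩, rfl⟩

theorem SD.exE : SD (fun e => ∃ (x : ℕ) (φ ψ : Formula), x ∉ ψ.fv ∧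
    e = ((Formula.all x (φ.imp ψ)).imp ((Formula.ex x φ).imp ψ)).code) := by
  have : SD (fun e => ∃ x a b, NFp x b ∧ (∃ ψ : Formula, ψ.code = a) ∧
      e = Nat.pair 5 (Nat.pair (Nat.pair 7 (Nat.pair x (Nat.pair 5 (Nat.pair a b))))
        (Nat.pair 5 (Nat.pair (Nat.pair 8 (Nat.pair x a)) b)))) := by
    repeat' first | apply SD.app2 SD.nf | apply SD.comp SD.isF | apply SD.ex | apply SD.and | apply SD.or | apply SD.eq
    all_goals fun_prop
  refine this.congr fun e => ⟨?_, ?_⟩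
  · rintro ⟨x, a, b, ⟨φ, rfl, h⟩, ⟨ψ, rfl⟩, rfl⟩
    exact ⟨x, ψ, φ, h, rfl⟩
  · rintro ⟨x, φ, ψ, h, rfl⟩
    exact ⟨x, _, _, ⟨ψ, rfl, h⟩, ⟨φ, rfl⟩, rfl⟩

theorem SD.la : SD (fun e => ∃ χ : Formula, LogicalAxiom χ ∧ e = χ.code) := by
  have h_imp1 := SD.form2 (fun a b => Nat.pair 5 (Nat.pair a (Nat.pair 5 (Nat.pair b a)))) (by fun_prop)
  have h_imp2 := SD.form3 (fun a b c => Nat.pair 5 (Nat.pair (Nat.pair 5 (Nat.pair a (Nat.pair 5 (Nat.pair b c)))) (Nat.pair 5 (Nat.pair (Nat.pair 5 (Nat.pair a b)) (Nat.pair 5 (Nat.pair a c)))))) (by fun_prop)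
  have h_dne := SD.form1 (fun a => Nat.pair 5 (Nat.pair (Nat.pair 6 (Nat.pair 6 a)) a)) (by fun_prop)
  have h_negI := SD.form2 (fun a b => Nat.pair 5 (Nat.pair (Nat.pair 5 (Nat.pair a b)) (Nat.pair 5 (Nat.pair (Nat.pair 5 (Nat.pair a (Nat.pair 6 b))) (Nat.pair 6 a))))) (by fun_prop)
  have h_negE := SD.form2 (fun a b => Nat.pair 5 (Nat.pair (Nat.pair 6 a) (Nat.pair 5 (Nat.pair a b)))) (by fun_prop)
  have h_falsumE := SD.form1 (fun a => Nat.pair 5 (Nat.pair (Nat.pair 0 0) a)) (by fun_prop)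
  have h_negIntro := SD.form1 (fun a => Nat.pair 5 (Nat.pair (Nat.pair 5 (Nat.pair a (Nat.pair 0 0))) (Nat.pair 6 a))) (by fun_prop)
  have h_negElimFalsum := SD.form1 (fun a => Nat.pair 5 (Nat.pair (Nat.pair 6 a) (Nat.pair 5 (Nat.pair a (Nat.pair 0 0))))) (by fun_prop)
  have h_andI := SD.form2 (fun a b => Nat.pair 5 (Nat.pair a (Nat.pair 5 (Nat.pair b (Nat.pair 3 (Nat.pair a b)))))) (by fun_prop)
  have h_andE1 := SD.form2 (fun a b => Nat.pair 5 (Nat.pair (Nat.pair 3 (Nat.pair a b)) a)) (by fun_prop)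
  have h_andE2 := SD.form2 (fun a b => Nat.pair 5 (Nat.pair (Nat.pair 3 (Nat.pair a b)) b)) (by fun_prop)
  have h_orI1 := SD.form2 (fun a b => Nat.pair 5 (Nat.pair a (Nat.pair 4 (Nat.pair a b)))) (by fun_prop)
  have h_orI2 := SD.form2 (fun a b => Nat.pair 5 (Nat.pair b (Nat.pair 4 (Nat.pair a b)))) (by fun_prop)
  have h_orE := SD.form3 (fun a b c => Nat.pair 5 (Nat.pair (Nat.pair 5 (Nat.pair a c)) (Nat.pair 5 (Nat.pair (Nat.pair 5 (Nat.pair b c)) (Nat.pair 5 (Nat.pair (Nat.pair 4 (Nat.pair a b)) c)))))) (by fun_prop)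
  have h_eqRefl := SD.term1 (fun a => Nat.pair 1 (Nat.pair a a)) (by fun_prop)
  have h_eqSymm := SD.term2 (fun a b => Nat.pair 5 (Nat.pair (Nat.pair 1 (Nat.pair a b)) (Nat.pair 1 (Nat.pair b a)))) (by fun_prop)
  have h_eqTrans := SD.term3 (fun a b c => Nat.pair 5 (Nat.pair (Nat.pair 1 (Nat.pair a b)) (Nat.pair 5 (Nat.pair (Nat.pair 1 (Nat.pair b c)) (Nat.pair 1 (Nat.pair a c)))))) (by fun_prop)
  have h_eqSucc := SD.term2 (fun a b => Nat.pair 5 (Nat.pair (Nat.pair 1 (Nat.pair a b)) (Nat.pair 1 (Nat.pair (Nat.pair 2 a) (Nat.pair 2 b))))) (by fun_prop)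
  have h_eqAdd := SD.term4 (fun a b c d => Nat.pair 5 (Nat.pair (Nat.pair 1 (Nat.pair a b)) (Nat.pair 5 (Nat.pair (Nat.pair 1 (Nat.pair c d)) (Nat.pair 1 (Nat.pair (Nat.pair 3 (Nat.pair a c)) (Nat.pair 3 (Nat.pair b d)))))))) (by fun_prop)
  have h_eqMul := SD.term4 (fun a b c d => Nat.pair 5 (Nat.pair (Nat.pair 1 (Nat.pair a b)) (Nat.pair 5 (Nat.pair (Nat.pair 1 (Nat.pair c d)) (Nat.pair 1 (Nat.pair (Nat.pair 4 (Nat.pair a c)) (Nat.pair 4 (Nat.pair b d)))))))) (by fun_prop)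
  have h_eqLe := SD.term4 (fun a b c d => Nat.pair 5 (Nat.pair (Nat.pair 1 (Nat.pair a b)) (Nat.pair 5 (Nat.pair (Nat.pair 1 (Nat.pair c d)) (Nat.pair 5 (Nat.pair (Nat.pair 2 (Nat.pair a c)) (Nat.pair 2 (Nat.pair b d)))))))) (by fun_prop)
  refine SD.congr (SD.or h_imp1 (SD.or h_imp2 (SD.or h_dne (SD.or h_negI (SD.or h_negE (SD.or h_falsumE (SD.or h_negIntro (SD.or h_negElimFalsum (SD.or h_andI (SD.or h_andE1 (SD.or h_andE2 (SD.or h_orI1 (SD.or h_orI2 (SD.or h_orE (SD.or h_eqRefl (SD.or h_eqSymm (SD.or h_eqTrans (SD.or h_eqSucc (SD.or h_eqAdd (SD.or h_eqMul (SD.or h_eqLe (SD.or SD.allE (SD.or SD.exI (SD.or SD.allImp (SD.exE))))))))))))))))))))))))) fun e => ⟨?_, ?_⟩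
  · rintro (⟨x, y, rfl⟩
      | ⟨x, y, z, rfl⟩
      | ⟨x, rfl⟩
      | ⟨x, y, rfl⟩
      | ⟨x, y, rfl⟩
      | ⟨x, rfl⟩
      | ⟨x, rfl⟩
      | ⟨x, rfl⟩
      | ⟨x, y, rfl⟩
      | ⟨x, y, rfl⟩
      | ⟨x, y, rfl⟩
      | ⟨x, y, rfl⟩
      | ⟨x, y, rfl⟩
      | ⟨x, y, z, rfl⟩
      | ⟨x, rfl⟩
      | ⟨x, y, rfl⟩
      | ⟨x, y, z, rfl⟩
      | ⟨x, y, rfl⟩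
      | ⟨x, y, z, w, rfl⟩
      | ⟨x, y, z, w, rfl⟩
      | ⟨x, y, z, w, rfl⟩
      | ⟨x, y, z, h, rfl⟩
      | ⟨x, y, z, h, rfl⟩
      | ⟨x, y, z, h, rfl⟩
      | ⟨x, y, z, h, rfl⟩)
    · exact ⟨_, .imp1 x y, rfl⟩
    · exact ⟨_, .imp2 x y z, rfl⟩
    · exact ⟨_, .dne x, rfl⟩
    · exact ⟨_, .negI x y, rfl⟩
    · exact ⟨_, .negE x y, rfl⟩
    · exact ⟨_, .falsumE x, rfl⟩
    · exact ⟨_, .negIntro x, rfl⟩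
    · exact ⟨_, .negElimFalsum x, rfl⟩
    · exact ⟨_, .andI x y, rfl⟩
    · exact ⟨_, .andE1 x y, rfl⟩
    · exact ⟨_, .andE2 x y, rfl⟩
    · exact ⟨_, .orI1 x y, rfl⟩
    · exact ⟨_, .orI2 x y, rfl⟩
    · exact ⟨_, .orE x y z, rfl⟩
    · exact ⟨_, .eqRefl x, rfl⟩
    · exact ⟨_, .eqSymm x y, rfl⟩
    · exact ⟨_, .eqTrans x y z, rfl⟩
    · exact ⟨_, .eqSucc x y, rfl⟩
    · exact ⟨_, .eqAdd x y z w, rfl⟩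
    · exact ⟨_, .eqMul x y z w, rfl⟩
    · exact ⟨_, .eqLe x y z w, rfl⟩
    · exact ⟨_, .allE x y z h, rfl⟩
    · exact ⟨_, .exI x y z h, rfl⟩
    · exact ⟨_, .allImp x y z h, rfl⟩
    · exact ⟨_, .exE x y z h, rfl⟩
  · rintro ⟨χ, h, rfl⟩
    cases h with
    | imp1 x y => exact .inl ⟨x, y, rfl⟩
    | imp2 x y z =>
      iterate 1 right
      exact .inl ⟨x, y, z, rfl⟩
    | dne x =>
      iterate 2 right
      exact .inl ⟨x, rfl⟩
    | negI x y =>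
      iterate 3 right
      exact .inl ⟨x, y, rfl⟩
    | negE x y =>
      iterate 4 right
      exact .inl ⟨x, y, rfl⟩
    | falsumE x =>
      iterate 5 right
      exact .inl ⟨x, rfl⟩
    | negIntro x =>
      iterate 6 right
      exact .inl ⟨x, rfl⟩
    | negElimFalsum x =>
      iterate 7 right
      exact .inl ⟨x, rfl⟩
    | andI x y =>
      iterate 8 right
      exact .inl ⟨x, y, rfl⟩
    | andE1 x y =>
      iterate 9 right
      exact .inl ⟨x, y, rfl⟩
    | andE2 x y =>
      iterate 10 right
      exact .inl ⟨x, y, rfl⟩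
    | orI1 x y =>
      iterate 11 right
      exact .inl ⟨x, y, rfl⟩
    | orI2 x y =>
      iterate 12 right
      exact .inl ⟨x, y, rfl⟩
    | orE x y z =>
      iterate 13 right
      exact .inl ⟨x, y, z, rfl⟩
    | eqRefl x =>
      iterate 14 right
      exact .inl ⟨x, rfl⟩
    | eqSymm x y =>
      iterate 15 right
      exact .inl ⟨x, y, rfl⟩
    | eqTrans x y z =>
      iterate 16 right
      exact .inl ⟨x, y, z, rfl⟩
    | eqSucc x y =>
      iterate 17 right
      exact .inl ⟨x, y, rfl⟩
    | eqAdd x y z w =>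
      iterate 18 right
      exact .inl ⟨x, y, z, w, rfl⟩
    | eqMul x y z w =>
      iterate 19 right
      exact .inl ⟨x, y, z, w, rfl⟩
    | eqLe x y z w =>
      iterate 20 right
      exact .inl ⟨x, y, z, w, rfl⟩
    | allE x y z h =>
      iterate 21 right
      exact .inl ⟨x, y, z, h, rfl⟩
    | exI x y z h =>
      iterate 22 right
      exact .inl ⟨x, y, z, h, rfl⟩
    | allImp x y z h =>
      iterate 23 right
      exact .inl ⟨x, y, z, h, rfl⟩
    | exE x y z h =>
      iterate 24 right
      exact ⟨x, y, z, h, rfl⟩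

theorem SD.pr {T : Set Formula} (hT : RE T) : SD (fun c => ∃ φ, Provable T φ ∧ c = φ.code) := by
  have h : SD (Lfp (fun p => (∃ φ ∈ T, Formula.code φ = p) ∨ ∃ χ : Formula, LogicalAxiom χ ∧ p = χ.code)
      (fun p q r => q = Nat.pair 5 (Nat.pair r p) ∨ (∃ x, p = Nat.pair 7 (Nat.pair x q)) ∨
        p = Nat.pair 9 q)) := by
    apply SD.lfp
    · exact SD.or (SD.ofRE hT) SD.la
    · repeat' first | apply SD.ex | apply SD.and | apply SD.or | apply SD.eq
      all_goals fun_prop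
  refine h.congr fun p => ⟨fun h => ?_, ?_⟩
  · induction h with
    | base h =>
      rcases h with ⟨φ, h, rfl⟩ | ⟨φ, h, rfl⟩
      · exact ⟨φ, .ax h, rfl⟩
      · exact ⟨φ, .logic h, rfl⟩
    | @step p q r h _ _ ih1 ih2 =>
      obtain ⟨φ, h1, rfl⟩ := ih1
      obtain ⟨ψ, h2, rfl⟩ := ih2
      rcases h with h | ⟨x, rfl⟩ | rfl
      · cases φ <;> simp only [Formula.code, Nat.pair_eq_pair] at h <;> try (exact absurd h.1 (by decide))
        obtain ⟨_, h, rfl⟩ := h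
        obtain rfl := Formula.code_inj.1 h
        exact ⟨_, .mp h1 h2, rfl⟩
      · exact ⟨_, .gen x h1, rfl⟩
      · exact ⟨_, .nec h1, rfl⟩
  · rintro ⟨φ, h, rfl⟩
    induction h with
    | ax h => exact .base (.inl ⟨_, h, rfl⟩)
    | logic h => exact .base (.inr ⟨_, h, rfl⟩)
    | mp _ _ ih1 ih2 => exact .step (.inl rfl) ih1 ih2
    | gen x _ ih => exact .step (.inr (.inl ⟨x, rfl⟩)) ih ih
    | nec _ ih => exact .step (.inr (.inr rfl)) ih ih

/-- `c` codes a formula whose instance at the numeral of `m` is provable. -/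
def Pf (T : Set Formula) (u c m : ℕ) : Prop :=
  ∃ χ : Formula, χ.code = c ∧ Provable T (χ.subst u (Term.numeral m))

theorem SD.pf {T : Set Formula} (hT : RE T) (u : ℕ) :
    SD (fun p => Pf T u (lft p) (rgt p)) := by
  have : SD (fun p => ∃ s d, s = (Term.numeral (rgt p)).code ∧ SFp (Nat.pair u s) (lft p) d ∧
      ∃ φ, Provable T φ ∧ d = φ.code) := by
    refine SD.ex (SD.ex (SD.and ?_ (SD.and ?_ ?_)))
    · exact SD.app2 (R := fun a b => b = (Term.numeral a).code) SD.num (by fun_prop) (by fun_prop)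
    · exact SD.app3 SD.sf (by fun_prop) (by fun_prop) (by fun_prop)
    · exact SD.comp (SD.pr hT) (by fun_prop)
  refine this.congr fun p => ⟨?_, ?_⟩
  · rintro ⟨s, d, rfl, ⟨x, t, χ, h1, h2, rfl, hf⟩, φ, h, h3⟩
    obtain ⟨rfl, h1b⟩ := Nat.pair_eq_pair.1 h1
    obtain rfl := Term.code_inj.1 h1b
    obtain rfl := Formula.code_inj.1 h3
    exact ⟨χ, h2.symm, h⟩
  · rintro ⟨χ, h1, h2⟩
    exact ⟨_, _, rfl, ⟨u, _, χ, rfl, h1.symm, rfl, Formula.freeFor_closed (Term.numeral_fv _) _ _⟩,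
      _, h2, rfl⟩

end ModalArith

namespace ModalArith
set_option linter.unusedSimpArgs false
set_option linter.unusedVariables false

/-! ### Propositional completeness -/

/-- A Boolean valuation of formulas. -/
structure IsVal (V : Formula → Prop) : Prop where
  falsum : V .falsum ↔ False
  and : ∀ φ ψ, V (.and φ ψ) ↔ (V φ ∧ V ψ)
  or : ∀ φ ψ, V (.or φ ψ) ↔ (V φ ∨ V ψ)
  imp : ∀ φ ψ, V (.imp φ ψ) ↔ (V φ → V ψ)
  neg : ∀ φ, V (.neg φ) ↔ ¬ V φ

theorem IsVal.iff {V : Formula → Prop} (h : IsVal V) (φ ψ : Formula) :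
    V (φ.iff ψ) ↔ (V φ ↔ V ψ) := by
  simp only [Formula.iff, h.and, h.imp]; tauto

/-- Sets of formulas containing all theorems and closed under modus ponens. -/
def MPC (T M : Set Formula) : Prop :=
  (∀ φ, Provable T φ → φ ∈ M) ∧ ∀ φ ψ, φ.imp ψ ∈ M → φ ∈ M → ψ ∈ M

theorem MPC.la {T M : Set Formula} (h : MPC T M) {φ : Formula} (hφ : LogicalAxiom φ) : φ ∈ M :=
  h.1 _ (.logic hφ)

theorem MPC.cond {T M : Set Formula} (h : MPC T M) (a : Formula) :
    MPC T {b | a.imp b ∈ M} := by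
  refine ⟨fun φ hφ => ?_, fun φ ψ h1 h2 => ?_⟩
  · exact h.2 _ _ (h.la (.imp1 φ a)) (h.1 _ hφ)
  · exact h.2 _ _ (h.2 _ _ (h.la (.imp2 a φ ψ)) h1) h2

theorem MPC.self {T M : Set Formula} (h : MPC T M) (a : Formula) : a.imp a ∈ M :=
  h.2 _ _ (h.2 _ _ (h.la (.imp2 a (a.imp a) a)) (h.la (.imp1 a (a.imp a)))) (h.la (.imp1 a a))

theorem taut {T : Set Formula} {φ : Formula}
    (H : ∀ V, IsVal V → (∀ ψ, Provable T ψ → V ψ) → V φ) : Provable T φ := by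
  by_contra hφ
  obtain ⟨M, -, hM⟩ := zorn_subset_nonempty {M : Set Formula | MPC T M ∧ φ ∉ M} (by
    rintro c hc hch ⟨N, hN⟩
    refine ⟨⋃₀ c, ⟨⟨fun ψ hψ => ⟨N, hN, (hc hN).1.1 ψ hψ⟩, ?_⟩, ?_⟩,
      fun s hs => Set.subset_sUnion_of_mem hs⟩
    · rintro a b ⟨s, hs, h1⟩ ⟨t, ht, h2⟩
      rcases hch.total hs ht with h | h
      · exact ⟨t, ht, (hc ht).1.2 a b (h h1) h2⟩
      · exact ⟨s, hs, (hc hs).1.2 a b h1 (h h2)⟩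
    · rintro ⟨s, hs, h⟩
      exact (hc hs).2 h) {ψ | Provable T ψ} ⟨⟨fun _ h => h, fun _ _ h k => .mp h k⟩, hφ⟩
  obtain ⟨hC, hn⟩ := hM.prop
  have key : ∀ a, a ∉ M → a.imp φ ∈ M := by
    intro a ha
    by_contra hh
    have := hM.le_of_ge (y := {b | a.imp b ∈ M}) ⟨hC.cond a, hh⟩
      (fun b hb => hC.2 _ _ (hC.la (.imp1 b a)) hb)
    exact ha (this (hC.self a))
  have hneg : ∀ a, a.neg ∈ M ↔ a ∉ M := by
    intro a
    constructor
    · intro h1 h2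
      exact hn (hC.2 _ _ (hC.2 _ _ (hC.la (.negE a φ)) h1) h2)
    · intro h1
      by_contra h2
      have k1 := key _ h1
      have k2 := key _ h2
      have hN := hC.cond φ.neg
      have up : ∀ b ∈ M, φ.neg.imp b ∈ M := fun b hb => hC.2 _ _ (hC.la (.imp1 b _)) hb
      have n1 : φ.neg ∈ {b | φ.neg.imp b ∈ M} := hC.self _
      have n2 : a.neg ∈ {b | φ.neg.imp b ∈ M} :=
        hN.2 _ _ (hN.2 _ _ (hN.la (.negI a φ)) (up _ k1)) (hN.2 _ _ (hN.la (.imp1 _ a)) n1)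
      have n3 : φ.neg.imp φ ∈ M := hN.2 _ _ (up _ k2) n2
      exact hn (hC.2 _ _ (hC.la (.dne φ)) (hC.2 _ _ (hC.2 _ _ (hC.la (.negI φ.neg φ)) n3)
        (hC.self _)))
  refine hn (H (fun ψ => ψ ∈ M) ⟨?_, ?_, ?_, ?_, hneg⟩ hC.1)
  · refine ⟨fun h => hn (hC.2 _ _ (hC.la (.falsumE φ)) h), False.elim⟩
  · intro a b
    exact ⟨fun h => ⟨hC.2 _ _ (hC.la (.andE1 a b)) h, hC.2 _ _ (hC.la (.andE2 a b)) h⟩,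
      fun h => hC.2 _ _ (hC.2 _ _ (hC.la (.andI a b)) h.1) h.2⟩
  · intro a b
    constructor
    · intro h
      by_contra hh
      rw [not_or] at hh
      exact hn (hC.2 _ _ (hC.2 _ _ (hC.2 _ _ (hC.la (.orE a b φ)) (key _ hh.1)) (key _ hh.2)) h)
    · rintro (h | h)
      · exact hC.2 _ _ (hC.la (.orI1 a b)) h
      · exact hC.2 _ _ (hC.la (.orI2 a b)) h
  · intro a b
    constructor
    · exact fun h k => hC.2 _ _ h k
    · intro h
      by_cases ha : a ∈ M
      · exact hC.2 _ _ (hC.la (.imp1 b a)) (h ha)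
      · exact hC.2 _ _ (hC.la (.negE a b)) ((hneg a).2 ha)

section
variable {T : Set Formula}

theorem taut0 {φ : Formula} (H : ∀ V, IsVal V → V φ) : Provable T φ :=
  taut fun V hV _ => H V hV
theorem taut1 {a φ : Formula} (h : Provable T a) (H : ∀ V, IsVal V → V a → V φ) : Provable T φ :=
  taut fun V hV k => H V hV (k _ h)
theorem taut2 {a b φ : Formula} (h : Provable T a) (h2 : Provable T b)
    (H : ∀ V, IsVal V → V a → V b → V φ) : Provable T φ :=
  taut fun V hV k => H V hV (k _ h) (k _ h2)
theorem taut3 {a b c φ : Formula} (h : Provable T a) (h2 : Provable T b) (h3 : Provable T c)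
    (H : ∀ V, IsVal V → V a → V b → V c → V φ) : Provable T φ :=
  taut fun V hV k => H V hV (k _ h) (k _ h2) (k _ h3)
theorem taut4 {a b c d φ : Formula} (h : Provable T a) (h2 : Provable T b) (h3 : Provable T c)
    (h4 : Provable T d) (H : ∀ V, IsVal V → V a → V b → V c → V d → V φ) : Provable T φ :=
  taut fun V hV k => H V hV (k _ h) (k _ h2) (k _ h3) (k _ h4)
theorem taut5 {a b c d e φ : Formula} (h : Provable T a) (h2 : Provable T b) (h3 : Provable T c)
    (h4 : Provable T d) (h5 : Provable T e)
    (H : ∀ V, IsVal V → V a → V b → V c → V d → V e → V φ) : Provable T φ :=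
  taut fun V hV k => H V hV (k _ h) (k _ h2) (k _ h3) (k _ h4) (k _ h5)

/-! ### First-order rules -/

theorem allE {x : ℕ} {t : Term} {φ : Formula} (h : φ.freeFor t x) :
    Provable T ((Formula.all x φ).imp (φ.subst x t)) := .logic (.allE x t φ h)
theorem exI {x : ℕ} {t : Term} {φ : Formula} (h : φ.freeFor t x) :
    Provable T ((φ.subst x t).imp (Formula.ex x φ)) := .logic (.exI x t φ h)

theorem inst {x : ℕ} {φ : Formula} (h : Provable T φ) (t : Term) (hf : φ.freeFor t x) :
    Provable T (φ.subst x t) := .mp (allE hf) (.gen x h)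

theorem allI {x : ℕ} {ψ φ : Formula} (h : Provable T (ψ.imp φ)) (hx : x ∉ ψ.fv) :
    Provable T (ψ.imp (.all x φ)) := .mp (.logic (.allImp x ψ φ hx)) (.gen x h)

theorem exE {x : ℕ} {ψ φ : Formula} (h : Provable T (φ.imp ψ)) (hx : x ∉ ψ.fv) :
    Provable T ((Formula.ex x φ).imp ψ) := .mp (.logic (.exE x φ ψ hx)) (.gen x h)

theorem freeFor_var (x : ℕ) (φ : Formula) : φ.freeFor (.var x) x := by
  induction φ <;> simp_all [Formula.freeFor, Term.fv] <;> grind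

@[simp] theorem subst_self (x : ℕ) (φ : Formula) : φ.subst x (.var x) = φ := by
  simp [Formula.subst]

theorem allE' (x : ℕ) (φ : Formula) : Provable T ((Formula.all x φ).imp φ) := by
  simpa using allE (T := T) (freeFor_var x φ)
theorem exI' (x : ℕ) (φ : Formula) : Provable T (φ.imp (Formula.ex x φ)) := by
  simpa using exI (T := T) (freeFor_var x φ)

end

/-! ### Simplification of substitutions -/

@[simp] theorem Term.subst_var_same (x : ℕ) (s : Term) : Term.subst x s (.var x) = s := by
  simp [Term.subst, Term.substAll]
theorem Term.subst_var_ne {x y : ℕ} (h : y ≠ x) (s : Term) :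
    Term.subst x s (.var y) = .var y := by
  simp [Term.subst, Term.substAll, h]
@[simp] theorem Term.subst_zero (x : ℕ) (s : Term) : Term.subst x s .zero = .zero := rfl
@[simp] theorem Term.subst_succ (x : ℕ) (s t : Term) :
    Term.subst x s (.succ t) = .succ (Term.subst x s t) := rfl
@[simp] theorem Term.subst_add (x : ℕ) (s t u : Term) :
    Term.subst x s (.add t u) = .add (Term.subst x s t) (Term.subst x s u) := rfl
@[simp] theorem Term.subst_mul (x : ℕ) (s t u : Term) :
    Term.subst x s (.mul t u) = .mul (Term.subst x s t) (Term.subst x s u) := rfl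
@[simp] theorem Formula.subst_falsum (x : ℕ) (s : Term) :
    Formula.subst x s .falsum = .falsum := rfl
@[simp] theorem Formula.subst_eq (x : ℕ) (s t u : Term) :
    Formula.subst x s (.eq t u) = .eq (Term.subst x s t) (Term.subst x s u) := rfl
@[simp] theorem Formula.subst_le (x : ℕ) (s t u : Term) :
    Formula.subst x s (.le t u) = .le (Term.subst x s t) (Term.subst x s u) := rfl
@[simp] theorem Formula.subst_lt (x : ℕ) (s t u : Term) :
    Formula.subst x s (.lt t u) = .lt (Term.subst x s t) (Term.subst x s u) := rfl
@[simp] theorem Formula.subst_and (x : ℕ) (s : Term) (φ ψ : Formula) :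
    Formula.subst x s (.and φ ψ) = .and (φ.subst x s) (ψ.subst x s) := rfl
@[simp] theorem Formula.subst_or (x : ℕ) (s : Term) (φ ψ : Formula) :
    Formula.subst x s (.or φ ψ) = .or (φ.subst x s) (ψ.subst x s) := rfl
@[simp] theorem Formula.subst_imp (x : ℕ) (s : Term) (φ ψ : Formula) :
    Formula.subst x s (.imp φ ψ) = .imp (φ.subst x s) (ψ.subst x s) := rfl
@[simp] theorem Formula.subst_iff (x : ℕ) (s : Term) (φ ψ : Formula) :
    Formula.subst x s (.iff φ ψ) = .iff (φ.subst x s) (ψ.subst x s) := rfl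
@[simp] theorem Formula.subst_neg (x : ℕ) (s : Term) (φ : Formula) :
    Formula.subst x s (.neg φ) = .neg (φ.subst x s) := rfl
@[simp] theorem Formula.subst_box (x : ℕ) (s : Term) (φ : Formula) :
    Formula.subst x s (.box φ) = .box (φ.subst x s) := rfl

theorem Term.substAll_substAll (t : Term) (v w : ℕ → Term) :
    (t.substAll v).substAll w = t.substAll (fun x => (v x).substAll w) := by
  induction t <;> simp_all [Term.substAll]

theorem Term.mem_fv_substAll {t : Term} {v : ℕ → Term} {x : ℕ} (h : x ∈ (t.substAll v).fv) :
    ∃ y ∈ t.fv, x ∈ (v y).fv := by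
  induction t with
  | var y => exact ⟨y, by simp [Term.fv], h⟩
  | zero => simp [Term.substAll, Term.fv] at h
  | succ t ih => exact ih h
  | add t u iht ihu | mul t u iht ihu =>
    simp only [Term.substAll, Term.fv, Finset.mem_union] at h ⊢
    rcases h with h | h
    · obtain ⟨y, h1, h2⟩ := iht h; exact ⟨y, .inl h1, h2⟩
    · obtain ⟨y, h1, h2⟩ := ihu h; exact ⟨y, .inr h1, h2⟩

theorem Formula.mem_fv_substAll {φ : Formula} {v : ℕ → Term} {x : ℕ}
    (h : x ∈ (φ.substAll v).fv) : ∃ y ∈ φ.fv, x ∈ (v y).fv := by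
  induction φ generalizing v with
  | falsum => simp [Formula.substAll, Formula.fv] at h
  | eq t u | le t u =>
    simp only [Formula.substAll, Formula.fv, Finset.mem_union] at h ⊢
    rcases h with h | h
    · obtain ⟨y, h1, h2⟩ := Term.mem_fv_substAll h; exact ⟨y, .inl h1, h2⟩
    · obtain ⟨y, h1, h2⟩ := Term.mem_fv_substAll h; exact ⟨y, .inr h1, h2⟩
  | and t u iht ihu | or t u iht ihu | imp t u iht ihu =>
    simp only [Formula.substAll, Formula.fv, Finset.mem_union] at h ⊢
    rcases h with h | h
    · obtain ⟨y, h1, h2⟩ := iht h; exact ⟨y, .inl h1, h2⟩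
    · obtain ⟨y, h1, h2⟩ := ihu h; exact ⟨y, .inr h1, h2⟩
  | neg φ ih | box φ ih => exact ih h
  | all y φ ih | ex y φ ih =>
    simp only [Formula.substAll, Formula.fv, Finset.mem_erase] at h ⊢
    obtain ⟨z, h1, h2⟩ := ih h.2
    by_cases hz : z = y
    · subst hz
      simp [Term.fv, h.1] at h2
    · rw [Function.update_of_ne hz] at h2
      exact ⟨z, ⟨hz, h1⟩, h2⟩

/-- Quantifier-free formulas (boxes allowed). -/
def QF : Formula → Prop
  | .falsum => True
  | .eq _ _ => True
  | .le _ _ => True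
  | .and φ ψ => QF φ ∧ QF ψ
  | .or φ ψ => QF φ ∧ QF ψ
  | .imp φ ψ => QF φ ∧ QF ψ
  | .neg φ => QF φ
  | .all _ _ => False
  | .ex _ _ => False
  | .box φ => QF φ

theorem QF.substAll_substAll {φ : Formula} (h : QF φ) (v w : ℕ → Term) :
    (φ.substAll v).substAll w = φ.substAll (fun x => (v x).substAll w) := by
  induction φ <;> simp_all [Formula.substAll, QF, Term.substAll_substAll]

theorem QF.freeFor {φ : Formula} (h : QF φ) (x : ℕ) (t : Term) : φ.freeFor t x := by
  induction φ <;> simp_all [Formula.freeFor, QF]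

theorem QF.substAll {φ : Formula} (h : QF φ) (v : ℕ → Term) : QF (φ.substAll v) := by
  induction φ <;> simp_all [Formula.substAll, QF]

theorem QF.inst_aux {T : Set Formula} {φ : Formula} (hq : QF φ) (h : Provable T φ) (w : ℕ → Term)
    (hw : ∀ x ∈ φ.fv, ∀ y ∈ φ.fv, y ∉ (w x).fv) (s : Finset ℕ) (hs : s ⊆ φ.fv) :
    Provable T (φ.substAll fun x => if x ∈ s then w x else .var x) := by
  induction s using Finset.induction_on with
  | empty =>
    have : (fun x => if x ∈ (∅ : Finset ℕ) then w x else Term.var x) = Term.var := by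
      funext x; simp
    rw [this]; simpa using h
  | insert a s ha ih =>
    have h1 := ih fun x hx => hs (Finset.mem_insert_of_mem hx)
    have h2 := inst (x := a) h1 (w a) ((hq.substAll _).freeFor _ _)
    unfold Formula.subst at h2
    rw [hq.substAll_substAll] at h2
    rw [Formula.substAll_congr] at h2
    · exact h2
    · intro x hx
      by_cases hxs : x ∈ s
      · have hne : x ≠ a := by rintro rfl; exact ha hxs
        simp only [hxs, if_true, Finset.mem_insert, or_true]
        exact Term.subst_not_fv (hw x hx a (hs (Finset.mem_insert_self _ _)))
      · by_cases hxa : x = a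
        · subst hxa; simp [hxs, Term.substAll]
        · simp [hxs, hxa, Term.substAll]

theorem QF.inst {T : Set Formula} {φ : Formula} (hq : QF φ) (h : Provable T φ) (v : ℕ → Term) :
    Provable T (φ.substAll v) := by
  obtain ⟨N, hN1⟩ : ∃ N, ∀ x ∈ φ.fv ∪ φ.fv.biUnion (fun x => (v x).fv), x < N := by
    refine ⟨(φ.fv ∪ φ.fv.biUnion (fun x => (v x).fv)).sup id + 1, fun x hx => ?_⟩
    exact Nat.lt_succ_of_le (Finset.le_sup (f := id) hx)
  have h1 := hq.inst_aux h (fun x => .var (N + x)) (fun x hx y hy => by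
    have := hN1 y (by simp [hy])
    simp [Term.fv]; omega) φ.fv (fun _ h => h)
  have e1 : (φ.substAll fun x => if x ∈ φ.fv then Term.var (N + x) else .var x) =
      φ.substAll (fun x => .var (N + x)) :=
    Formula.substAll_congr fun x hx => by simp [hx]
  rw [e1] at h1
  have hfv : ∀ y ∈ (φ.substAll (fun x => .var (N + x))).fv, ∃ x ∈ φ.fv, y = N + x := by
    intro y hy
    obtain ⟨x, hx, hh⟩ := Formula.mem_fv_substAll hy
    exact ⟨x, hx, by simpa [Term.fv] using hh⟩
  have h2 := (hq.substAll (fun x => .var (N + x))).inst_aux h1 (fun y => v (y - N)) (by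
    intro y hy z hz
    obtain ⟨x, hx, rfl⟩ := hfv y hy
    obtain ⟨x', hx', rfl⟩ := hfv z hz
    intro hh
    have := hN1 (N + x') (by
      rw [Finset.mem_union, Finset.mem_biUnion]
      exact .inr ⟨x, hx, by simpa using hh⟩)
    omega) _ (fun _ h => h)
  rw [Formula.substAll_congr (w := fun y => v (y - N)) (fun x hx => by simp [hx]),
    hq.substAll_substAll] at h2
  simpa [Term.substAll] using h2

/-- Valuation used to instantiate the first three variables. -/
def v3 (t u w : Term) : ℕ → Term := fun i =>
  if i = 0 then t else if i = 1 then u else if i = 2 then w else .zero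

/-- Substitutions replacing variables by themselves or by closed terms. -/
def CV (v : ℕ → Term) : Prop := ∀ i, v i = .var i ∨ (v i).fv = ∅

theorem Term.substAll_closed {t : Term} (h : t.fv = ∅) (v : ℕ → Term) : t.substAll v = t := by
  rw [Term.substAll_congr (w := Term.var) (by simp [h]), Term.substAll_var]

theorem CV.update {v : ℕ → Term} (h : CV v) (x : ℕ) : CV (Function.update v x (.var x)) := by
  intro i
  by_cases hi : i = x
  · subst hi; simp
  · rw [Function.update_of_ne hi]; exact h i

theorem CV.substAll_substAll {φ : Formula} {v : ℕ → Term} (h : CV v) (w : ℕ → Term) :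
    (φ.substAll v).substAll w = φ.substAll (fun x => (v x).substAll w) := by
  induction φ generalizing v w with
  | falsum => rfl
  | eq t u | le t u => simp [Formula.substAll, Term.substAll_substAll]
  | and t u iht ihu | or t u iht ihu | imp t u iht ihu => simp [Formula.substAll, iht h, ihu h]
  | neg φ ih | box φ ih => simp [Formula.substAll, ih h]
  | all y φ ih | ex y φ ih =>
    simp only [Formula.substAll, ih (h.update y)]
    congr 2
    funext i
    by_cases hi : i = y
    · subst hi; simp [Term.substAll]
    · rw [Function.update_of_ne hi, Function.update_of_ne hi]
      rcases h i with h | h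
      · simp [h, Term.substAll, hi]
      · simp [Term.substAll_closed h]

/-- A bound on all the variables occurring in a formula, bound or free. -/
def bd : Formula → ℕ
  | .falsum => 0
  | .eq t u => (t.fv ∪ u.fv).sup id + 1
  | .le t u => (t.fv ∪ u.fv).sup id + 1
  | .and φ ψ => max (bd φ) (bd ψ)
  | .or φ ψ => max (bd φ) (bd ψ)
  | .imp φ ψ => max (bd φ) (bd ψ)
  | .neg φ => bd φ
  | .all x φ => max (x + 1) (bd φ)
  | .ex x φ => max (x + 1) (bd φ)
  | .box φ => bd φ

theorem bd_fv {φ : Formula} {x : ℕ} (h : bd φ ≤ x) : x ∉ φ.fv := by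
  induction φ with
  | falsum => simp [Formula.fv]
  | eq t u | le t u =>
    intro hx
    have := Finset.le_sup (f := id) hx
    simp only [bd, Formula.fv, id] at h this
    omega
  | and t u iht ihu | or t u iht ihu | imp t u iht ihu =>
    simp only [bd, max_le_iff] at h
    simp [Formula.fv, iht h.1, ihu h.2]
  | neg φ ih | box φ ih => exact ih h
  | all y φ ih | ex y φ ih =>
    simp only [bd, max_le_iff] at h
    simp [Formula.fv, ih h.2]

theorem bd_freeFor {φ : Formula} {u : ℕ} (h : bd φ ≤ u) (x : ℕ) : φ.freeFor (.var u) x := by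
  induction φ with
  | falsum => trivial
  | eq t u => trivial
  | le t u => trivial
  | and t u iht ihu | or t u iht ihu | imp t u iht ihu =>
    simp only [bd, max_le_iff] at h
    exact ⟨iht h.1, ihu h.2⟩
  | neg φ ih | box φ ih => exact ih h
  | all y φ ih | ex y φ ih =>
    simp only [bd, max_le_iff] at h
    refine .inr (.inr ⟨?_, ih h.2⟩)
    simp [Term.fv]; omega

end ModalArith

namespace ModalArith
set_option linter.unusedSimpArgs false
set_option linter.unusedVariables false

/-- Boolean valuations making all theorems of `T` true. -/
structure Mdl (T : Set Formula) (V : Formula → Prop) : Prop extends IsVal V where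
  prov : ∀ ψ, Provable T ψ → V ψ

theorem pr {T : Set Formula} {φ : Formula} (H : ∀ V, Mdl T V → V φ) : Provable T φ :=
  taut fun V hV k => H V { toIsVal := hV, prov := k }

namespace Mdl
variable {T : Set Formula} {V : Formula → Prop} (m : Mdl T V)
include m
theorem refl (t : Term) : V (.eq t t) := m.prov _ (.logic (.eqRefl t))
theorem symm {t u : Term} (h : V (.eq t u)) : V (.eq u t) := by
  have := m.prov _ (.logic (.eqSymm t u)); rw [m.imp] at this; exact this h
theorem trans {t u w : Term} (h : V (.eq t u)) (h2 : V (.eq u w)) : V (.eq t w) := by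
  have := m.prov _ (.logic (.eqTrans t u w)); simp only [m.imp] at this; exact this h h2
theorem succ {t u : Term} (h : V (.eq t u)) : V (.eq t.succ u.succ) := by
  have := m.prov _ (.logic (.eqSucc t u)); simp only [m.imp] at this; exact this h
theorem add {t u t' u' : Term} (h : V (.eq t t')) (h2 : V (.eq u u')) :
    V (.eq (t.add u) (t'.add u')) := by
  have := m.prov _ (.logic (.eqAdd t t' u u')); simp only [m.imp] at this; exact this h h2
theorem mul {t u t' u' : Term} (h : V (.eq t t')) (h2 : V (.eq u u')) :
    V (.eq (t.mul u) (t'.mul u')) := by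
  have := m.prov _ (.logic (.eqMul t t' u u')); simp only [m.imp] at this; exact this h h2
theorem le {t u t' u' : Term} (h : V (.eq t t')) (h2 : V (.eq u u')) (h3 : V (.le t u)) :
    V (.le t' u') := by
  have := m.prov _ (.logic (.eqLe t t' u u')); simp only [m.imp] at this; exact this h h2 h3
theorem lt {t u t' u' : Term} (h : V (.eq t t')) (h2 : V (.eq u u')) (h3 : V (.lt t u)) :
    V (.lt t' u') := m.le (m.succ h) h2 h3
theorem mp {φ ψ : Formula} (h : Provable T (φ.imp ψ)) (h2 : V φ) : V ψ :=
  (m.imp _ _).1 (m.prov _ h) h2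
end Mdl

theorem imp_of {T : Set Formula} {φ ψ : Formula} (H : ∀ V, Mdl T V → V φ → V ψ) :
    Provable T (φ.imp ψ) := pr fun V m => (m.imp _ _).2 (H V m)

section
variable {T : Set Formula} (hT : Extends T PAK4)
include hT

theorem base {φ : Formula} (h : φ ∈ baseAxioms) : Provable T φ :=
  hT _ (Or.inl (Or.inl (Or.inl h)))

theorem ind {x : ℕ} {φ : Formula} (h0 : Provable T (φ.subst x .zero))
    (h1 : Provable T (φ.imp (φ.subst x (.succ (.var x))))) : Provable T φ := by
  have h := hT (inductionAx x φ) (Or.inl (Or.inl (Or.inr ⟨x, φ, rfl⟩)))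
  refine .mp (allE' x φ) (.mp h ?_)
  exact .mp (.mp (.logic (.andI _ _)) h0) (.gen x h1)

theorem K0 (φ ψ : Formula) : Provable T (axK φ ψ) := hT _ (Or.inl (Or.inr ⟨φ, ψ, rfl⟩))

theorem four (φ : Formula) : Provable T ((Formula.box φ).imp (Formula.box (Formula.box φ))) :=
  hT _ (Or.inr ⟨φ, rfl⟩)

theorem K1 {φ ψ : Formula} (h : Provable T (φ.imp ψ)) :
    Provable T ((Formula.box φ).imp (Formula.box ψ)) := .mp (K0 hT φ ψ) (.nec h)

theorem K2 {φ ψ χ : Formula} (h : Provable T (φ.imp (ψ.imp χ))) :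
    Provable T ((Formula.box φ).imp ((Formula.box ψ).imp (Formula.box χ))) := by
  have h1 := K1 hT h
  have h2 := K0 hT ψ χ
  refine imp_of fun V m h => ?_
  exact m.mp h2 (m.mp h1 h)

theorem a_zero (t : Term) : Provable T (.eq (t.add .zero) t) := by
  have := QF.inst (by simp [QF, addZero]) (base hT (φ := addZero) (by simp [baseAxioms])) (v3 t t t)
  simpa [Formula.substAll, Term.substAll, v3, addZero] using this
theorem a_succ (t u : Term) : Provable T (.eq (t.add u.succ) (t.add u).succ) := by
  have := QF.inst (by simp [QF, addSucc]) (base hT (φ := addSucc) (by simp [baseAxioms])) (v3 t u t)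
  simpa [Formula.substAll, Term.substAll, v3, addSucc] using this
theorem m_zero (t : Term) : Provable T (.eq (t.mul .zero) .zero) := by
  have := QF.inst (by simp [QF, mulZero]) (base hT (φ := mulZero) (by simp [baseAxioms])) (v3 t t t)
  simpa [Formula.substAll, Term.substAll, v3, mulZero] using this
theorem m_succ (t u : Term) : Provable T (.eq (t.mul u.succ) ((t.mul u).add t)) := by
  have := QF.inst (by simp [QF, mulSucc]) (base hT (φ := mulSucc) (by simp [baseAxioms])) (v3 t u t)
  simpa [Formula.substAll, Term.substAll, v3, mulSucc] using this
theorem s_ne (t : Term) : Provable T (Formula.neg (.eq t.succ .zero)) := by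
  have := QF.inst (by simp [QF, succNeZero]) (base hT (φ := succNeZero) (by simp [baseAxioms])) (v3 t t t)
  simpa [Formula.substAll, Term.substAll, v3, succNeZero] using this
theorem s_inj (t u : Term) : Provable T ((Formula.eq t.succ u.succ).imp (.eq t u)) := by
  have := QF.inst (by simp [QF, succInj]) (base hT (φ := succInj) (by simp [baseAxioms])) (v3 t u t)
  simpa [Formula.substAll, Term.substAll, v3, succInj] using this

theorem z_add (t : Term) : Provable T (.eq (Term.zero.add t) t) := by
  have h : Provable T (.eq (Term.zero.add (.var 0)) (.var 0)) := by
    apply ind hT (x := 0)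
    · simpa using a_zero hT .zero
    · simp only [Formula.subst_eq, Term.subst_add, Term.subst_zero, Term.subst_var_same]
      exact imp_of fun V m h => m.trans (m.prov _ (a_succ hT _ _)) (m.succ h)
  have := QF.inst (by simp [QF]) h (v3 t t t)
  simpa [Formula.substAll, Term.substAll, v3] using this

theorem s_add (t u : Term) : Provable T (.eq (t.succ.add u) (t.add u).succ) := by
  have h : Provable T (.eq ((Term.var 0).succ.add (.var 1)) ((Term.var 0).add (.var 1)).succ) := by
    apply ind hT (x := 1)
    · simp only [Formula.subst_eq, Term.subst_add, Term.subst_zero, Term.subst_succ,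
        Term.subst_var_same, Term.subst_var_ne (show 0 ≠ 1 by simp)]
      exact pr fun V m => m.trans (m.prov _ (a_zero hT _)) (m.symm (m.succ (m.prov _ (a_zero hT _))))
    · simp only [Formula.subst_eq, Term.subst_add, Term.subst_zero, Term.subst_succ,
        Term.subst_var_same, Term.subst_var_ne (show 0 ≠ 1 by simp)]
      exact imp_of fun V m h => m.trans (m.prov _ (a_succ hT _ _)) (m.trans (m.succ h)
        (m.symm (m.succ (m.prov _ (a_succ hT _ _)))))
  have := QF.inst (by simp [QF]) h (v3 t u t)
  simpa [Formula.substAll, Term.substAll, v3] using this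

theorem lt_intro (t u w : Term) : Provable T ((Formula.eq (t.succ.add w) u).imp (.lt t u)) := by
  have h : Provable T ((Formula.eq ((Term.var 0).add (.var 2)) (.var 1)).imp
      (.le (.var 0) (.var 1))) := by
    have h1 := base hT (φ := leDef) (by simp [baseAxioms])
    have h2 := exI' (T := T) 2 (.eq ((Term.var 0).add (.var 2)) (.var 1))
    exact imp_of fun V m h => ((m.iff _ _).1 (m.prov _ h1)).2 (m.mp h2 h)
  have := QF.inst (by simp [QF]) h (v3 t.succ u w)
  simpa [Formula.substAll, Term.substAll, v3, Formula.lt] using this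

theorem lt_elim {ψ : Formula} (h : Provable T
    ((Formula.eq ((Term.var 0).succ.add (.var 2)) (.var 1)).imp ψ)) (h2 : 2 ∉ ψ.fv) :
    Provable T ((Formula.lt (.var 0) (.var 1)).imp ψ) := by
  have h1 := base hT (φ := leDef) (by simp [baseAxioms])
  have h3 := inst h1 (x := 0) (.succ (.var 0)) (by simp [leDef, Formula.iff, Formula.freeFor, Term.fv])
  have h4 : (leDef.subst 0 (.succ (.var 0))) = (Formula.lt (.var 0) (.var 1)).iff
    (Formula.ex 2 (Formula.eq (Term.add (.succ (.var 0)) (Term.var 2)) (Term.var 1))) := by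
    simp [leDef, Formula.lt, Formula.iff, Formula.subst, Formula.substAll, Term.substAll]
  rw [h4] at h3
  have h5 := exE h h2
  exact imp_of fun V m h => m.mp h5 (((m.iff _ _).1 (m.prov _ h3)).1 h)

theorem lt_zero (t : Term) : Provable T (Formula.neg (.lt t .zero)) := by
  have h : Provable T ((Formula.lt (.var 0) (.var 1)).imp (.neg (.eq (.var 1) .zero))) := by
    refine lt_elim hT (imp_of fun V m h => ?_) (by simp [Formula.fv, Term.fv])
    rw [m.neg]
    intro h2
    have := m.prov _ (s_ne hT ((Term.var 0).add (.var 2)))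
    rw [m.neg] at this
    exact this (m.trans (m.symm (m.prov _ (s_add hT _ _))) (m.trans h h2))
  have := QF.inst (by simp [QF, Formula.lt]) h (v3 t .zero t)
  simp only [Formula.substAll, Term.substAll, v3, Formula.lt] at this
  exact pr fun V m => by
    have := m.prov _ this
    simp only [m.imp, m.neg, Formula.lt, if_true] at this ⊢
    intro h; exact this h (m.refl _)

theorem le_cases (t u w : Term) : Provable T ((Formula.eq (t.add w) u).imp
    ((Formula.lt t u).or (.eq t u))) := by
  have h : Provable T ((Formula.eq ((Term.var 0).add (.var 2)) (.var 1)).imp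
    ((Formula.lt (.var 0) (.var 1)).or (.eq (.var 0) (.var 1)))) := by
    apply ind hT (x := 2)
    · simp only [Formula.subst_imp, Formula.subst_or, Formula.subst_lt, Formula.subst_eq,
        Term.subst_add, Term.subst_zero, Term.subst_succ,
        Term.subst_var_same, Term.subst_var_ne (show 0 ≠ 2 by simp), Term.subst_var_ne (show 1 ≠ 2 by simp)]
      exact imp_of fun V m h => (m.or _ _).2 (.inr (m.trans (m.symm (m.prov _ (a_zero hT _))) h))
    · simp only [Formula.subst_imp, Formula.subst_or, Formula.subst_lt, Formula.subst_eq,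
        Term.subst_add, Term.subst_zero, Term.subst_succ,
        Term.subst_var_same, Term.subst_var_ne (show 0 ≠ 2 by simp), Term.subst_var_ne (show 1 ≠ 2 by simp)]
      refine imp_of fun V m _ => (m.imp _ _).2 fun h => (m.or _ _).2 (.inl ?_)
      exact m.mp (lt_intro hT _ _ (.var 2)) (m.trans (m.prov _ (s_add hT _ _))
        (m.trans (m.symm (m.prov _ (a_succ hT _ _))) h))
  have := QF.inst (by simp [QF, Formula.lt]) h (v3 t u w)
  simpa [Formula.substAll, Term.substAll, v3, Formula.lt] using this

theorem lt_succ_cases (t u : Term) : Provable T ((Formula.lt t u.succ).imp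
    ((Formula.lt t u).or (.eq t u))) := by
  have h : Provable T ((Formula.lt (.var 0) (.var 1)).imp ((Formula.eq (.var 1) (.succ (.var 3))).imp
      ((Formula.lt (.var 0) (.var 3)).or (.eq (.var 0) (.var 3))))) := by
    refine lt_elim hT (imp_of fun V m h => ?_) (by simp [Formula.fv, Term.fv, Formula.lt])
    rw [m.imp]
    intro h2
    refine m.mp (le_cases hT _ _ (.var 2)) (m.mp (s_inj hT _ _) ?_)
    exact m.trans (m.symm (m.prov _ (s_add hT _ _))) (m.trans h h2)
  have := QF.inst (by simp [QF, Formula.lt]) h (fun i => if i = 0 then t else if i = 1 then u.succ else u)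
  simp only [Formula.substAll, Term.substAll, v3, Formula.lt] at this
  exact imp_of fun V m h => by
    have := m.mp this h
    rw [m.imp] at this
    exact this (m.refl _)

theorem lt_succ_of_lt (t u : Term) : Provable T ((Formula.lt t u).imp (.lt t u.succ)) := by
  have h : Provable T ((Formula.lt (.var 0) (.var 1)).imp (.lt (.var 0) (.succ (.var 1)))) := by
    refine lt_elim hT (imp_of fun V m h => ?_) (by simp [Formula.fv, Term.fv, Formula.lt])
    exact m.mp (lt_intro hT _ _ (.succ (.var 2))) (m.trans (m.prov _ (a_succ hT _ _)) (m.succ h))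
  have := QF.inst (by simp [QF, Formula.lt]) h (v3 t u u)
  simpa [Formula.substAll, Term.substAll, v3, Formula.lt] using this

theorem lt_succ_of_eq (t u : Term) : Provable T ((Formula.eq t u).imp (.lt t u.succ)) :=
  imp_of fun V m h => m.mp (lt_intro hT _ _ .zero) (m.trans (m.prov _ (a_zero hT _)) (m.succ h))

theorem succ_lt (t u : Term) : Provable T ((Formula.lt t u).imp
    ((Formula.lt t.succ u).or (.eq t.succ u))) := by
  have h : Provable T ((Formula.lt (.var 0) (.var 1)).imp
      ((Formula.lt (.succ (.var 0)) (.var 1)).or (.eq (.succ (.var 0)) (.var 1)))) :=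
    lt_elim hT (le_cases hT _ _ (.var 2)) (by simp [Formula.fv, Term.fv, Formula.lt])
  have := QF.inst (by simp [QF, Formula.lt]) h (v3 t u u)
  simpa [Formula.substAll, Term.substAll, v3, Formula.lt] using this

theorem lt_of_succ_lt (t u : Term) : Provable T ((Formula.lt t.succ u).imp (.lt t u)) := by
  have h : Provable T ((Formula.lt (.var 0) (.var 1)).imp
      ((Formula.eq (.var 0) (.succ (.var 3))).imp (.lt (.var 3) (.var 1)))) := by
    refine lt_elim hT (imp_of fun V m h => ?_) (by simp [Formula.fv, Term.fv, Formula.lt])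
    rw [m.imp]
    intro h2
    refine m.mp (lt_intro hT _ _ (.succ (.var 2))) ?_
    refine m.trans (m.prov _ (a_succ hT _ _)) (m.trans ?_ h)
    exact m.trans (m.symm (m.prov _ (s_add hT _ _))) (m.add (m.succ (m.symm h2)) (m.refl _))
  have := QF.inst (by simp [QF, Formula.lt]) h (fun i => if i = 0 then t.succ else if i = 1 then u else t)
  simp only [Formula.substAll, Term.substAll, v3, Formula.lt] at this
  exact imp_of fun V m h => by
    have := m.mp this h
    rw [m.imp] at this
    exact this (m.refl _)

theorem zero_lt_succ (t : Term) : Provable T (Formula.lt .zero t.succ) :=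
  pr fun V m => m.mp (lt_intro hT _ _ t) (m.trans (m.prov _ (s_add hT _ _))
    (m.succ (m.prov _ (z_add hT _))))

theorem zero_cases (t : Term) : Provable T ((Formula.eq t .zero).or (.lt .zero t)) := by
  have h : Provable T ((Formula.eq (.var 0) .zero).or (.lt .zero (.var 0))) := by
    apply ind hT (x := 0)
    · simp only [Formula.subst_imp, Formula.subst_or, Formula.subst_lt, Formula.subst_eq,
        Term.subst_add, Term.subst_zero, Term.subst_succ, Term.subst_var_same]
      exact pr fun V m => (m.or _ _).2 (.inl (m.refl _))
    · simp only [Formula.subst_imp, Formula.subst_or, Formula.subst_lt, Formula.subst_eq,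
        Term.subst_add, Term.subst_zero, Term.subst_succ, Term.subst_var_same]
      exact imp_of fun V m h => (m.or _ _).2 (.inr (m.prov _ (zero_lt_succ hT _)))
  have := QF.inst (by simp [QF, Formula.lt]) h (v3 t t t)
  simpa [Formula.substAll, Term.substAll, v3, Formula.lt] using this

theorem trich (t u : Term) :
    Provable T ((Formula.eq t u).or ((Formula.lt t u).or (.lt u t))) := by
  have h : Provable T ((Formula.eq (.var 0) (.var 1)).or
      ((Formula.lt (.var 0) (.var 1)).or (.lt (.var 1) (.var 0)))) := by
    apply ind hT (x := 1)
    · simp only [Formula.subst_imp, Formula.subst_or, Formula.subst_lt, Formula.subst_eq,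
        Term.subst_add, Term.subst_zero, Term.subst_succ, Term.subst_var_same,
        Term.subst_var_ne (show 0 ≠ 1 by simp)]
      exact pr fun V m => by
        have := m.prov _ (zero_cases hT (.var 0))
        simp only [m.or] at this ⊢; tauto
    · simp only [Formula.subst_imp, Formula.subst_or, Formula.subst_lt, Formula.subst_eq,
        Term.subst_add, Term.subst_zero, Term.subst_succ, Term.subst_var_same,
        Term.subst_var_ne (show 0 ≠ 1 by simp)]
      refine imp_of fun V m h => ?_
      simp only [m.or] at h ⊢
      rcases h with h | h | h
      · exact .inr (.inl (m.mp (lt_succ_of_eq hT _ _) h))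
      · exact .inr (.inl (m.mp (lt_succ_of_lt hT _ _) h))
      · have := m.mp (succ_lt hT _ _) h
        rw [m.or] at this
        rcases this with h | h
        · exact .inr (.inr h)
        · exact .inl (m.symm h)
  have := QF.inst (by simp [QF, Formula.lt]) h (v3 t u u)
  simpa [Formula.substAll, Term.substAll, v3, Formula.lt] using this

theorem lt_irrefl (t : Term) : Provable T (Formula.neg (.lt t t)) := by
  have h : Provable T (Formula.neg (.lt (.var 0) (.var 0))) := by
    apply ind hT (x := 0)
    · simpa using lt_zero hT .zero
    · simp only [Formula.subst_imp, Formula.subst_neg, Formula.subst_lt, Formula.subst_eq,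
        Term.subst_add, Term.subst_zero, Term.subst_succ, Term.subst_var_same]
      refine imp_of fun V m h => ?_
      rw [m.neg] at h ⊢
      intro h2
      apply h
      have := m.mp (lt_succ_cases hT _ _) h2
      rw [m.or] at this
      rcases this with h3 | h3
      · exact m.mp (lt_of_succ_lt hT _ _) h3
      · exact m.lt (m.refl _) h3 (m.mp (lt_succ_of_eq hT _ _) (m.refl _))
  have := QF.inst (by simp [QF, Formula.lt]) h (v3 t t t)
  simpa [Formula.substAll, Term.substAll, v3, Formula.lt] using this

theorem lt_ne (t u : Term) : Provable T ((Formula.lt t u).imp (Formula.neg (.eq t u))) :=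
  imp_of fun V m h => by
    rw [m.neg]; intro h2
    have := m.prov _ (lt_irrefl hT u)
    rw [m.neg] at this
    exact this (m.lt h2 (m.refl _) h)

end
end ModalArith

namespace ModalArith
set_option linter.unusedSimpArgs false
set_option linter.unusedVariables false

section
variable {T : Set Formula} (hT : Extends T PAK4)
include hT

theorem box_imp {φ ψ : Formula} {V : Formula → Prop} (m : Mdl T V)
    (h : Provable T (φ.imp ψ)) (h2 : V (.box φ)) : V (.box ψ) := m.mp (K1 hT h) h2

theorem eq_box_var : Provable T ((Formula.eq (.var 0) (.var 1)).imp
    (.box (.eq (.var 0) (.var 1)))) := by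
  have h : Provable T (Formula.all 1 ((Formula.eq (.var 0) (.var 1)).imp
    (.box (.eq (.var 0) (.var 1))))) := by
    apply ind hT (x := 0)
    · rw [Formula.subst_all_ne (by simp)]
      apply Provable.gen
      apply ind hT (x := 1)
      · simp [Term.subst_var_ne (show 1 ≠ 0 by simp)]
        exact imp_of fun V m h => m.prov _ (.nec (.logic (.eqRefl _)))
      · simp [Term.subst_var_ne (show 1 ≠ 0 by simp)]
        refine imp_of fun V m _ => (m.imp _ _).2 fun h => ?_
        have := m.prov _ (s_ne hT (.var 1))
        rw [m.neg] at this
        exact (this (m.symm h)).elim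
    · rw [Formula.subst_all_ne (by simp)]
      apply allI _ (by simp [Formula.fv])
      apply ind hT (x := 1)
      · simp [Formula.subst_all_same, Term.subst_var_ne (show 1 ≠ 0 by simp),
          Term.subst_var_ne (show 0 ≠ 1 by simp)]
        refine imp_of fun V m _ => (m.imp _ _).2 fun h => ?_
        have := m.prov _ (s_ne hT (.var 0))
        rw [m.neg] at this
        exact (this h).elim
      · simp [Formula.subst_all_same, Term.subst_var_ne (show 1 ≠ 0 by simp),
          Term.subst_var_ne (show 0 ≠ 1 by simp)]
        refine imp_of fun V m _ => (m.imp _ _).2 fun h => (m.imp _ _).2 fun h2 => ?_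
        have := m.mp (allE' _ _) h
        rw [m.imp] at this
        exact box_imp hT m (.logic (.eqSucc _ _)) (this (m.mp (s_inj hT _ _) h2))
  exact .mp (allE' _ _) h

theorem eq_box (t u : Term) : Provable T ((Formula.eq t u).imp (.box (.eq t u))) := by
  have := QF.inst (by simp [QF, Formula.lt]) (eq_box_var hT) (v3 t u t)
  simpa [Formula.substAll, Term.substAll, v3, Formula.lt] using this

theorem lt_box (t u : Term) : Provable T ((Formula.lt t u).imp (.box (.lt t u))) := by
  have h : Provable T ((Formula.lt (.var 0) (.var 1)).imp (.box (.lt (.var 0) (.var 1)))) := by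
    refine lt_elim hT (imp_of fun V m h => ?_) (by simp [Formula.fv, Term.fv, Formula.lt])
    exact box_imp hT m (lt_intro hT _ _ _) (m.mp (eq_box hT _ _) h)
  have := QF.inst (by simp [QF, Formula.lt]) h (v3 t u t)
  simpa [Formula.substAll, Term.substAll, v3, Formula.lt] using this

theorem ne_box (t u : Term) :
    Provable T ((Formula.neg (.eq t u)).imp (.box (.neg (.eq t u)))) := by
  refine imp_of fun V m h => ?_
  have := m.prov _ (trich hT t u)
  rw [m.neg] at h
  simp only [m.or] at this
  rcases this with h2 | h2 | h2
  · exact (h h2).elim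
  · exact box_imp hT m (lt_ne hT _ _) (m.mp (lt_box hT _ _) h2)
  · refine box_imp hT m ?_ (m.mp (lt_box hT _ _) h2)
    refine imp_of fun V m h => ?_
    have := m.mp (lt_ne hT _ _) h
    rw [m.neg] at this ⊢
    exact fun h => this (m.symm h)

theorem leib_term (x : ℕ) (t s : Term) :
    Provable T ((Formula.eq (.var x) t).imp (.eq s (Term.subst x t s))) := by
  induction s with
  | var y =>
    by_cases h : y = x
    · subst h; simp; exact imp_of fun V m h => h
    · rw [Term.subst_var_ne h]; exact imp_of fun V m h => m.refl _
  | zero => exact imp_of fun V m h => m.refl _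
  | succ s ih => exact imp_of fun V m h => m.succ (m.mp ih h)
  | add s r ihs ihr => exact imp_of fun V m h => m.add (m.mp ihs h) (m.mp ihr h)
  | mul s r ihs ihr => exact imp_of fun V m h => m.mul (m.mp ihs h) (m.mp ihr h)

theorem leib (x : ℕ) (t : Term) (φ : Formula) (hf : φ.freeFor t x) :
    Provable T ((Formula.eq (.var x) t).imp (φ.iff (φ.subst x t))) := by
  have triv : ∀ ψ : Formula, Provable T ((Formula.eq (.var x) t).imp (ψ.iff ψ)) :=
    fun ψ => imp_of fun V m _ => (m.iff _ _).2 Iff.rfl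
  induction φ with
  | falsum => exact triv _
  | eq s r =>
    refine imp_of fun V m h => ?_
    simp only [Formula.subst_eq, m.iff]
    have h1 := m.mp (leib_term hT x t s) h
    have h2 := m.mp (leib_term hT x t r) h
    exact ⟨fun h => m.trans (m.symm h1) (m.trans h h2),
      fun h => m.trans h1 (m.trans h (m.symm h2))⟩
  | le s r =>
    refine imp_of fun V m h => ?_
    simp only [Formula.subst_le, m.iff]
    have h1 := m.mp (leib_term hT x t s) h
    have h2 := m.mp (leib_term hT x t r) h
    exact ⟨m.le h1 h2, m.le (m.symm h1) (m.symm h2)⟩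
  | and φ ψ ih1 ih2 =>
    refine imp_of fun V m h => ?_
    have h1 := m.mp (ih1 hf.1) h
    have h2 := m.mp (ih2 hf.2) h
    simp only [Formula.subst_and, m.iff, m.and] at *; tauto
  | or φ ψ ih1 ih2 =>
    refine imp_of fun V m h => ?_
    have h1 := m.mp (ih1 hf.1) h
    have h2 := m.mp (ih2 hf.2) h
    simp only [Formula.subst_or, m.iff, m.or] at *; tauto
  | imp φ ψ ih1 ih2 =>
    refine imp_of fun V m h => ?_
    have h1 := m.mp (ih1 hf.1) h
    have h2 := m.mp (ih2 hf.2) h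
    simp only [Formula.subst_imp, m.iff, m.imp] at *; tauto
  | neg φ ih =>
    refine imp_of fun V m h => ?_
    have h1 := m.mp (ih hf) h
    simp only [Formula.subst_neg, m.iff, m.neg] at *; tauto
  | box φ ih =>
    have h1 : Provable T ((Formula.eq (.var x) t).imp (φ.imp (φ.subst x t))) :=
      imp_of fun V m h => (m.imp _ _).2 ((m.iff _ _).1 (m.mp (ih hf) h)).1
    have h2 : Provable T ((Formula.eq (.var x) t).imp ((φ.subst x t).imp φ)) :=
      imp_of fun V m h => (m.imp _ _).2 ((m.iff _ _).1 (m.mp (ih hf) h)).2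
    refine imp_of fun V m h => ?_
    have h3 := m.mp (K2 hT h1) (m.mp (eq_box hT _ _) h)
    have h4 := m.mp (K2 hT h2) (m.mp (eq_box hT _ _) h)
    simp only [Formula.subst_box, m.iff, m.imp] at *; tauto
  | all y φ ih =>
    by_cases hxy : x = y
    · subst hxy; rw [Formula.subst_all_same]; exact triv _
    by_cases hxf : x ∉ φ.fv
    · rw [Formula.subst_not_fv]
      · exact triv _
      · simp [Formula.fv, hxf]
    rw [Formula.subst_all_ne (Ne.symm hxy)]
    have hf' : y ∉ t.fv ∧ φ.freeFor t x := by
      have := hf; simp only [Formula.freeFor] at this; tauto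
    have hy : y ∉ (Formula.eq (.var x) t).fv := by
      simp [Formula.fv, Term.fv, hf'.1, Ne.symm hxy]
    have h1 : Provable T (((Formula.eq (.var x) t).and (.all y φ)).imp (.all y (φ.subst x t))) := by
      refine allI (imp_of fun V m h => ?_) (by
        rw [Formula.fv, Finset.mem_union]; simp [hy]; simp [Formula.fv])
      rw [m.and] at h
      exact ((m.iff _ _).1 (m.mp (ih hf'.2) h.1)).1 (m.mp (allE' _ _) h.2)
    have h2 : Provable T (((Formula.eq (.var x) t).and (.all y (φ.subst x t))).imp (.all y φ)) := by
      refine allI (imp_of fun V m h => ?_) (by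
        rw [Formula.fv, Finset.mem_union]; simp [hy]; simp [Formula.fv])
      rw [m.and] at h
      exact ((m.iff _ _).1 (m.mp (ih hf'.2) h.1)).2 (m.mp (allE' _ _) h.2)
    refine imp_of fun V m h => ?_
    have h3 := m.prov _ h1
    have h4 := m.prov _ h2
    simp only [m.iff, m.imp, m.and] at *; tauto
  | ex y φ ih =>
    by_cases hxy : x = y
    · subst hxy; rw [Formula.subst_ex_same]; exact triv _
    by_cases hxf : x ∉ φ.fv
    · rw [Formula.subst_not_fv]
      · exact triv _
      · simp [Formula.fv, hxf]
    rw [Formula.subst_ex_ne (Ne.symm hxy)]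
    have hf' : y ∉ t.fv ∧ φ.freeFor t x := by
      have := hf; simp only [Formula.freeFor] at this; tauto
    have hy : y ∉ (Formula.eq (.var x) t).fv := by
      simp [Formula.fv, Term.fv, hf'.1, Ne.symm hxy]
    have h1 : Provable T ((Formula.ex y φ).imp ((Formula.eq (.var x) t).imp
        (.ex y (φ.subst x t)))) := by
      refine exE (imp_of fun V m h => (m.imp _ _).2 fun h2 => ?_) (by
        rw [Formula.fv, Finset.mem_union]; simp [hy]; simp [Formula.fv])
      exact m.mp (exI' _ _) (((m.iff _ _).1 (m.mp (ih hf'.2) h2)).1 h)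
    have h2 : Provable T ((Formula.ex y (φ.subst x t)).imp ((Formula.eq (.var x) t).imp
        (.ex y φ))) := by
      refine exE (imp_of fun V m h => (m.imp _ _).2 fun h2 => ?_) (by
        rw [Formula.fv, Finset.mem_union]; simp [hy]; simp [Formula.fv])
      exact m.mp (exI' _ _) (((m.iff _ _).1 (m.mp (ih hf'.2) h2)).2 h)
    refine imp_of fun V m h => ?_
    have h3 := m.prov _ h1
    have h4 := m.prov _ h2
    simp only [m.iff, m.imp, m.and] at *; tauto

end

theorem subst_ball {x u : ℕ} {s t : Term} {φ : Formula} (h : u ≠ x) (hu : u ∉ φ.fv) :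
    (Formula.ball x s φ).subst u t = Formula.ball x (Term.subst u t s) φ := by
  simp only [Formula.ball]
  rw [Formula.subst_all_ne (Ne.symm h)]
  simp [Formula.subst_not_fv hu, Term.subst_var_ne (Ne.symm h)]

section
variable {T : Set Formula} (hT : Extends T PAK4)
include hT

theorem ball_zero (x : ℕ) (φ : Formula) : Provable T (Formula.ball x .zero φ) := by
  refine .gen _ (imp_of fun V m h => ?_)
  have := m.prov _ (lt_zero hT (.var x))
  rw [m.neg] at this
  exact (this h).elim

theorem ball_succ {x u : ℕ} {φ : Formula} (hux : u ≠ x) (hu : bd φ ≤ u) :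
    Provable T ((Formula.ball x (.var u) φ).imp
      ((φ.subst x (.var u)).imp (Formula.ball x (.succ (.var u)) φ))) := by
  have h1 : Provable T (((Formula.ball x (.var u) φ).and (φ.subst x (.var u))).imp
      (Formula.ball x (.succ (.var u)) φ)) := by
    refine allI (imp_of fun V m h => (m.imp _ _).2 fun h2 => ?_) ?_
    · rw [m.and] at h
      have h3 := m.mp (lt_succ_cases hT _ _) h2
      rw [m.or] at h3
      rcases h3 with h3 | h3
      · exact (m.imp _ _).1 (m.mp (allE' _ _) h.1) h3
      · exact ((m.iff _ _).1 (m.mp (leib hT x _ φ (bd_freeFor hu x)) h3)).2 h.2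
    · simp only [Formula.fv, Formula.ball, Finset.mem_union, Finset.mem_erase]
      rintro (h | h)
      · exact h.1 rfl
      · obtain ⟨y, hy, h⟩ := Formula.mem_fv_substAll h
        by_cases hyx : y = x
        · subst hyx; simp [Term.fv] at h; exact hux h.symm
        · simp [Term.fv, hyx] at h; exact hyx h.symm
  refine imp_of fun V m h => (m.imp _ _).2 fun h2 => m.mp h1 ((m.and _ _).2 ⟨h, h2⟩)

theorem ball_succ_left {x u : ℕ} {φ : Formula} (hux : u ≠ x) :
    Provable T ((Formula.ball x (.succ (.var u)) φ).imp (Formula.ball x (.var u) φ)) := by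
  refine allI (imp_of fun V m h => (m.imp _ _).2 fun h2 => ?_) (by simp [Formula.ball, Formula.fv])
  exact (m.imp _ _).1 (m.mp (allE' _ _) h) (m.mp (lt_succ_of_lt hT _ _) h2)

theorem ball_succ_right {x u : ℕ} {φ : Formula} (hux : u ≠ x) (hu : bd φ ≤ u) :
    Provable T ((Formula.ball x (.succ (.var u)) φ).imp (φ.subst x (.var u))) := by
  have := allE (T := T) (x := x) (t := .var u)
    (φ := (Formula.lt (.var x) (.succ (.var u))).imp φ) ⟨trivial, bd_freeFor hu x⟩
  simp [Term.subst_var_ne hux] at this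
  refine imp_of fun V m h => ?_
  exact (m.imp _ _).1 (m.mp this h) (m.mp (lt_succ_of_eq hT _ _) (m.refl _))

theorem D0_stable {φ : Formula} (h : D0 φ) :
    Provable T (φ.imp (.box φ)) ∧ Provable T (φ.neg.imp (.box φ.neg)) := by
  induction h with
  | eq t u => exact ⟨eq_box hT t u, ne_box hT t u⟩
  | neg h ih =>
    refine ⟨ih.2, imp_of fun V m h => ?_⟩
    rename_i ψ
    simp only [m.neg, not_not] at h
    exact box_imp hT m (taut0 fun V hV => by simp only [hV.imp, hV.neg]; tauto) (m.mp ih.1 h)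
  | and h1 h2 ih1 ih2 =>
    rename_i φ ψ
    refine ⟨imp_of fun V m h => ?_, imp_of fun V m h => ?_⟩
    · rw [m.and] at h
      have := m.mp (K2 hT (.logic (.andI φ ψ))) (m.mp ih1.1 h.1)
      rw [m.imp] at this
      exact this (m.mp ih2.1 h.2)
    · rw [m.neg, m.and] at h
      by_cases hφ : V φ
      · have : V ψ.neg := by rw [m.neg]; tauto
        exact box_imp hT m (taut0 fun V hV => by simp only [hV.imp, hV.neg, hV.and]; tauto)
          (m.mp ih2.2 this)
      · have : V φ.neg := by rw [m.neg]; tauto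
        exact box_imp hT m (taut0 fun V hV => by simp only [hV.imp, hV.neg, hV.and]; tauto)
          (m.mp ih1.2 this)
  | ball hx h ih =>
    rename_i x t φ
    constructor
    · obtain ⟨u, hu, hux, hut⟩ : ∃ u, bd φ ≤ u ∧ u ≠ x ∧ True :=
        ⟨bd φ + x + 1, by omega, by omega, trivial⟩
      have huf := bd_fv hu
      have h1 : Provable T ((Formula.ball x (.var u) φ).imp (.box (.ball x (.var u) φ))) := by
        apply ind hT (x := u)
        · simp only [Formula.subst_imp, Formula.subst_box, subst_ball hux huf, Term.subst_var_same]
          exact imp_of fun V m _ => m.prov _ (.nec (ball_zero hT _ _))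
        · simp only [Formula.subst_imp, Formula.subst_box, subst_ball hux huf, Term.subst_var_same]
          have ih' := inst ih.1 (x := x) (.var u) ⟨bd_freeFor hu x, bd_freeFor hu x⟩
          simp only [Formula.subst_imp, Formula.subst_box] at ih'
          refine imp_of fun V m h => (m.imp _ _).2 fun h2 => ?_
          rw [m.imp] at h
          have h3 := h (m.mp (ball_succ_left hT hux) h2)
          have h4 := m.mp ih' (m.mp (ball_succ_right hT hux hu) h2)
          exact (m.imp _ _).1 (m.mp (K2 hT (ball_succ hT hux hu)) h3) h4
      have h2 := inst h1 (x := u) t (by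
        simp only [Formula.freeFor, Formula.ball, Formula.lt]
        have := Formula.freeFor_not_fv (s := t) huf
        tauto)
      simpa only [Formula.subst_imp, Formula.subst_box, subst_ball hux huf, Term.subst_var_same] using h2
    · have hb : Provable T ((Formula.bex x t φ.neg).imp (.box (Formula.ball x t φ).neg)) := by
        refine exE (imp_of fun V m h => ?_) (by simp [Formula.ball, Formula.fv])
        rw [m.and] at h
        have h1 := m.mp (lt_box hT _ _) h.1
        have h2 := m.mp ih.2 h.2
        have h3 : Provable T ((Formula.lt (.var x) t).imp (φ.neg.imp (Formula.ball x t φ).neg)) :=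
          taut1 (allE' x ((Formula.lt (.var x) t).imp φ)) fun V hV h => by
            simp only [hV.imp, hV.neg, Formula.ball] at *; tauto
        exact (m.imp _ _).1 (m.mp (K2 hT h3) h1) h2
      have hc : Provable T ((Formula.bex x t φ.neg).neg.imp (Formula.ball x t φ)) := by
        refine allI ?_ (by simp [Formula.bex, Formula.fv])
        exact taut1 (exI' x ((Formula.lt (.var x) t).and φ.neg)) fun V hV h => by
            simp only [hV.imp, hV.neg, hV.and, Formula.bex] at *; tauto
      exact taut2 hb hc fun V hV h1 h2 => by
        simp only [hV.imp, hV.neg] at *; tauto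

end
end ModalArith

namespace ModalArith
set_option linter.unusedSimpArgs false
set_option linter.unusedVariables false

theorem CV.not_fv {v : ℕ → Term} (h : CV v) {x : ℕ} {t : Term} (hx : x ∉ t.fv) :
    x ∉ (t.substAll v).fv := by
  intro hm
  obtain ⟨y, hy, hm⟩ := Term.mem_fv_substAll hm
  rcases h y with h | h
  · rw [h] at hm; simp [Term.fv] at hm; exact hx (hm ▸ hy)
  · simp [h] at hm

theorem ball_substAll (x : ℕ) (t : Term) (φ : Formula) (v : ℕ → Term) :
    (Formula.ball x t φ).substAll v =
      Formula.ball x (t.substAll (Function.update v x (.var x)))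
        (φ.substAll (Function.update v x (.var x))) := by
  simp [Formula.ball, Formula.substAll, Formula.lt, Term.substAll]

theorem D0.substAll {φ : Formula} (h : D0 φ) {v : ℕ → Term} (hv : CV v) : D0 (φ.substAll v) := by
  induction h generalizing v with
  | eq t u => exact .eq _ _
  | neg h ih => exact .neg (ih hv)
  | and h1 h2 ih1 ih2 => exact .and (ih1 hv) (ih2 hv)
  | ball hx h ih =>
    rw [ball_substAll]
    exact .ball ((hv.update _).not_fv hx) (ih (hv.update _))

def num (v : ℕ → ℕ) : ℕ → Term := fun i => .numeral (v i)

theorem num_cv (v : ℕ → ℕ) : CV (num v) := fun i => .inr (Term.numeral_fv _)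

section
variable {T : Set Formula} (hT : Extends T PAK4)
include hT

theorem num_add (n k : ℕ) :
    Provable T (.eq ((Term.numeral n).add (.numeral k)) (.numeral (n + k))) := by
  induction k with
  | zero => exact a_zero hT _
  | succ k ih => exact pr fun V m => m.trans (m.prov _ (a_succ hT _ _)) (m.succ (m.prov _ ih))

theorem num_mul (n k : ℕ) :
    Provable T (.eq ((Term.numeral n).mul (.numeral k)) (.numeral (n * k))) := by
  induction k with
  | zero => exact m_zero hT _
  | succ k ih =>
    exact pr fun V m => m.trans (m.prov _ (m_succ hT _ _))
      (m.trans (m.add (m.prov _ ih) (m.refl _)) (m.prov _ (num_add hT _ _)))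

theorem num_term (t : Term) (v : ℕ → ℕ) :
    Provable T (.eq (t.substAll (num v)) (.numeral (t.val v))) := by
  induction t with
  | var x => exact .logic (.eqRefl _)
  | zero => exact .logic (.eqRefl _)
  | succ t ih => exact pr fun V m => m.succ (m.prov _ ih)
  | add t u iht ihu =>
    exact pr fun V m => m.trans (m.add (m.prov _ iht) (m.prov _ ihu)) (m.prov _ (num_add hT _ _))
  | mul t u iht ihu =>
    exact pr fun V m => m.trans (m.mul (m.prov _ iht) (m.prov _ ihu)) (m.prov _ (num_mul hT _ _))

theorem num_lt {n k : ℕ} (h : n < k) : Provable T (.lt (.numeral n) (.numeral k)) := by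
  induction k with
  | zero => omega
  | succ k ih =>
    rcases Nat.lt_succ_iff_lt_or_eq.1 h with h | rfl
    · exact .mp (lt_succ_of_lt hT _ _) (ih h)
    · exact .mp (lt_succ_of_eq hT _ _) (.logic (.eqRefl _))

theorem num_ne {n k : ℕ} (h : n ≠ k) :
    Provable T (Formula.neg (.eq (.numeral n) (.numeral k))) := by
  rcases Nat.lt_or_gt_of_ne h with h | h
  · exact .mp (lt_ne hT _ _) (num_lt hT h)
  · refine pr fun V m => ?_
    have := m.mp (lt_ne hT _ _) (m.prov _ (num_lt hT h))
    rw [m.neg] at *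
    exact fun h => this (m.symm h)

theorem bounded {x k : ℕ} {ψ : Formula} (h : ∀ i < k, Provable T (ψ.subst x (.numeral i))) :
    Provable T ((Formula.lt (.var x) (.numeral k)).imp ψ) := by
  induction k with
  | zero =>
    exact taut1 (lt_zero hT (.var x)) fun V hV h => by
      simp only [hV.imp, hV.neg, Term.numeral] at *; tauto
  | succ k ih =>
    have ih := ih fun i hi => h i (by omega)
    refine imp_of fun V m h1 => ?_
    have h2 := m.mp (lt_succ_cases hT _ _) h1
    rw [m.or] at h2
    rcases h2 with h2 | h2
    · exact m.mp ih h2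
    · exact ((m.iff _ _).1 (m.mp (leib hT x _ ψ
        (Formula.freeFor_closed (Term.numeral_fv k) x ψ)) h2)).2 (m.prov _ (h k (by omega)))

theorem D0_dec {φ : Formula} (h : D0 φ) (v : ℕ → ℕ) :
    (φ.val v → Provable T (φ.substAll (num v))) ∧
    (¬ φ.val v → Provable T (φ.substAll (num v)).neg) := by
  induction h generalizing v with
  | eq t u =>
    have h1 := num_term hT t v
    have h2 := num_term hT u v
    simp only [Formula.val, Formula.substAll]
    constructor
    · intro h
      rw [h] at h1
      exact pr fun V m => m.trans (m.prov _ h1) (m.symm (m.prov _ h2))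
    · intro h
      refine pr fun V m => ?_
      have := m.prov _ (num_ne hT h)
      rw [m.neg] at *
      exact fun h => this (m.trans (m.symm (m.prov _ h1)) (m.trans h (m.prov _ h2)))
  | neg h ih =>
    simp only [Formula.val, Formula.substAll, not_not]
    exact ⟨(ih v).2, fun h => taut1 ((ih v).1 h) fun V hV h => by
      simp only [hV.neg] at *; tauto⟩
  | and h1 h2 ih1 ih2 =>
    simp only [Formula.val, Formula.substAll]
    constructor
    · intro h
      exact .mp (.mp (.logic (.andI _ _)) ((ih1 v).1 h.1)) ((ih2 v).1 h.2)
    · intro h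
      rw [not_and_or] at h
      rcases h with h | h
      · exact taut1 ((ih1 v).2 h) fun V hV h => by simp only [hV.neg, hV.and] at *; tauto
      · exact taut1 ((ih2 v).2 h) fun V hV h => by simp only [hV.neg, hV.and] at *; tauto
  | ball hx h ih =>
    rename_i x t ψ
    have ht : t.substAll (Function.update (num v) x (.var x)) = t.substAll (num v) :=
      Term.substAll_congr fun y hy => by
        rw [Function.update_of_ne]; rintro rfl; exact hx hy
    have hs : ∀ i, (ψ.substAll (Function.update (num v) x (.var x))).subst x (.numeral i) =
        ψ.substAll (num (Function.update v x i)) := by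
      intro i
      rw [Formula.subst, ((num_cv v).update x).substAll_substAll]
      congr 1
      funext y
      by_cases hy : y = x
      · subst hy; simp [Term.substAll, num]
      · simp [hy, num, Term.substAll_closed (Term.numeral_fv _)]
    rw [ball_substAll, ht, val_ball _ _ _ hx]
    have hk := num_term hT t v
    constructor
    · intro h
      have := bounded hT (x := x) (k := t.val v)
        (ψ := ψ.substAll (Function.update (num v) x (.var x))) (fun i hi => by
          rw [hs]; exact (ih _).1 (h i hi))
      refine .gen _ (imp_of fun V m h1 => ?_)
      exact m.mp this (m.lt (m.refl _) (m.prov _ hk) h1)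
    · intro h
      push Not at h
      obtain ⟨i, hi, h⟩ := h
      have h1 := (ih _).2 h
      rw [← hs] at h1
      have h2 := allE (T := T) (x := x) (t := .numeral i) (φ := (Formula.lt (.var x)
        (t.substAll (num v))).imp (ψ.substAll (Function.update (num v) x (.var x))))
        (Formula.freeFor_closed (Term.numeral_fv i) _ _)
      simp only [Formula.subst_imp, Formula.subst_lt, Term.subst_var_same] at h2
      rw [Term.subst_not_fv ((num_cv v).not_fv hx)] at h2
      refine pr fun V m => ?_
      have h1 := m.prov _ h1
      rw [m.neg] at *
      intro h3
      have h4 := m.mp h2 h3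
      rw [m.imp] at h4
      exact h1 (h4 (m.lt (m.refl _) (m.symm (m.prov _ hk)) (m.prov _ (num_lt hT hi))))

end

/-- Disjunction of boxed formulas. -/
def boxes : List Formula → Formula
  | [] => .falsum
  | a :: l => .or (.box a) (boxes l)

theorem boxes_fv {l : List Formula} (h : ∀ a ∈ l, a.fv = ∅) : (boxes l).fv = ∅ := by
  induction l with
  | nil => rfl
  | cons a l ih =>
    simp [boxes, Formula.fv, h a, ih fun b hb => h b (by simp [hb])]

theorem boxes_intro {T : Set Formula} {l : List Formula} {a : Formula} (h : a ∈ l) :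
    Provable T ((Formula.box a).imp (boxes l)) := by
  induction l with
  | nil => simp at h
  | cons b l ih =>
    rcases List.mem_cons.1 h with rfl | h
    · exact .logic (.orI1 _ _)
    · exact imp_of fun V m h2 => (m.or _ _).2 (.inr (m.mp (ih h) h2))

theorem or_box {T : Set Formula} (hT : Extends T PAK4) {φ ψ : Formula}
    (h1 : Provable T (φ.imp (.box φ))) (h2 : Provable T (ψ.imp (.box ψ))) :
    Provable T ((φ.or ψ).imp (.box (φ.or ψ))) := by
  refine imp_of fun V m h => ?_
  rw [m.or] at h
  rcases h with h | h
  · exact box_imp hT m (.logic (.orI1 _ _)) (m.mp h1 h)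
  · exact box_imp hT m (.logic (.orI2 _ _)) (m.mp h2 h)

theorem and_box {T : Set Formula} (hT : Extends T PAK4) {φ ψ : Formula}
    (h1 : Provable T (φ.imp (.box φ))) (h2 : Provable T (ψ.imp (.box ψ))) :
    Provable T ((φ.and ψ).imp (.box (φ.and ψ))) := by
  refine imp_of fun V m h => ?_
  rw [m.and] at h
  exact (m.imp _ _).1 (m.mp (K2 hT (.logic (.andI φ ψ))) (m.mp h1 h.1)) (m.mp h2 h.2)

theorem ex_box {T : Set Formula} (hT : Extends T PAK4) {φ : Formula} (x : ℕ)
    (h1 : Provable T (φ.imp (.box φ))) :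
    Provable T ((Formula.ex x φ).imp (.box (.ex x φ))) := by
  refine exE (imp_of fun V m h => ?_) (by simp [Formula.fv])
  exact box_imp hT m (exI' _ _) (m.mp h1 h)

theorem boxes_box {T : Set Formula} (hT : Extends T PAK4) (l : List Formula) :
    Provable T ((boxes l).imp (.box (boxes l))) := by
  induction l with
  | nil => exact .logic (.falsumE _)
  | cons a l ih => exact or_box hT (four hT a) ih

theorem mdp_list {T : Set Formula} (hT : Extends T PAK4) (hM : HasMDP T) (l : List Formula)
    (hl : ∀ a ∈ l, a.fv = ∅) (h : Provable T (boxes l)) :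
    (∃ a ∈ l, Provable T a) ∨ Provable T .falsum := by
  induction l with
  | nil => exact .inr h
  | cons a l ih =>
    have h1 : Provable T ((Formula.box a).or (.box (boxes l))) :=
      taut2 h (boxes_box hT l) fun V hV h1 h2 => by
        simp only [boxes, hV.or, hV.imp] at *; tauto
    rcases hM a (boxes l) (hl a (by simp)) (boxes_fv fun b hb => hl b (by simp [hb])) h1 with h2 | h2
    · exact .inl ⟨a, by simp, h2⟩
    · rcases ih (fun b hb => hl b (by simp [hb])) h2 with ⟨b, hb, h3⟩ | h3
      · exact .inl ⟨b, by simp [hb], h3⟩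
      · exact .inr h3

end ModalArith

namespace ModalArith
set_option linter.unusedSimpArgs false
set_option linter.unusedVariables false

def RR (x z : ℕ) (φ A B : Formula) : Formula :=
  .ex x (((Formula.box φ).or B).and (.ball z (.succ (.var x)) A.neg))
def RR' (x z : ℕ) (A B : Formula) : Formula :=
  .ex z (A.and (.ball x (.var z) B.neg))

section
variable {T : Set Formula} (hT : Extends T PAK4) {x z : ℕ} (hxz : x ≠ z) {φ A B : Formula}
  (hφ : φ.fv ⊆ {x}) (hA : A.fv ⊆ {z}) (hB : B.fv ⊆ {x})

include hxz hφ hA hB in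
theorem RR_fv : (RR x z φ A B).fv = ∅ ∧ (RR' x z A B).fv = ∅ := by
  constructor
  · simp only [RR, Formula.fv, Formula.ball, Formula.lt, Term.fv]
    ext i
    have h1 := @hφ i
    have h2 := @hA i
    have h3 := @hB i
    simp at *; tauto
  · simp only [RR', Formula.fv, Formula.ball, Formula.lt, Term.fv]
    ext i
    have h1 := @hφ i
    have h2 := @hA i
    have h3 := @hB i
    simp at *; tauto

include hT hxz hφ hA hB in
theorem core1 (h : Provable T (.ex x (.box φ))) :
    Provable T ((RR x z φ A B).or (RR' x z A B)) := by
  set D := (RR x z φ A B).or (RR' x z A B) with hD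
  have hDfv : D.fv = ∅ := by
    have := RR_fv hxz hφ hA hB
    rw [hD, Formula.fv, this.1, this.2]; rfl
  obtain ⟨w, hwA, hwB, hwφ, hwx, hwz⟩ : ∃ w, bd A ≤ w ∧ bd B ≤ w ∧ bd φ ≤ w ∧ w ≠ x ∧ w ≠ z :=
    ⟨bd A + bd B + bd φ + x + z + 1, by omega, by omega, by omega, by omega, by omega⟩
  have hDw : w ∉ D.fv := by simp [hDfv]
  have hAw : w ∉ A.neg.fv := bd_fv (φ := A.neg) hwA
  have hBw : w ∉ B.neg.fv := bd_fv (φ := B.neg) hwB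
  have hxA : x ∉ A.neg.fv := fun h => hxz (by simpa using hA h)
  have hzB : z ∉ B.neg.fv := fun h => hxz (Finset.mem_singleton.1 (hB h)).symm
  have e1 : Provable T (((A.subst z (.var w)).and (.ball x (.var w) B.neg)).imp D) := by
    have := exI (T := T) (x := z) (t := .var w) (φ := A.and (.ball x (.var z) B.neg))
      ⟨bd_freeFor hwA z, .inr (.inr ⟨by simpa [Term.fv] using Ne.symm hwx, trivial,
        bd_freeFor (φ := B.neg) hwB z⟩)⟩
    rw [Formula.subst_and, subst_ball (Ne.symm hxz) hzB, Term.subst_var_same] at this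
    exact imp_of fun V m h => (m.or _ _).2 (.inr (m.mp this h))
  have e2 : Provable T (((B.subst x (.var w)).and (.ball z (.succ (.var w)) A.neg)).imp D) := by
    have := exI (T := T) (x := x) (t := .var w)
      (φ := ((Formula.box φ).or B).and (.ball z (.succ (.var x)) A.neg))
      ⟨⟨bd_freeFor (φ := .box φ) hwφ x, bd_freeFor hwB x⟩,
        .inr (.inr ⟨by simpa [Term.fv] using Ne.symm hwz, trivial,
        bd_freeFor (φ := A.neg) hwA x⟩)⟩
    rw [Formula.subst_and, Formula.subst_or, subst_ball hxz hxA, Term.subst_succ,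
      Term.subst_var_same] at this
    refine imp_of fun V m h => (m.or _ _).2 (.inl (m.mp this ?_))
    simp only [m.and, m.or] at h ⊢; tauto
  have hI : Provable T (((Formula.ball z (.var w) A.neg).and (.ball x (.var w) B.neg)).or D) := by
    apply ind hT (x := w)
    · rw [Formula.subst_or, Formula.subst_and, subst_ball hwz hAw, subst_ball hwx hBw,
        Formula.subst_not_fv hDw, Term.subst_var_same]
      refine pr fun V m => ?_
      rw [m.or, m.and]
      exact .inl ⟨m.prov _ (ball_zero hT _ _), m.prov _ (ball_zero hT _ _)⟩
    · rw [Formula.subst_or, Formula.subst_and, subst_ball hwz hAw, subst_ball hwx hBw,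
        Formula.subst_not_fv hDw, Term.subst_var_same]
      refine imp_of fun V m h => ?_
      have h1 := m.prov _ e1
      have h2 := m.prov _ e2
      have h3 := m.prov _ (ball_succ hT (φ := A.neg) hwz hwA)
      have h4 := m.prov _ (ball_succ hT (φ := B.neg) hwx hwB)
      simp only [m.or, m.and, m.imp, Formula.subst_neg, m.neg] at h h1 h2 h3 h4 ⊢
      tauto
  have hJ : Provable T ((Formula.ball z (.var w) A.neg).or D) :=
    taut1 hI fun V hV h => by simp only [hV.or, hV.and] at *; tauto
  have hJ2 := inst hJ (x := w) (.succ (.var x))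
    ⟨.inr (.inr ⟨by simpa [Term.fv] using Ne.symm hxz, trivial,
      Formula.freeFor_not_fv (φ := A.neg) hAw⟩), Formula.freeFor_not_fv hDw⟩
  rw [Formula.subst_or, subst_ball hwz hAw, Formula.subst_not_fv hDw, Term.subst_var_same] at hJ2
  have e3 := exI' (T := T) x (((Formula.box φ).or B).and (.ball z (.succ (.var x)) A.neg))
  have e4 : Provable T ((Formula.box φ).imp D) := by
    refine imp_of fun V m h => ?_
    have h1 := m.prov _ hJ2
    have h2 := m.prov _ e3
    simp only [hD, RR, m.or, m.imp, m.and] at *; tauto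
  exact .mp (exE e4 (by simp [hDfv])) h

include hT hxz in
theorem core2 (hA0 : D0 A) (hB0 : D0 B)
    (h : Provable T ((RR x z φ A B).or (RR' x z A B))) :
    Provable T ((Formula.box (RR x z φ A B)).or (.box (RR' x z A B))) := by
  have h1 : Provable T ((RR x z φ A B).imp (.box (RR x z φ A B))) := by
    refine ex_box hT _ (and_box hT (or_box hT (four hT _) (D0_stable hT hB0).1) ?_)
    exact (D0_stable hT (.ball (by simpa [Term.fv] using Ne.symm hxz) (.neg hA0))).1
  have h2 : Provable T ((RR' x z A B).imp (.box (RR' x z A B))) := by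
    refine ex_box hT _ (and_box hT (D0_stable hT hA0).1 ?_)
    exact (D0_stable hT (.ball (by simpa [Term.fv] using hxz) (.neg hB0))).1
  exact taut3 h h1 h2 fun V hV a b c => by simp only [hV.or, hV.imp] at *; tauto

include hT hxz hφ in
theorem core3 (hM : HasMDP T) (h : Provable T (RR x z φ A B)) {k : ℕ}
    (hAk : Provable T (A.subst z (.numeral k)))
    (hBk : ∀ i < k, Provable T (B.subst x (.numeral i)).neg) :
    ∃ n, Provable T (φ.subst x (.numeral n)) := by
  set L := (List.range k).map fun i => φ.subst x (.numeral i) with hL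
  have hLs : ∀ a ∈ L, a.fv = ∅ := by
    intro a ha
    simp only [hL, List.mem_map] at ha
    obtain ⟨i, -, rfl⟩ := ha
    rw [Finset.eq_empty_iff_forall_notMem]
    intro y hy
    obtain ⟨y', hy', hy⟩ := Formula.mem_fv_substAll hy
    have := hφ hy'
    simp at this
    subst this
    simp [Term.numeral_fv] at hy
  have hLf := boxes_fv hLs
  have b1 : Provable T ((Formula.lt (.var x) (.numeral k)).imp B.neg) := bounded hT hBk
  have b2 : Provable T ((Formula.lt (.var x) (.numeral k)).imp ((Formula.box φ).imp (boxes L))) :=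
    bounded hT fun i hi => by
      rw [Formula.subst_imp, Formula.subst_not_fv (φ := boxes L) (by simp [hLf])]
      exact boxes_intro (by simp only [hL, List.mem_map]; exact ⟨i, by simpa using hi, rfl⟩)
  have b3 := allE (T := T) (x := z) (t := .numeral k)
    (φ := (Formula.lt (.var z) (.succ (.var x))).imp A.neg)
    (Formula.freeFor_closed (Term.numeral_fv k) _ _)
  simp only [Formula.subst_imp, Formula.subst_lt, Term.subst_var_same, Term.subst_succ,
    Term.subst_var_ne hxz, Formula.subst_neg] at b3
  have b4 : Provable T (boxes L) := by
    refine .mp (exE (imp_of fun V m h => ?_) (by simp [hLf])) h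
    have c1 := m.prov _ b1
    have c2 := m.prov _ b2
    have c3 := m.prov _ b3
    have c4 := m.prov _ hAk
    have c5 := m.prov _ (trich hT (.numeral k) (.var x))
    have c6 := m.prov _ (lt_succ_of_lt hT (.numeral k) (.var x))
    have c7 := m.prov _ (lt_succ_of_eq hT (.numeral k) (.var x))
    simp only [m.or, m.and, m.imp, m.neg, Formula.ball] at h c1 c2 c3 c5 c6 c7
    tauto
  rcases mdp_list hT hM L hLs b4 with ⟨a, ha, h⟩ | h
  · simp only [hL, List.mem_map] at ha
    obtain ⟨i, -, rfl⟩ := ha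
    exact ⟨i, h⟩
  · exact ⟨0, .mp (.logic (.falsumE _)) h⟩

include hT hxz in
theorem core4 (h : Provable T (RR' x z A B)) {k : ℕ}
    (hBk : Provable T (B.subst x (.numeral k)))
    (hAk : ∀ i < k + 1, Provable T (A.subst z (.numeral i)).neg) :
    Provable T .falsum := by
  have b1 : Provable T ((Formula.lt (.var z) (.numeral (k + 1))).imp A.neg) := bounded hT hAk
  have b3 := allE (T := T) (x := x) (t := .numeral k)
    (φ := (Formula.lt (.var x) (.var z)).imp B.neg)
    (Formula.freeFor_closed (Term.numeral_fv k) _ _)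
  simp only [Formula.subst_imp, Formula.subst_lt, Term.subst_var_same, Term.subst_succ,
    Term.subst_var_ne (Ne.symm hxz), Formula.subst_neg] at b3
  refine .mp (exE (imp_of fun V m h => ?_) (by simp [Formula.fv])) h
  have c1 := m.prov _ b1
  have c3 := m.prov _ b3
  have c4 := m.prov _ hBk
  have c5 := m.prov _ (trich hT (.var z) (.numeral k))
  have c6 := m.prov _ (lt_succ_of_lt hT (.var z) (.numeral k))
  have c7 := m.prov _ (lt_succ_of_eq hT (.var z) (.numeral k))
  simp only [m.or, m.and, m.imp, m.neg, Formula.ball, Term.numeral] at h c1 c3 c5 c6 c7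
  tauto

include hT in
theorem mep_mdp (hM : HasMEP T) : HasMDP T := by
  intro φ ψ hφ hψ h
  have hφ0 : 0 ∉ φ.fv := by rw [hφ]; simp
  have hψ0 : 0 ∉ ψ.fv := by rw [hψ]; simp
  let E : Formula := .eq (.var 0) .zero
  let χ : Formula := (E.and φ).or (E.neg.and ψ)
  have hs : ∀ t, χ.subst 0 t = ((Formula.eq t .zero).and φ).or ((Formula.eq t .zero).neg.and ψ) := by
    intro t
    simp [χ, E, Formula.subst_not_fv hφ0, Formula.subst_not_fv hψ0]
  have h0 : Provable T (Formula.eq (.numeral 0) .zero) := .logic (.eqRefl _)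
  have h1 : ∀ n, Provable T (Formula.eq (.numeral (n + 1)) .zero).neg := fun n => s_ne hT _
  have e1 : Provable T (φ.imp (χ.subst 0 (.numeral 0))) := by
    rw [hs]
    exact taut1 h0 fun V hV h => by simp only [hV.imp, hV.or, hV.and] at *; tauto
  have e2 : Provable T (ψ.imp (χ.subst 0 (.numeral 1))) := by
    rw [hs]
    exact taut1 (h1 0) fun V hV h => by
      simp only [hV.imp, hV.or, hV.and] at *; tauto
  have i1 := exI (T := T) (x := 0) (t := .numeral 0) (φ := .box χ)
    (Formula.freeFor_closed (Term.numeral_fv _) _ _)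
  have i2 := exI (T := T) (x := 0) (t := .numeral 1) (φ := .box χ)
    (Formula.freeFor_closed (Term.numeral_fv _) _ _)
  rw [Formula.subst_box] at i1 i2
  have hex : Provable T (.ex 0 (.box χ)) := by
    refine pr fun V m => ?_
    have := m.prov _ h
    rw [m.or] at this
    rcases this with h | h
    · exact m.mp i1 (box_imp hT m e1 h)
    · exact m.mp i2 (box_imp hT m e2 h)
  obtain ⟨n, hn⟩ := hM 0 χ (by
    simp only [χ, E, Formula.fv, Term.fv]; rw [hφ, hψ]; simp) hex
  rw [hs] at hn
  cases n with
  | zero =>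
    exact .inl (taut2 hn h0 fun V hV h1 h2 => by
      simp only [hV.imp, hV.or, hV.and, hV.neg] at *; tauto)
  | succ n =>
    exact .inr (taut2 hn (h1 n) fun V hV h1 h2 => by
      simp only [hV.imp, hV.or, hV.and, hV.neg] at *; tauto)

end

/-- Keep variables `a` and `u`, replace all others by zero. -/
def keep (a u : ℕ) : ℕ → Term := fun i => if i = a ∨ i = u then .var i else .zero

theorem keep_cv (a u : ℕ) : CV (keep a u) := by
  intro i
  by_cases h : i = a ∨ i = u
  · simp [keep, h]
  · simp [keep, h, Term.fv]

def keepn (a u n : ℕ) : ℕ → Term :=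
  fun i => if i = u then .numeral n else if i = a then .var i else .zero

theorem keepn_cv (a u n : ℕ) : CV (keepn a u n) := by
  intro i
  by_cases h : i = u
  · simp [keepn, h, Term.numeral_fv]
  · by_cases h2 : i = a
    · subst h2; simp [keepn, h]
    · simp [keepn, h, h2, Term.fv]

theorem keep_subst {a u n : ℕ} (α : Formula) :
    (α.substAll (keep a u)).subst u (.numeral n) = α.substAll (keepn a u n) := by
  rw [Formula.subst, (keep_cv a u).substAll_substAll]
  congr 1
  funext i
  by_cases h : i = u
  · simp [keep, keepn, h, Term.substAll]
  · by_cases h2 : i = a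
    · subst h2; simp [keep, keepn, h, Term.substAll]
    · simp [keep, keepn, h, h2, Term.substAll]

theorem keepn_fv {a u n : ℕ} (α : Formula) : (α.substAll (keepn a u n)).fv ⊆ {a} := by
  intro y hy
  obtain ⟨i, -, hy⟩ := Formula.mem_fv_substAll hy
  by_cases h : i = u
  · simp [keepn, h, Term.numeral_fv] at hy
  · by_cases h2 : i = a
    · subst h2; simpa [keepn, h, Term.fv] using hy
    · simp [keepn, h, h2, Term.fv] at hy

theorem keepn_subst {a u n k : ℕ} (hau : a ≠ u) (α : Formula) :
    (α.substAll (keepn a u n)).subst a (.numeral k) =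
      α.substAll (num fun i => if i = u then n else if i = a then k else 0) := by
  rw [Formula.subst, (keepn_cv a u n).substAll_substAll]
  congr 1
  funext i
  by_cases h : i = u
  · simp [keepn, num, h, Term.substAll_closed (Term.numeral_fv _)]
  · by_cases h2 : i = a
    · subst h2; simp [keepn, num, h, Term.substAll]
    · simp [keepn, num, h, h2, Term.substAll, Term.numeral]

theorem keepn_dec {T : Set Formula} (hT : Extends T PAK4) {a u n k : ℕ} (hau : a ≠ u)
    {α : Formula} (hα : D0 α) {Q : ℕ → ℕ → Prop} (hQ : ∀ v, α.val v ↔ Q (v a) (v u)) :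
    (Q k n → Provable T ((α.substAll (keepn a u n)).subst a (.numeral k))) ∧
    (¬ Q k n → Provable T ((α.substAll (keepn a u n)).subst a (.numeral k)).neg) := by
  rw [keepn_subst hau]
  have := D0_dec hT hα (fun i => if i = u then n else if i = a then k else 0)
  rw [hQ] at this
  simpa [hau] using this

theorem ball_subst_num {z u n : ℕ} (h : z ≠ u) (t : Term) (ht : u ∉ t.fv) (ψ : Formula) :
    (Formula.ball z t ψ.neg).subst u (.numeral n) = .ball z t (ψ.subst u (.numeral n)).neg := by
  simp only [Formula.ball]
  rw [Formula.subst_all_ne h]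
  simp [Term.subst_var_ne h, Term.subst_not_fv ht]

theorem mdp_mep {T : Set Formula} (hre : RE T) (hT : Extends T PAK4) (hM : HasMDP T) :
    HasMEP T := by
  intro x φ hφ hex
  obtain ⟨z, u, hxz, hxu, hzu⟩ : ∃ z u : ℕ, x ≠ z ∧ x ≠ u ∧ z ≠ u :=
    ⟨x + 1, x + 2, by omega, by omega, by omega⟩
  have s1 : SD (fun m => Pf T u (lft m) m) := by
    simpa using (SD.pf hre u).comp (f := fun m => Nat.pair (lft m) m) (by fun_prop)
  have s2 : SD (fun m => Pf T u (rgt m) m) := by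
    simpa using (SD.pf hre u).comp (f := fun m => Nat.pair (rgt m) m) (by fun_prop)
  unfold SD at s1 s2
  obtain ⟨QA, hQA, -, hA⟩ := s1
  obtain ⟨QB, hQB, -, hB⟩ := s2
  obtain ⟨α, hα0, hα⟩ := hQA z u hzu
  obtain ⟨β, hβ0, hβ⟩ := hQB x u hxu
  obtain ⟨r, hr⟩ : ∃ r, r = RR x z φ (α.substAll (keep z u)) (β.substAll (keep x u)) := ⟨_, rfl⟩
  obtain ⟨r', hr'⟩ : ∃ r, r = RR' x z (α.substAll (keep z u)) (β.substAll (keep x u)) := ⟨_, rfl⟩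
  obtain ⟨n, hn⟩ : ∃ n, n = Nat.pair r.code r'.code := ⟨_, rfl⟩
  set A := α.substAll (keepn z u n) with hAdef
  set B := β.substAll (keepn x u n) with hBdef
  have huφ : u ∉ φ.fv := fun h => hxu (Finset.mem_singleton.1 (hφ h)).symm
  have er : r.subst u (.numeral n) = RR x z φ A B := by
    rw [hr, RR, Formula.subst_ex_ne hxu, Formula.subst_and, Formula.subst_or, Formula.subst_box,
      Formula.subst_not_fv huφ, ball_subst_num hzu _ (by simpa [Term.fv] using Ne.symm hxu),
      keep_subst, keep_subst]
    rfl
  have er' : r'.subst u (.numeral n) = RR' x z A B := by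
    rw [hr', RR', Formula.subst_ex_ne hzu, Formula.subst_and,
      ball_subst_num hxu _ (by simpa [Term.fv] using Ne.symm hzu),
      keep_subst, keep_subst]
    rfl
  have pA : Provable T (RR x z φ A B) ↔ ∃ k, QA k n := by
    have e : lft n = r.code := by rw [hn, lft_pair]
    rw [← hA, ← er]
    show _ ↔ Pf T u (lft n) n
    rw [e]
    constructor
    · exact fun h => ⟨r, rfl, h⟩
    · rintro ⟨χ, hχ, h⟩
      rw [Formula.code_inj] at hχ
      rwa [hχ] at h
  have pB : Provable T (RR' x z A B) ↔ ∃ k, QB k n := by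
    have e : rgt n = r'.code := by rw [hn, rgt_pair]
    rw [← hB, ← er']
    show _ ↔ Pf T u (rgt n) n
    rw [e]
    constructor
    · exact fun h => ⟨r', rfl, h⟩
    · rintro ⟨χ, hχ, h⟩
      rw [Formula.code_inj] at hχ
      rwa [hχ] at h
  have hAfv : A.fv ⊆ {z} := keepn_fv α
  have hBfv : B.fv ⊆ {x} := keepn_fv β
  have c1 := core1 hT hxz hφ hAfv hBfv hex
  have c2 := core2 hT hxz (hα0.substAll (keepn_cv z u n)) (hβ0.substAll (keepn_cv x u n)) c1
  have hfv := RR_fv hxz hφ hAfv hBfv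
  have c3 := hM _ _ hfv.1 hfv.2 c2
  have hk : ∃ k, QA k n ∨ QB k n := by
    rcases c3 with h | h
    · obtain ⟨k, hk⟩ := pA.1 h; exact ⟨k, .inl hk⟩
    · obtain ⟨k, hk⟩ := pB.1 h; exact ⟨k, .inr hk⟩
  classical
  have hmin : ∀ i < Nat.find hk, ¬ QA i n ∧ ¬ QB i n := fun i hi => by
    have := Nat.find_min hk hi; tauto
  have hsp := Nat.find_spec hk
  generalize Nat.find hk = k at hmin hsp
  by_cases hQ : QA k n
  · exact core3 hT hxz hφ hM (pA.2 ⟨k, hQ⟩) ((keepn_dec hT hzu hα0 hα).1 hQ)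
      fun i hi => (keepn_dec hT hxu hβ0 hβ).2 (hmin i hi).2
  · have hQ2 : QB k n := by tauto
    refine ⟨0, .mp (.logic (.falsumE _)) (core4 hT hxz (pB.2 ⟨k, hQ2⟩)
      ((keepn_dec hT hxu hβ0 hβ).1 hQ2) fun i hi => (keepn_dec hT hzu hα0 hα).2 ?_)⟩
    rcases Nat.lt_succ_iff_lt_or_eq.1 hi with hi | rfl
    · exact (hmin i hi).1
    · exact hQ

end ModalArith

namespace ModalArith

/-- For any r.e. extension T of PA(K4), T has MDP iff T has MEP. -/
theorem statement17 (T : Set Formula) (hre : RE T) (hT : Extends T PAK4) :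
    HasMDP T ↔ HasMEP T :=
  ⟨mdp_mep hre hT, mep_mdp hT⟩

end ModalArith
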